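/- For every reduced expression i of w_0 and every Lusztig data a ∈ ℤ_{≥0}^N, the bar involution applied to the PBW monomial F_i^a satisfies: bar(F_i^a) = F_i^a + Σ_{a′ ≺ a} p^a_{a′}(q) F_i^{a′}, where the sum is over Lusztig data a′ strictly less than a in the partial order ≺, and each coefficient p^a_{a′}(q) is a Laurent polynomial in q. -/

import Mathlib

/-!
Common setup: the quantized universal enveloping algebra `U_q(𝔤)` of a simple
complex Lie algebra of type ADE, presented by the Chevalley generators
`E i`, `F i`, `K i`, `K i⁻¹` over `ℚ(q)`, together with the combinatorics of
words in the Weyl group, PBW root vectors and monomials, Lusztig's braid group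
automorphisms, the bar involution, lattices, and partial orders on Lusztig data.
-/

noncomputable section

open scoped BigOperators

/-- The base field `ℚ(q)`. -/
abbrev 𝕂 : Type := RatFunc ℚ

/-- The indeterminate `q ∈ ℚ(q)`. -/
noncomputable def qq : 𝕂 := RatFunc.X

/-- The Cartan matrix attached to an adjacency function: `2` on the diagonal,
`-1` for adjacent vertices, `0` otherwise. -/
def cartanOf {I : Type} [DecidableEq I] (adj : I → I → Bool) (i j : I) : ℤ :=
  if i = j then 2 else if adj i j then -1 else 0

/-- The datum of a simply laced (ADE) Dynkin diagram of a simple Lie algebra: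
a finite nonempty vertex set with a symmetric irreflexive adjacency relation,
connected (simple `𝔤`), whose Cartan matrix is positive definite (finite type;
together with simply-lacedness this characterizes types A, D, E). -/
structure ADEData (I : Type) [Fintype I] [DecidableEq I] : Type where
  nonE : Nonempty I
  adj : I → I → Bool
  symm : ∀ i j, adj i j = adj j i
  irrefl : ∀ i, adj i i = false
  conn : ∀ i j : I, Relation.ReflTransGen (fun a b => adj a b = true) i j
  posdef : ∀ v : I → ℚ, v ≠ 0 → 0 < ∑ i, ∑ j, (cartanOf adj i j : ℚ) * v i * v j

variable {I : Type} [Fintype I] [DecidableEq I]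

/-- Generators `E i`, `F i`, `K i`, `K i⁻¹` of `U_q(𝔤)`. -/
inductive Gen (I : Type) : Type
  | E : I → Gen I
  | F : I → Gen I
  | K : I → Gen I
  | Kinv : I → Gen I

/-- The free `ℚ(q)`-algebra on the generators. -/
abbrev FA (I : Type) := FreeAlgebra 𝕂 (Gen I)

def gE (i : I) : FA I := FreeAlgebra.ι 𝕂 (Gen.E i)
def gF (i : I) : FA I := FreeAlgebra.ι 𝕂 (Gen.F i)
def gK (i : I) : FA I := FreeAlgebra.ι 𝕂 (Gen.K i)
def gKinv (i : I) : FA I := FreeAlgebra.ι 𝕂 (Gen.Kinv i)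

/-- The defining relations of `U_q(𝔤)` (type ADE). -/
inductive QRel (D : ADEData I) : FA I → FA I → Prop
  | KKinv (i : I) : QRel D (gK i * gKinv i) 1
  | KinvK (i : I) : QRel D (gKinv i * gK i) 1
  | KcommK (i j : I) : QRel D (gK i * gK j) (gK j * gK i)
  | KEself (i : I) : QRel D (gK i * gE i * gKinv i) ((qq ^ 2) • gE i)
  | KFself (i : I) : QRel D (gK i * gF i * gKinv i) ((qq ^ 2)⁻¹ • gF i)
  | EFdiff (i j : I) (h : i ≠ j) : QRel D (gE i * gF j - gF j * gE i) 0
  | EFself (i : I) :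
      QRel D (gE i * gF i - gF i * gE i) ((qq - qq⁻¹)⁻¹ • (gK i - gKinv i))
  | serreE (i j : I) (h : D.adj i j = true) :
      QRel D (gE i ^ 2 * gE j + gE j * gE i ^ 2) ((qq + qq⁻¹) • (gE i * gE j * gE i))
  | serreF (i j : I) (h : D.adj i j = true) :
      QRel D (gF i ^ 2 * gF j + gF j * gF i ^ 2) ((qq + qq⁻¹) • (gF i * gF j * gF i))
  | KEadj (i j : I) (h : D.adj i j = true) :
      QRel D (gK i * gE j * gKinv i) (qq⁻¹ • gE j)
  | KFadj (i j : I) (h : D.adj i j = true) :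
      QRel D (gK i * gF j * gKinv i) (qq • gF j)
  | EEfar (i j : I) (h : i ≠ j) (h' : D.adj i j = false) :
      QRel D (gE i * gE j) (gE j * gE i)
  | FFfar (i j : I) (h : i ≠ j) (h' : D.adj i j = false) :
      QRel D (gF i * gF j) (gF j * gF i)
  | KEfar (i j : I) (h : i ≠ j) (h' : D.adj i j = false) :
      QRel D (gK i * gE j * gKinv i) (gE j)
  | KFfar (i j : I) (h : i ≠ j) (h' : D.adj i j = false) :
      QRel D (gK i * gF j * gKinv i) (gF j)

/-- The quantized universal enveloping algebra `U_q(𝔤)`. -/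
abbrev Uq (D : ADEData I) := RingQuot (QRel D)

/-- The generator `E i` of `U_q(𝔤)`. -/
def EE (D : ADEData I) (i : I) : Uq D := RingQuot.mkAlgHom 𝕂 (QRel D) (gE i)
/-- The generator `F i` of `U_q(𝔤)`. -/
def FF (D : ADEData I) (i : I) : Uq D := RingQuot.mkAlgHom 𝕂 (QRel D) (gF i)
/-- The generator `K i` of `U_q(𝔤)`. -/
def KK (D : ADEData I) (i : I) : Uq D := RingQuot.mkAlgHom 𝕂 (QRel D) (gK i)
/-- The generator `K i ⁻¹` of `U_q(𝔤)`. -/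
def KKinv (D : ADEData I) (i : I) : Uq D := RingQuot.mkAlgHom 𝕂 (QRel D) (gKinv i)

/-- The quantum integer `[n] = q^{n-1} + q^{n-3} + ⋯ + q^{-n+1}`. -/
def qInt (n : ℕ) : 𝕂 := ∑ t ∈ Finset.range n, qq ^ ((n : ℤ) - 1 - 2 * (t : ℤ))

/-- The quantum factorial `[n]! = [n][n-1]⋯[2][1]`. -/
def qFact (n : ℕ) : 𝕂 := ∏ t ∈ Finset.range n, qInt (t + 1)

/-- The `q`-divided power `X^{(n)} = X^n / [n]!`. -/
def dp {D : ADEData I} (x : Uq D) (n : ℕ) : Uq D := (qFact n)⁻¹ • x ^ n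

/-- `U_q^-(𝔤)`: the subalgebra generated by the `F i`. -/
def Uminus (D : ADEData I) : Subalgebra 𝕂 (Uq D) :=
  Algebra.adjoin 𝕂 (Set.range (FF D))

/-- `U_q^{≥0}(𝔤)`: the subalgebra generated by the `E i` and `K i^{±1}`. -/
def Ugeq0 (D : ADEData I) : Subalgebra 𝕂 (Uq D) :=
  Algebra.adjoin 𝕂 (Set.range (EE D) ∪ Set.range (KK D) ∪ Set.range (KKinv D))

/-- A family of algebra automorphisms `T i` is the family of Lusztig braid
automorphisms if it takes the prescribed values on all generators. -/
def IsLusztigAuts (D : ADEData I) (T : I → (Uq D ≃ₐ[𝕂] Uq D)) : Prop :=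
  ∀ i j : I,
    (T i (FF D i) = -(KKinv D i * EE D i)) ∧
    (D.adj i j = true → T i (FF D j) = FF D j * FF D i - qq • (FF D i * FF D j)) ∧
    (i ≠ j → D.adj i j = false → T i (FF D j) = FF D j) ∧
    (T i (EE D i) = -(FF D i * KK D i)) ∧
    (D.adj i j = true → T i (EE D j) = EE D i * EE D j - qq⁻¹ • (EE D j * EE D i)) ∧
    (i ≠ j → D.adj i j = false → T i (EE D j) = EE D j) ∧
    (T i (KK D i) = KKinv D i) ∧
    (D.adj i j = true → T i (KK D j) = KK D i * KK D j) ∧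
    (i ≠ j → D.adj i j = false → T i (KK D j) = KK D j)

/-- The Cartan matrix of the diagram. -/
def cartan (D : ADEData I) : I → I → ℤ := cartanOf D.adj

/-- The simple root `α i`, as a vector in the root lattice `ℤ^I`. -/
def simpleRoot (i : I) : I → ℤ := fun j => if j = i then 1 else 0

/-- The standard pairing `(v, α i)` on the root lattice. -/
def pairing (D : ADEData I) (v : I → ℤ) (i : I) : ℤ := ∑ j, v j * cartan D j i

/-- The simple reflection `s i` acting on the root lattice. -/
def sref (D : ADEData I) (i : I) (v : I → ℤ) : I → ℤ :=
  fun j => v j - pairing D v i * simpleRoot i j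

/-- Action of a word `(i₁, …, i_N)` on the root lattice: `s_{i₁} ∘ ⋯ ∘ s_{i_N}`. -/
def wordAct (D : ADEData I) : List I → (I → ℤ) → (I → ℤ)
  | [] => fun v => v
  | i :: l => fun v => sref D i (wordAct D l v)

/-- A word in the generators of the Weyl group is reduced if no shorter word
defines the same element (i.e., the same action on the root lattice). -/
def IsReducedWord (D : ADEData I) (w : List I) : Prop :=
  ∀ w' : List I, wordAct D w' = wordAct D w → w.length ≤ w'.length

/-- `w` is a reduced expression of the longest element `w₀` of the Weyl group. -/
def IsRedW0 (D : ADEData I) (w : List I) : Prop :=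
  IsReducedWord D w ∧ ∀ w' : List I, IsReducedWord D w' → w'.length ≤ w.length

/-- The root `β_k = s_{i₁} ⋯ s_{i_{k-1}} (α_{i_k})` attached to the `k`-th letter
of the word `w` (here `k` is 0-indexed). -/
def beta (D : ADEData I) (w : List I) (k : Fin w.length) : I → ℤ :=
  wordAct D (w.take k) (simpleRoot (w.get k))

/-- `v` is a root: it lies in the Weyl group orbit of a simple root. -/
def IsRoot (D : ADEData I) (v : I → ℤ) : Prop :=
  ∃ (l : List I) (i : I), v = wordAct D l (simpleRoot i)

/-- `v` is a positive root. -/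
def IsPosRoot (D : ADEData I) (v : I → ℤ) : Prop :=
  IsRoot D v ∧ ∀ j, 0 ≤ v j

/-- Apply `T_{i₁} ∘ T_{i₂} ∘ ⋯ ∘ T_{i_m}` for a word `(i₁, …, i_m)`. -/
def applyT {D : ADEData I} (T : I → (Uq D ≃ₐ[𝕂] Uq D)) : List I → Uq D → Uq D
  | [], x => x
  | i :: l, x => T i (applyT T l x)

/-- Apply `T_{i_m}^{-1} ∘ ⋯ ∘ T_{i₁}^{-1}` for a word `(i₁, …, i_m)`. -/
def applyTinv {D : ADEData I} (T : I → (Uq D ≃ₐ[𝕂] Uq D)) : List I → Uq D → Uq D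
  | [], x => x
  | i :: l, x => applyTinv T l ((T i).symm x)

/-- The PBW root vector `F_{i;β_k} = T_{i₁} ⋯ T_{i_{k-1}} (F_{i_k})`
(`k` is 0-indexed). -/
def rootVec {D : ADEData I} (T : I → (Uq D ≃ₐ[𝕂] Uq D)) (w : List I)
    (k : Fin w.length) : Uq D :=
  applyT T (w.take k) (FF D (w.get k))

/-- The PBW monomial `F^a = F_{β₁}^{(a₁)} F_{β₂}^{(a₂)} ⋯ F_{β_N}^{(a_N)}`
attached to the Lusztig datum `a`. -/
def pbw {D : ADEData I} (T : I → (Uq D ≃ₐ[𝕂] Uq D)) (w : List I)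
    (a : Fin w.length → ℕ) : Uq D :=
  ((List.finRange w.length).map (fun k => dp (rootVec T w k) (a k))).prod

/-- `u` is a homogeneous element of weight `μ` for the root-lattice grading of
`U_q(𝔤)`: conjugation by `K i` multiplies it by `q^{(μ, α_i)}`. -/
def HasWeight (D : ADEData I) (u : Uq D) (μ : I → ℤ) : Prop :=
  ∀ i, KK D i * u * KKinv D i = (qq ^ pairing D μ i) • u

/-- The weight `Σ_k a_k β_k` of a Lusztig datum. -/
def wtData (D : ADEData I) (w : List I) (a : Fin w.length → ℕ) : I → ℤ :=
  ∑ k, (a k : ℤ) • beta D w k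

/-- `a` is less than `b` in the left lexicographic order on Lusztig data:
at the first index where they differ, `a` is **bigger**. -/
def LtLeft {N : ℕ} (a b : Fin N → ℕ) : Prop :=
  ∃ k, b k < a k ∧ ∀ l, l < k → a l = b l

/-- `a` is less than `b` in the right lexicographic order on Lusztig data:
at the last index where they differ, `a` is **bigger**. -/
def LtRight {N : ℕ} (a b : Fin N → ℕ) : Prop :=
  ∃ k, b k < a k ∧ ∀ l, k < l → a l = b l

/-- The partial order `≺` on Lusztig data: same weight, and strictly smaller in
both lexicographic orders. -/
def Prec (D : ADEData I) (w : List I) (a b : Fin w.length → ℕ) : Prop :=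
  wtData D w a = wtData D w b ∧ LtLeft a b ∧ LtRight a b

/-- Two words are related by a single braid move. -/
def BraidMove (D : ADEData I) (w w' : List I) : Prop :=
  (∃ (w₁ w₂ : List I) (a b : I), a ≠ b ∧ D.adj a b = false ∧
      w = w₁ ++ a :: b :: w₂ ∧ w' = w₁ ++ b :: a :: w₂) ∨
  (∃ (w₁ w₂ : List I) (a b : I), D.adj a b = true ∧
      w = w₁ ++ a :: b :: a :: w₂ ∧ w' = w₁ ++ b :: a :: b :: w₂)

instance : Algebra (Polynomial ℤ) 𝕂 :=
  ((Polynomial.aeval qq : Polynomial ℤ →ₐ[ℤ] 𝕂)).toRingHom.toAlgebra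

instance (D : ADEData I) : Module (Polynomial ℤ) (Uq D) :=
  Module.compHom _ (algebraMap (Polynomial ℤ) 𝕂)

/-- The `ℤ[q]`-lattice `𝓛` spanned by the PBW monomials of `B_i`. -/
def latt {D : ADEData I} (T : I → (Uq D ≃ₐ[𝕂] Uq D)) (w : List I) :
    Submodule (Polynomial ℤ) (Uq D) :=
  Submodule.span (Polynomial ℤ) (Set.range (pbw T w))

/-- The sublattice `q𝓛`. -/
def qlatt {D : ADEData I} (T : I → (Uq D ≃ₐ[𝕂] Uq D)) (w : List I) :
    Submodule (Polynomial ℤ) (Uq D) :=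
  Submodule.span (Polynomial ℤ) ((fun x => qq • x) '' ((latt T w : Submodule (Polynomial ℤ) (Uq D)) : Set (Uq D)))

/-- `bar` is the bar involution: the `ℚ`-algebra involution fixing `E i` and
`F i`, sending `K i` to `K i⁻¹` and `q` to `q⁻¹`. -/
def IsBar (D : ADEData I) (bar : Uq D →+* Uq D) : Prop :=
  (∀ i, bar (EE D i) = EE D i) ∧ (∀ i, bar (FF D i) = FF D i) ∧
  (∀ i, bar (KK D i) = KKinv D i) ∧
  bar (algebraMap 𝕂 (Uq D) qq) = algebraMap 𝕂 (Uq D) qq⁻¹ ∧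
  ∀ x, bar (bar x) = x

/-- `c ∈ ℚ(q)` is a Laurent polynomial in `q`. -/
def IsLaurent (c : 𝕂) : Prop :=
  ∃ (f : Polynomial ℚ) (m : ℕ), c = qq⁻¹ ^ m * Polynomial.aeval qq f

/-- `b` is (an indexing of) the canonical basis: it lies in the lattice `𝓛`,
its residues mod `q𝓛` are the residues of the PBW monomials, and it is
bar-invariant. -/
def IsCanBasis {D : ADEData I} (T : I → (Uq D ≃ₐ[𝕂] Uq D)) (w : List I)
    (bar : Uq D →+* Uq D) (b : (Fin w.length → ℕ) → Uq D) : Prop :=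
  (∀ a, b a ∈ latt T w) ∧ (∀ a, b a - pbw T w a ∈ qlatt T w) ∧ (∀ a, bar (b a) = b a)

/-- The braid move from `w` to `w'` does not change the relative position of the
roots `u` and `v` in the enumerations of positive roots attached to `w`, `w'`. -/
def SameRelPos (D : ADEData I) (w w' : List I) (u v : I → ℤ) : Prop :=
  ∀ (k l : Fin w.length) (k' l' : Fin w'.length),
    beta D w k = u → beta D w l = v → beta D w' k' = u → beta D w' l' = v →
    ((k : ℕ) < (l : ℕ) ↔ (k' : ℕ) < (l' : ℕ))

/-- The subring `ℚ[q]₀ ⊆ ℚ(q)` of rational functions regular at `q = 0`. -/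
def Reg0 : Subring 𝕂 where
  carrier := {x | ∃ f g : Polynomial ℚ, Polynomial.eval 0 g ≠ 0 ∧
    x * algebraMap (Polynomial ℚ) 𝕂 g = algebraMap (Polynomial ℚ) 𝕂 f}
  zero_mem' := ⟨0, 1, by simp, by simp⟩
  one_mem' := ⟨1, 1, by simp, by simp⟩
  add_mem' := by
    rintro x y ⟨f1, g1, h1, e1⟩ ⟨f2, g2, h2, e2⟩
    refine ⟨f1 * g2 + f2 * g1, g1 * g2, by simpa using mul_ne_zero h1 h2, ?_⟩
    rw [map_mul, map_add, map_mul, map_mul, ← e1, ← e2]; ring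
  mul_mem' := by
    rintro x y ⟨f1, g1, h1, e1⟩ ⟨f2, g2, h2, e2⟩
    refine ⟨f1 * f2, g1 * g2, by simpa using mul_ne_zero h1 h2, ?_⟩
    rw [map_mul, map_mul, ← e1, ← e2]; ring
  neg_mem' := by
    rintro x ⟨f, g, h, e⟩
    exact ⟨-f, g, h, by rw [map_neg, ← e]; ring⟩

instance (D : ADEData I) : Module ↥Reg0 (Uq D) :=
  Module.compHom _ (Reg0.subtype)

/-- Iterated application of a family of operators along a word. -/
def applyOps {D : ADEData I} (Ft : I → Uq D → Uq D) : List I → Uq D → Uq D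
  | [], x => x
  | i :: l, x => Ft i (applyOps Ft l x)

/-- Kashiwara's lattice `𝓛(∞)`: the `ℚ[q]₀`-span of all elements obtained from
`1` by applying sequences of the Kashiwara operators. -/
def lattInf {D : ADEData I} (Ft : I → Uq D → Uq D) : Submodule ↥Reg0 (Uq D) :=
  Submodule.span ↥Reg0 {x : Uq D | ∃ l : List I, x = applyOps Ft l 1}

/-- The sublattice `q𝓛(∞)`. -/
def qlattInf {D : ADEData I} (Ft : I → Uq D → Uq D) : Submodule ↥Reg0 (Uq D) :=
  Submodule.span ↥Reg0 ((fun x => qq • x) '' ((lattInf Ft : Submodule ↥Reg0 (Uq D)) : Set (Uq D)))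

end


namespace QProof
section Weyl
set_option linter.unusedSectionVars false
set_option linter.unusedSimpArgs false
set_option linter.unusedVariables false
open Finset

variable {I : Type} [Fintype I] [DecidableEq I] (D : ADEData I)

theorem cartan_symm (i j : I) : cartan D i j = cartan D j i := by
  unfold cartan cartanOf
  rw [D.symm i j]
  by_cases h : i = j
  · subst h; simp
  · simp [h, Ne.symm h]

theorem cartan_self (i : I) : cartan D i i = 2 := by simp [cartan, cartanOf]

theorem cartan_adj {i j : I} (h : D.adj i j = true) : cartan D i j = -1 := by
  have : i ≠ j := by rintro rfl; simp [D.irrefl] at h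
  simp [cartan, cartanOf, this, h]

theorem cartan_far {i j : I} (h : i ≠ j) (h' : D.adj i j = false) : cartan D i j = 0 := by
  simp [cartan, cartanOf, h, h']

theorem cartan_nonpos {i j : I} (h : i ≠ j) : cartan D i j ≤ 0 := by
  simp only [cartan, cartanOf, if_neg h]; split <;> simp

theorem adj_ne {i j : I} (h : D.adj i j = true) : i ≠ j := by
  rintro rfl; simp [D.irrefl] at h

/-- simple reflection as linear map -/
def pairL (i : I) : (I → ℤ) →ₗ[ℤ] ℤ where
  toFun v := pairing D v i
  map_add' u v := by simp [pairing, add_mul, sum_add_distrib]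
  map_smul' c v := by simp [pairing, mul_sum, mul_assoc]

theorem pairing_add (u v : I → ℤ) (i : I) : pairing D (u + v) i = pairing D u i + pairing D v i :=
  (pairL D i).map_add u v
theorem pairing_sub (u v : I → ℤ) (i : I) : pairing D (u - v) i = pairing D u i - pairing D v i :=
  (pairL D i).map_sub u v
theorem pairing_smul (c : ℤ) (v : I → ℤ) (i : I) : pairing D (c • v) i = c * pairing D v i :=
  (pairL D i).map_smul c v

theorem pairing_simple (i j : I) : pairing D (simpleRoot i) j = cartan D i j := by
  simp [pairing, simpleRoot]

theorem sref_eq (i : I) (v : I → ℤ) : sref D i v = v - pairing D v i • simpleRoot i := by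
  ext j; simp [sref]

def wL : List I → ((I → ℤ) →ₗ[ℤ] (I → ℤ))
  | [] => LinearMap.id
  | i :: l => (LinearMap.id - (pairL D i).smulRight (simpleRoot i)).comp (wL l)

theorem wL_eq (l : List I) (v : I → ℤ) : wL D l v = wordAct D l v := by
  induction l with
  | nil => rfl
  | cons i l ih =>
    simp only [wL, wordAct, sref_eq, LinearMap.comp_apply, ih]
    rfl

theorem act_add (l : List I) (u v : I → ℤ) : wordAct D l (u + v) = wordAct D l u + wordAct D l v := by
  simp [← wL_eq]
theorem act_sub (l : List I) (u v : I → ℤ) : wordAct D l (u - v) = wordAct D l u - wordAct D l v := by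
  simp [← wL_eq]
theorem act_neg (l : List I) (u : I → ℤ) : wordAct D l (-u) = -wordAct D l u := by
  simp [← wL_eq]
theorem act_smul (l : List I) (c : ℤ) (v : I → ℤ) : wordAct D l (c • v) = c • wordAct D l v := by
  rw [← wL_eq, ← wL_eq, map_smul]
theorem act_sum (l : List I) {ι : Type} (s : Finset ι) (f : ι → I → ℤ) :
    wordAct D l (∑ k ∈ s, f k) = ∑ k ∈ s, wordAct D l (f k) := by
  simp [← wL_eq]
theorem act_zero (l : List I) : wordAct D l 0 = 0 := by simp [← wL_eq]

theorem act_append (l m : List I) (v : I → ℤ) :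
    wordAct D (l ++ m) v = wordAct D l (wordAct D m v) := by
  induction l with
  | nil => rfl
  | cons i l ih => simp [wordAct, ih]

theorem act_cons (i : I) (m : List I) (v : I → ℤ) :
    wordAct D (i :: m) v = sref D i (wordAct D m v) := rfl
theorem act_single (i : I) (v : I → ℤ) :
    wordAct D [i] v = sref D i v := rfl
theorem act_nil (v : I → ℤ) : wordAct D [] v = v := rfl

theorem sref_sref (i : I) (v : I → ℤ) : sref D i (sref D i v) = v := by
  rw [sref_eq, sref_eq, pairing_sub, pairing_smul, pairing_simple, cartan_self]
  module

theorem sref_self (i : I) : sref D i (simpleRoot i) = - simpleRoot i := by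
  rw [sref_eq, pairing_simple, cartan_self]; module

theorem sref_adj {i j : I} (h : D.adj i j = true) :
    sref D i (simpleRoot j) = simpleRoot i + simpleRoot j := by
  rw [sref_eq, pairing_simple, cartan_symm, cartan_adj D h]; module

theorem sref_far {i j : I} (h : i ≠ j) (h' : D.adj i j = false) :
    sref D i (simpleRoot j) = simpleRoot j := by
  rw [sref_eq, pairing_simple, cartan_symm, cartan_far D h h']; module

/-- bilinear form -/
def BF (u v : I → ℤ) : ℤ := ∑ i, u i * pairing D v i

theorem BF_add_left (u u' v : I → ℤ) : BF D (u + u') v = BF D u v + BF D u' v := by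
  simp [BF, add_mul, sum_add_distrib]
theorem BF_smul_left (c : ℤ) (u v : I → ℤ) : BF D (c • u) v = c * BF D u v := by
  simp [BF, mul_sum, mul_assoc]
theorem BF_symm (u v : I → ℤ) : BF D u v = BF D v u := by
  simp only [BF, pairing, mul_sum]
  rw [sum_comm]
  refine sum_congr rfl fun i _ => sum_congr rfl fun j _ => ?_
  rw [cartan_symm D i j]; ring
theorem BF_sub_left (u u' v : I → ℤ) : BF D (u - u') v = BF D u v - BF D u' v := by
  simp [BF, sub_mul, sum_sub_distrib]
theorem BF_sub_right (u v v' : I → ℤ) : BF D u (v - v') = BF D u v - BF D u v' := by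
  rw [BF_symm, BF_sub_left, BF_symm D v, BF_symm D v']
theorem BF_add_right (u v v' : I → ℤ) : BF D u (v + v') = BF D u v + BF D u v' := by
  rw [BF_symm, BF_add_left, BF_symm D v, BF_symm D v']
theorem BF_smul_right (c : ℤ) (u v : I → ℤ) : BF D u (c • v) = c * BF D u v := by
  rw [BF_symm, BF_smul_left, BF_symm]
theorem BF_simple_left (i : I) (v : I → ℤ) : BF D (simpleRoot i) v = pairing D v i := by
  simp [BF, simpleRoot]
theorem BF_simple_right (i : I) (v : I → ℤ) : BF D v (simpleRoot i) = pairing D v i := by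
  rw [BF_symm, BF_simple_left]

theorem BF_sref (i : I) (u v : I → ℤ) : BF D (sref D i u) (sref D i v) = BF D u v := by
  simp only [sref_eq, BF_sub_left, BF_sub_right, BF_smul_left, BF_smul_right, BF_simple_left,
    BF_simple_right, pairing_sub, pairing_smul, pairing_simple, cartan_self]
  ring

theorem BF_act (l : List I) (u v : I → ℤ) : BF D (wordAct D l u) (wordAct D l v) = BF D u v := by
  induction l with
  | nil => rfl
  | cons i l ih => rw [act_cons, act_cons, BF_sref, ih]

theorem BF_pos (v : I → ℤ) (hv : v ≠ 0) : 0 < BF D v v := by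
  have := D.posdef (fun i => (v i : ℚ)) (by
    intro h; apply hv; ext i; have := congrFun h i; simpa using this)
  have h2 : ((BF D v v : ℤ) : ℚ) = ∑ i, ∑ j, (cartanOf D.adj i j : ℚ) * v i * v j := by
    simp only [BF, pairing, mul_sum]
    push_cast
    refine sum_congr rfl fun i _ => sum_congr rfl fun j _ => ?_
    rw [show cartan D j i = cartan D i j from cartan_symm D j i]
    simp only [cartan]; ring
  rw [← h2] at this
  exact_mod_cast this

theorem eq_sum_simple (v : I → ℤ) : v = ∑ i, v i • simpleRoot i := by
  ext j; simp [simpleRoot]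

theorem BF_even (v : I → ℤ) : Even (BF D v v) := by
  let S : AddSubgroup (I → ℤ) :=
    { carrier := {v | Even (BF D v v)}
      zero_mem' := by simp [BF]
      add_mem' := by
        intro a b ha hb
        simp only [Set.mem_ofPred_eq, BF_add_left, BF_add_right] at *
        rw [BF_symm D b a, show BF D a a + BF D a b + (BF D a b + BF D b b) =
          BF D a a + BF D b b + 2 * BF D a b by ring]
        exact (ha.add hb).add (even_two_mul _)
      neg_mem' := by
        intro a ha
        simp only [Set.mem_ofPred_eq] at *
        rwa [show -a = (-1 : ℤ) • a by simp, BF_smul_left, BF_smul_right,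
          show (-1 : ℤ) * (-1 * BF D a a) = BF D a a by ring] }
  have : v ∈ S := by
    rw [eq_sum_simple v]
    refine S.sum_mem fun i _ => S.zsmul_mem ?_ _
    show Even (BF D _ _)
    rw [BF_simple_left, pairing_simple, cartan_self]; exact even_two
  exact this

theorem sign_coherent (v : I → ℤ) (h : BF D v v = 2) : (0 ≤ v) ∨ (v ≤ 0) := by
  by_contra hc
  push Not at hc
  obtain ⟨h1, h2⟩ := hc
  have e : v = v⁺ - v⁻ := (posPart_sub_negPart v).symm
  have hp : v⁺ ≠ 0 := fun h0 => h2 (posPart_eq_zero.1 h0)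
  have hn : v⁻ ≠ 0 := fun h0 => h1 (negPart_eq_zero.1 h0)
  have b1 := BF_pos D _ hp
  have b2 := BF_pos D _ hn
  obtain ⟨c1, e1⟩ := BF_even D v⁺
  obtain ⟨c2, e2⟩ := BF_even D v⁻
  have hc : BF D v⁺ v⁻ ≤ 0 := by
    simp only [BF, pairing, mul_sum]
    refine sum_nonpos fun i _ => sum_nonpos fun j _ => ?_
    by_cases hij : j = i
    · subst hij
      rw [← mul_assoc]
      have : v⁺ j * v⁻ j = 0 := by
        simp only [Pi.posPart_apply, Pi.negPart_apply]
        rcases le_total 0 (v j) with h | h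
        · rw [negPart_eq_zero.2 h]; simp
        · rw [posPart_eq_zero.2 h]; simp
      rw [this]; simp
    · have := cartan_nonpos D hij
      have h3 : 0 ≤ v⁺ i := posPart_nonneg v i
      have h4 : 0 ≤ v⁻ j := negPart_nonneg v j
      have := mul_nonneg h3 h4
      nlinarith [mul_nonneg h3 h4]
  have : BF D v v = BF D v⁺ v⁺ + BF D v⁻ v⁻ - 2 * BF D v⁺ v⁻ := by
    conv_lhs => rw [e]
    rw [BF_sub_left, BF_sub_right, BF_sub_right, BF_symm D v⁻ v⁺]; ring
  omega

theorem simple_norm (i : I) : BF D (simpleRoot i) (simpleRoot i) = 2 := by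
  rw [BF_simple_left, pairing_simple, cartan_self]

theorem simple_nonneg (i : I) : (0 : I → ℤ) ≤ simpleRoot i := by
  intro j; simp only [simpleRoot]; split <;> simp

theorem simple_ne_zero (i : I) : (simpleRoot i : I → ℤ) ≠ 0 := by
  intro h; have := congrFun h i; simp [simpleRoot] at this

theorem act_norm (l : List I) (i : I) :
    BF D (wordAct D l (simpleRoot i)) (wordAct D l (simpleRoot i)) = 2 := by
  rw [BF_act, simple_norm]

theorem norm_ne_zero {v : I → ℤ} (h : BF D v v = 2) : v ≠ 0 := by
  rintro rfl; simp [BF] at h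

theorem act_inj (l : List I) {u v : I → ℤ} (h : wordAct D l u = wordAct D l v) : u = v := by
  induction l with
  | nil => exact h
  | cons i l ih =>
    apply ih
    have := congrArg (sref D i) h
    rwa [act_cons, act_cons, sref_sref, sref_sref] at this

/-- a positive root all of whose mass is at i equals α_i -/
theorem pos_eq_simple {v : I → ℤ} (h : BF D v v = 2) (hp : 0 ≤ v) (i : I)
    (h0 : ∀ j, j ≠ i → v j = 0) : v = simpleRoot i := by
  have e : v = v i • simpleRoot i := by
    ext j; by_cases hj : j = i
    · subst hj; simp [simpleRoot]
    · simp [simpleRoot, hj, h0 j hj]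
  rw [e, BF_smul_left, BF_smul_right, simple_norm] at h
  have h1 : 0 ≤ v i := hp i
  have : v i = 1 := by nlinarith
  rw [e, this, one_smul]

theorem sref_pos {v : I → ℤ} (h : BF D v v = 2) (hp : 0 ≤ v) (i : I) (hne : v ≠ simpleRoot i) :
    0 ≤ sref D i v := by
  rcases sign_coherent D (sref D i v) (by rw [BF_sref, h]) with h1 | h1
  · exact h1
  · exfalso
    apply hne
    apply pos_eq_simple D h hp
    intro j hj
    have a := h1 j
    have b := hp j
    simp [sref, simpleRoot, hj] at a b
    omega

theorem conj_refl (y : List I) (i j : I) (h : wordAct D y (simpleRoot i) = simpleRoot j) :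
    wordAct D (j :: y) = wordAct D (y ++ [i]) := by
  ext1 u
  rw [act_append, act_single, act_cons, sref_eq, sref_eq, act_sub, act_smul, h,
    ← BF_simple_right, ← h, BF_act, BF_simple_right]

theorem exchange (x : List I) (i : I) (h : ¬ 0 ≤ wordAct D x (simpleRoot i)) :
    ∃ x' : List I, x'.length + 1 = x.length ∧ wordAct D x' = wordAct D (x ++ [i]) := by
  induction x with
  | nil => exact absurd (simple_nonneg i) h
  | cons j x ih =>
    by_cases hx : 0 ≤ wordAct D x (simpleRoot i)
    · have hj : wordAct D x (simpleRoot i) = simpleRoot j := by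
        by_contra hne
        exact h (sref_pos D (act_norm D x i) hx j hne)
      refine ⟨x, by simp, ?_⟩
      have := conj_refl D x i j hj
      ext1 u
      rw [List.cons_append, act_cons, ← congrFun this u, act_cons, sref_sref]
    · obtain ⟨x', h1, h2⟩ := ih hx
      refine ⟨j :: x', by simp [h1], ?_⟩
      ext1 u
      rw [List.cons_append, act_cons, act_cons, h2]

theorem not_nonneg_of_nonpos {v : I → ℤ} (h : BF D v v = 2) (h1 : v ≤ 0) : ¬ 0 ≤ v :=
  fun h2 => norm_ne_zero D h (le_antisymm h1 h2)

theorem nonpos_of_not {v : I → ℤ} (h : BF D v v = 2) (h1 : ¬ 0 ≤ v) : v ≤ 0 :=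
  (sign_coherent D v h).resolve_left h1

variable {D}

theorem act_snoc_cancel {x y : List I} {i : I}
    (h : wordAct D (x ++ [i]) = wordAct D (y ++ [i])) : wordAct D x = wordAct D y := by
  ext1 u
  have := congrFun h (sref D i u)
  rwa [act_append, act_append, act_single, sref_sref] at this

theorem act_snoc_congr {x y : List I} (z : List I)
    (h : wordAct D x = wordAct D y) : wordAct D (x ++ z) = wordAct D (y ++ z) := by
  ext1 u; rw [act_append, act_append, h]

theorem act_append_congr (z : List I) {x y : List I} 
    (h : wordAct D x = wordAct D y) : wordAct D (z ++ x) = wordAct D (z ++ y) := by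
  ext1 u; rw [act_append, act_append, h]

theorem act_snoc_snoc (x : List I) (i : I) : wordAct D (x ++ [i] ++ [i]) = wordAct D x := by
  ext1 u; simp only [act_append, act_single, sref_sref]

theorem red_left {x y : List I} (h : IsReducedWord D (x ++ y)) : IsReducedWord D x := by
  intro z hz
  have := h (z ++ y) (act_snoc_congr y hz)
  simpa using this

theorem red_right {x y : List I} (h : IsReducedWord D (x ++ y)) : IsReducedWord D y := by
  intro z hz
  have := h (x ++ z) (act_append_congr x hz)
  simpa using this

theorem red_nil : IsReducedWord D ([] : List I) := fun _ _ => by simp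

theorem red_congr {x y : List I} (h : IsReducedWord D x) (e : wordAct D y = wordAct D x)
    (hl : y.length = x.length) : IsReducedWord D y := by
  intro z hz; rw [hl]; exact h z (hz.trans e)

theorem red_len {x y : List I} (hx : IsReducedWord D x) (hy : IsReducedWord D y)
    (e : wordAct D y = wordAct D x) : y.length = x.length :=
  le_antisymm (hy x e.symm) (hx y e)

theorem red_pos {x : List I} {i : I} (h : IsReducedWord D (x ++ [i])) :
    0 ≤ wordAct D x (simpleRoot i) := by
  by_contra hc
  obtain ⟨x', h1, h2⟩ := exchange D x i hc
  have := h x' h2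
  simp at this; omega

theorem red_snoc {x : List I} {i : I} (h : IsReducedWord D x)
    (hp : 0 ≤ wordAct D x (simpleRoot i)) : IsReducedWord D (x ++ [i]) := by
  intro y hy
  by_contra hlt
  have hlt : y.length ≤ x.length := by simp at hlt; omega
  have e1 : wordAct D (y ++ [i]) = wordAct D x := by
    rw [act_snoc_congr [i] hy, act_snoc_snoc]
  have e2 : wordAct D y (simpleRoot i) = - wordAct D x (simpleRoot i) := by
    rw [hy, act_append, act_single, sref_self, act_neg]
  have hneg : ¬ 0 ≤ wordAct D y (simpleRoot i) := by
    rw [e2]; intro h0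
    exact norm_ne_zero D (act_norm D x i) (le_antisymm (by simpa using h0) hp)
  obtain ⟨y', h1, h2⟩ := exchange D y i hneg
  have := h y' (h2.trans e1)
  omega

theorem red_descent {x : List I} {i : I} (h : IsReducedWord D x)
    (hn : wordAct D x (simpleRoot i) ≤ 0) :
    ∃ x', IsReducedWord D (x' ++ [i]) ∧ wordAct D (x' ++ [i]) = wordAct D x := by
  obtain ⟨x', h1, h2⟩ := exchange D x i (not_nonneg_of_nonpos D (act_norm D x i) hn)
  have e : wordAct D (x' ++ [i]) = wordAct D x := by
    rw [act_snoc_congr [i] h2, act_snoc_snoc]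
  exact ⟨x', red_congr h e (by simp [h1]), e⟩

theorem red_neg {x : List I} {i : I} (h : IsReducedWord D (x ++ [i])) :
    wordAct D (x ++ [i]) (simpleRoot i) ≤ 0 := by
  rw [act_append, act_single, sref_self, act_neg]
  simpa using red_pos h

theorem act_cons_snoc_ne {x : List I} {i j : I} (h : IsReducedWord D (x ++ [i] ++ [j])) : i ≠ j := by
  rintro rfl
  have := h x (act_snoc_snoc x i).symm
  simp at this

theorem matsumoto {r : List I → List I → Prop} (hr : ∀ x, r x x) (hs : ∀ x y, r x y → r y x)
    (ht : ∀ x y z, r x y → r y z → r x z) (hc : ∀ x y i, r x y → r (x ++ [i]) (y ++ [i]))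
    (hf : ∀ z i j, i ≠ j → D.adj i j = false → r (z ++ [i] ++ [j]) (z ++ [j] ++ [i]))
    (hn : ∀ z i j, D.adj i j = true → r (z ++ [i] ++ [j] ++ [i]) (z ++ [j] ++ [i] ++ [j])) :
    ∀ (n : ℕ) (u v : List I), u.length = n → IsReducedWord D u → IsReducedWord D v →
      wordAct D u = wordAct D v → r u v := by
  intro n
  induction n using Nat.strong_induction_on with
  | _ n ih =>
  intro u v hl hu hv e
  have hlv := red_len hu hv e.symm
  -- same-last-letter case
  have same : ∀ (a b : List I) (i : I), (a ++ [i]).length = n → IsReducedWord D (a ++ [i]) →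
      IsReducedWord D (b ++ [i]) → wordAct D (a ++ [i]) = wordAct D (b ++ [i]) →
      r (a ++ [i]) (b ++ [i]) := by
    intro a b i hla ha hb hab
    exact hc _ _ _ (ih a.length (by simp at hla; omega) a b rfl (red_left ha) (red_left hb)
      (act_snoc_cancel hab))
  rcases List.eq_nil_or_concat' u with rfl | ⟨u', i, rfl⟩
  · have : v = [] := List.length_eq_zero_iff.1 (by simpa using hlv)
    subst this; exact hr _
  rcases List.eq_nil_or_concat' v with rfl | ⟨v', j, rfl⟩
  · simp at hlv
  by_cases hij : i = j
  · subst hij; exact same _ _ _ hl hu hv e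
  have hj : wordAct D (u' ++ [i]) (simpleRoot j) ≤ 0 := by rw [e]; exact red_neg hv
  cases hadj : D.adj i j
  · have h1 : wordAct D u' (simpleRoot j) ≤ 0 := by
      rwa [act_append, act_single, sref_far D hij hadj] at hj
    obtain ⟨z, hz, ez⟩ := red_descent (red_left hu) h1
    have c1 : wordAct D (z ++ [j] ++ [i]) = wordAct D (u' ++ [i]) := act_snoc_congr _ ez
    have c1r : IsReducedWord D (z ++ [j] ++ [i]) := red_congr hu c1 (by
      have := red_len (red_left hu) hz ez
      simpa using this)
    have c2 : wordAct D (z ++ [i] ++ [j]) = wordAct D (z ++ [j] ++ [i]) := by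
      ext1 v
      simp only [act_append, act_single]
      congr 1
      simp only [sref_eq, pairing_sub, pairing_smul, pairing_simple, cartan_far D hij hadj,
        cartan_symm D j i]
      module
    have c2r : IsReducedWord D (z ++ [i] ++ [j]) := red_congr c1r c2 (by simp)
    refine ht _ _ _ (same _ _ _ hl hu c1r c1.symm) (ht _ _ _ (hs _ _ (hf z i j hij hadj)) ?_)
    exact same _ _ _ (by rw [red_len hu c2r (c2.trans c1)]; exact hl) c2r hv
      ((c2.trans c1).trans e)
  · have hadj' : D.adj j i = true := by rw [D.symm]; exact hadj
    have h1 : wordAct D u' (simpleRoot j) ≤ 0 := by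
      have e1 : wordAct D u' (simpleRoot j) = wordAct D (u' ++ [i]) (simpleRoot i) +
          wordAct D (u' ++ [i]) (simpleRoot j) := by
        rw [← act_add, act_append, act_single, ← sref_adj D hadj, sref_sref]
      rw [e1]; exact add_nonpos (red_neg hu) hj
    obtain ⟨z', hz', ez'⟩ := red_descent (red_left hu) h1
    have h2 : wordAct D z' (simpleRoot i) ≤ 0 := by
      have : wordAct D z' (simpleRoot i) = wordAct D (u' ++ [i]) (simpleRoot j) := by
        rw [act_append, ← ez', act_append, act_single, act_single, sref_adj D hadj,
          add_comm, ← sref_adj D hadj', sref_sref]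
      rw [this]; exact hj
    obtain ⟨z, hz, ez⟩ := red_descent (red_left hz') h2
    have c1 : wordAct D (z ++ [i] ++ [j] ++ [i]) = wordAct D (u' ++ [i]) :=
      (act_snoc_congr _ (act_snoc_congr _ ez)).trans (act_snoc_congr _ ez')
    have l1 := red_len (red_left hu) hz' ez'
    have l2 := red_len (red_left hz') hz ez
    have c1r : IsReducedWord D (z ++ [i] ++ [j] ++ [i]) := red_congr hu c1 (by
      simp at l1 l2 ⊢; omega)
    have c2 : wordAct D (z ++ [j] ++ [i] ++ [j]) = wordAct D (z ++ [i] ++ [j] ++ [i]) := by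
      ext1 v
      simp only [act_append, act_single]
      congr 1
      simp only [sref_eq, pairing_sub, pairing_smul, pairing_simple, cartan_adj D hadj,
        cartan_symm D j i, cartan_self]
      module
    have c2r : IsReducedWord D (z ++ [j] ++ [i] ++ [j]) := red_congr c1r c2 (by simp)
    refine ht _ _ _ (same _ _ _ hl hu c1r c1.symm) (ht _ _ _ (hn z i j hadj) ?_)
    exact same _ _ _ (by rw [red_len hu c2r (c2.trans c1)]; exact hl) c2r hv
      ((c2.trans c1).trans e)

theorem act_rev (l : List I) (v : I → ℤ) : wordAct D l (wordAct D l.reverse v) = v := by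
  induction l generalizing v with
  | nil => rfl
  | cons a l ih => rw [List.reverse_cons, act_append, act_cons, ih, act_single, sref_sref]

theorem rev_act (l : List I) (v : I → ℤ) : wordAct D l.reverse (wordAct D l v) = v := by
  have := act_rev (D := D) l.reverse v
  rwa [List.reverse_reverse] at this

theorem act_rev_congr {l m : List I} (h : wordAct D l = wordAct D m) :
    wordAct D l.reverse = wordAct D m.reverse := by
  ext1 v
  apply act_inj D l
  rw [act_rev, h, act_rev]

theorem red_rev {l : List I} (h : IsReducedWord D l) : IsReducedWord D l.reverse := by
  intro y hy
  have := h y.reverse (by rw [act_rev_congr hy, List.reverse_reverse])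
  simpa using this

/-- if `x` sends all simple roots to negative ones, it has any reduced word as a suffix -/
theorem neg_all_suffix {x : List I} (hx : IsReducedWord D x)
    (hn : ∀ i, wordAct D x (simpleRoot i) ≤ 0) (u : List I) (hu : IsReducedWord D u) :
    ∃ x', wordAct D (x' ++ u) = wordAct D x ∧ x'.length + u.length = x.length := by
  induction u with
  | nil => exact ⟨x, by simp, by simp⟩
  | cons i u ih =>
    have hu' : IsReducedWord D u := red_right (x := [i]) hu
    obtain ⟨x', e, l⟩ := ih hu'
    have hx'u : IsReducedWord D (x' ++ u) := red_congr hx e (by simpa using l)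
    have hx' := red_left hx'u
    -- u⁻¹ α_i is positive
    have hneg : wordAct D x' (simpleRoot i) ≤ 0 := by
      have key := act_rev (D := D) u (simpleRoot i)
      have hpos : 0 ≤ wordAct D u.reverse (simpleRoot i) := by
        apply red_pos
        have := red_rev hu
        rwa [List.reverse_cons] at this
      have e2 : wordAct D x' (simpleRoot i) = wordAct D x (wordAct D u.reverse (simpleRoot i)) := by
        rw [← e, act_append, key]
      rw [e2, eq_sum_simple (wordAct D u.reverse (simpleRoot i)), act_sum]
      refine Finset.sum_nonpos fun k _ => ?_
      rw [act_smul]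
      exact smul_nonpos_of_nonneg_of_nonpos (hpos k) (hn k)
    obtain ⟨x'', h1, h2⟩ := red_descent hx' hneg
    refine ⟨x'', ?_, ?_⟩
    · rw [← e, ← act_snoc_congr u h2]; simp
    · have := red_len hx' h1 h2
      simp at this ⊢; omega

theorem w0_neg {w : List I} (hw : IsRedW0 D w) (i : I) : wordAct D w (simpleRoot i) ≤ 0 := by
  apply nonpos_of_not D (act_norm D w i)
  intro h
  have := hw.2 _ (red_snoc hw.1 h)
  simp at this

theorem w0_act {w w' : List I} (hw : IsRedW0 D w) (hw' : IsRedW0 D w') :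
    wordAct D w = wordAct D w' := by
  obtain ⟨x', e, l⟩ := neg_all_suffix hw.1 (w0_neg hw) w' hw'.1
  have h1 := hw'.2 _ hw.1
  have : x' = [] := List.length_eq_zero_iff.1 (by omega)
  subst this
  simpa using e.symm

theorem w0_extend {w : List I} (hw : IsRedW0 D w) :
    ∀ (n : ℕ) (x : List I), IsReducedWord D x → w.length - x.length = n →
      ∃ y, IsRedW0 D (x ++ y) := by
  intro n
  induction n with
  | zero =>
    intro x hx hl
    refine ⟨[], ?_⟩
    rw [List.append_nil]
    refine ⟨hx, fun w' h' => ?_⟩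
    have := hw.2 _ h'
    omega
  | succ n ih =>
    intro x hx hl
    by_cases hp : ∃ i, 0 ≤ wordAct D x (simpleRoot i)
    · obtain ⟨i, hi⟩ := hp
      obtain ⟨y, hy⟩ := ih (x ++ [i]) (red_snoc hx hi) (by simp; omega)
      exact ⟨i :: y, by simpa using hy⟩
    · push Not at hp
      obtain ⟨x', e, l⟩ := neg_all_suffix hx (fun i => nonpos_of_not D (act_norm D x i) (hp i)) w hw.1
      omega

theorem red_single (i : I) : IsReducedWord D [i] := by
  have := red_snoc (D := D) (x := []) (i := i) red_nil (by rw [act_nil]; exact simple_nonneg i)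
  simpa using this

theorem w0_start {w : List I} (hw : IsRedW0 D w) (i : I) : ∃ y, IsRedW0 D (i :: y) := by
  obtain ⟨y, hy⟩ := w0_extend hw _ [i] (red_single i) rfl
  exact ⟨y, by simpa using hy⟩

end Weyl
end QProof


namespace QProof
section Rel
set_option linter.unusedSectionVars false
set_option linter.unusedSimpArgs false
set_option linter.unusedVariables false
attribute [local instance] Semiring.toNatAlgebra Ring.toIntAlgebra

theorem qq_ne : qq ≠ 0 := RatFunc.X_ne_zero

theorem qq_pow_ne (n : ℕ) (hn : n ≠ 0) : qq ^ n ≠ 1 := by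
  intro h
  have h1 : algebraMap (Polynomial ℚ) 𝕂 (Polynomial.X ^ n) = algebraMap (Polynomial ℚ) 𝕂 1 := by
    rw [map_pow, RatFunc.algebraMap_X, map_one]; exact h
  have h2 := RatFunc.algebraMap_injective ℚ h1
  have h3 := congrArg Polynomial.natDegree h2
  simp at h3; exact hn h3

theorem qq_zpow_inj {m n : ℤ} (h : qq ^ m = qq ^ n) : m = n := by
  wlog hmn : m ≤ n generalizing m n
  · exact (this h.symm (by omega)).symm
  by_contra hne
  have h1 : qq ^ (n - m) = 1 := by rw [zpow_sub₀ qq_ne, h, div_self (zpow_ne_zero _ qq_ne)]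
  obtain ⟨k, hk⟩ := Int.eq_ofNat_of_zero_le (show 0 ≤ n - m by omega)
  rw [hk, zpow_natCast] at h1
  exact qq_pow_ne k (by omega) h1

theorem qd_ne : qq - qq⁻¹ ≠ 0 := by
  intro h
  have := qq_pow_ne 2 (by norm_num)
  apply this
  have h1 : qq * (qq - qq⁻¹) = 0 := by rw [h, mul_zero]
  rw [mul_sub, mul_inv_cancel₀ qq_ne] at h1
  rw [pow_two]; exact sub_eq_zero.1 h1

theorem qs_ne : qq ^ 2 - 1 ≠ 0 := sub_ne_zero.2 (qq_pow_ne 2 (by norm_num))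

theorem assoc_rw {R : Type} [Semigroup R] {a b c : R} (h : a * b = c) (z : R) :
    a * (b * z) = c * z := by rw [← mul_assoc, h]

variable {I : Type} [Fintype I] [DecidableEq I] {D : ADEData I}

theorem KKi (i : I) : KK D i * KKinv D i = 1 := by
  have := RingQuot.mkAlgHom_rel 𝕂 (QRel.KKinv (D := D) i)
  simpa [KK, KKinv] using this
theorem KiK (i : I) : KKinv D i * KK D i = 1 := by
  have := RingQuot.mkAlgHom_rel 𝕂 (QRel.KinvK (D := D) i)
  simpa [KK, KKinv] using this
theorem K_comm (i j : I) : KK D i * KK D j = KK D j * KK D i := by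
  have := RingQuot.mkAlgHom_rel 𝕂 (QRel.KcommK (D := D) i j)
  simpa [KK, KKinv] using this

theorem KEK (i j : I) : KK D i * EE D j * KKinv D i = qq ^ (cartan D i j) • EE D j := by
  by_cases h : i = j
  · subst h
    have := RingQuot.mkAlgHom_rel 𝕂 (QRel.KEself (D := D) i)
    rw [cartan_self]
    simpa [KK, KKinv, EE] using this
  · cases h' : D.adj i j
    · have := RingQuot.mkAlgHom_rel 𝕂 (QRel.KEfar (D := D) i j h h')
      rw [cartan_far D h h']
      simpa [KK, KKinv, EE] using this
    · have := RingQuot.mkAlgHom_rel 𝕂 (QRel.KEadj (D := D) i j h')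
      rw [cartan_adj D h']
      simpa [KK, KKinv, EE] using this

theorem KFK (i j : I) : KK D i * FF D j * KKinv D i = qq ^ (-cartan D i j) • FF D j := by
  by_cases h : i = j
  · subst h
    have := RingQuot.mkAlgHom_rel 𝕂 (QRel.KFself (D := D) i)
    rw [cartan_self, zpow_neg]
    simpa [KK, KKinv, FF] using this
  · cases h' : D.adj i j
    · have := RingQuot.mkAlgHom_rel 𝕂 (QRel.KFfar (D := D) i j h h')
      rw [cartan_far D h h']
      simpa [KK, KKinv, FF] using this
    · have := RingQuot.mkAlgHom_rel 𝕂 (QRel.KFadj (D := D) i j h')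
      rw [cartan_adj D h']
      simpa [KK, KKinv, FF] using this

theorem K_E (i j : I) : KK D i * EE D j = qq ^ (cartan D i j) • (EE D j * KK D i) := by
  have := congrArg (· * KK D i) (KEK (D := D) i j)
  simpa only [mul_assoc, KiK, mul_one, smul_mul_assoc] using this
theorem K_F (i j : I) : KK D i * FF D j = qq ^ (-cartan D i j) • (FF D j * KK D i) := by
  have := congrArg (· * KK D i) (KFK (D := D) i j)
  simpa only [mul_assoc, KiK, mul_one, smul_mul_assoc] using this

/-- moving K past an eigenvector, inverse version -/
theorem Ki_of {K Ki X : Uq D} (h1 : K * Ki = 1) (h2 : Ki * K = 1) {m : ℤ}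
    (h : K * X = qq ^ m • (X * K)) : Ki * X = qq ^ (-m) • (X * Ki) := by
  have h3 := congrArg (fun y => qq ^ (-m) • (Ki * y * Ki)) h
  simp only [mul_smul_comm, smul_mul_assoc, smul_smul] at h3
  rw [← zpow_add₀ qq_ne, neg_add_cancel, zpow_zero, one_smul, mul_assoc Ki (X * K) Ki, mul_assoc X,
    h1, mul_one, ← mul_assoc Ki K X, h2, one_mul] at h3
  exact h3.symm

theorem Ki_E (i j : I) : KKinv D i * EE D j = qq ^ (-cartan D i j) • (EE D j * KKinv D i) :=
  Ki_of (KKi i) (KiK i) (K_E i j)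
theorem Ki_F (i j : I) : KKinv D i * FF D j = qq ^ (cartan D i j) • (FF D j * KKinv D i) := by
  have := Ki_of (KKi i) (KiK i) (K_F (D := D) i j)
  rwa [neg_neg] at this
theorem Ki_K (i j : I) : KKinv D i * KK D j = KK D j * KKinv D i := by
  have := Ki_of (KKi i) (KiK i) (m := 0) (X := KK D j) (by simpa using K_comm i j)
  simpa using this
theorem Ki_Ki (i j : I) : KKinv D i * KKinv D j = KKinv D j * KKinv D i := by
  have := Ki_of (KKi i) (KiK i) (m := 0) (X := KKinv D j) (by simpa using (Ki_K j i).symm)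
  simpa using this

theorem EF_ne {i j : I} (h : i ≠ j) : EE D i * FF D j = FF D j * EE D i := by
  have := RingQuot.mkAlgHom_rel 𝕂 (QRel.EFdiff (D := D) i j h)
  rw [← sub_eq_zero]
  simpa [EE, FF] using this
theorem EF_self (i : I) : EE D i * FF D i = FF D i * EE D i +
    (qq - qq⁻¹)⁻¹ • (KK D i - KKinv D i) := by
  have := RingQuot.mkAlgHom_rel 𝕂 (QRel.EFself (D := D) i)
  rw [← sub_eq_iff_eq_add']
  simpa only [EE, FF, KK, KKinv, map_sub, map_mul, map_smul] using this
theorem serreE' {i j : I} (h : D.adj i j = true) : EE D i ^ 2 * EE D j + EE D j * EE D i ^ 2 =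
    (qq + qq⁻¹) • (EE D i * EE D j * EE D i) := by
  have := RingQuot.mkAlgHom_rel 𝕂 (QRel.serreE (D := D) i j h)
  simpa only [EE, map_add, map_mul, map_smul, map_pow] using this
theorem serreF' {i j : I} (h : D.adj i j = true) : FF D i ^ 2 * FF D j + FF D j * FF D i ^ 2 =
    (qq + qq⁻¹) • (FF D i * FF D j * FF D i) := by
  have := RingQuot.mkAlgHom_rel 𝕂 (QRel.serreF (D := D) i j h)
  simpa only [FF, map_add, map_mul, map_smul, map_pow] using this
theorem EE_far {i j : I} (h : i ≠ j) (h' : D.adj i j = false) :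
    EE D i * EE D j = EE D j * EE D i := by
  have := RingQuot.mkAlgHom_rel 𝕂 (QRel.EEfar (D := D) i j h h')
  simpa only [EE, map_mul] using this
theorem FF_far {i j : I} (h : i ≠ j) (h' : D.adj i j = false) :
    FF D i * FF D j = FF D j * FF D i := by
  have := RingQuot.mkAlgHom_rel 𝕂 (QRel.FFfar (D := D) i j h h')
  simpa only [FF, map_mul] using this

/-- ring hom extensionality on `Uq` for 𝕂-algebra homs -/
theorem hom_ext {B : Type} [Ring B] [Algebra 𝕂 B] {f g : Uq D →ₐ[𝕂] B}
    (hE : ∀ i, f (EE D i) = g (EE D i)) (hF : ∀ i, f (FF D i) = g (FF D i))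
    (hK : ∀ i, f (KK D i) = g (KK D i)) : f = g := by
  apply RingQuot.ringQuot_ext'
  apply FreeAlgebra.hom_ext
  ext x
  cases x with
  | E i => exact hE i
  | F i => exact hF i
  | K i => exact hK i
  | Kinv i =>
    show f (KKinv D i) = g (KKinv D i)
    have h1 : f (KKinv D i) * f (KK D i) = 1 := by rw [← map_mul, KiK, map_one]
    have h2 : g (KK D i) * g (KKinv D i) = 1 := by rw [← map_mul, KKi, map_one]
    calc f (KKinv D i) = f (KKinv D i) * (g (KK D i) * g (KKinv D i)) := by rw [h2, mul_one]
      _ = g (KKinv D i) := by rw [← mul_assoc, ← hK, h1, one_mul]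

/-! ### Lusztig automorphisms -/

variable {T : I → (Uq D ≃ₐ[𝕂] Uq D)}

/-- we avoid the negation instance of `RingQuot`, which does not unify well -/
theorem negU (x : Uq D) : -x = (-1 : 𝕂) • x := (neg_one_smul 𝕂 x).symm

theorem TF_self (hT : IsLusztigAuts D T) (i : I) : T i (FF D i) = (-1 : 𝕂) • (KKinv D i * EE D i) := by
  rw [← negU]; exact (hT i i).1
theorem TF_adj (hT : IsLusztigAuts D T) {i j : I} (h : D.adj i j = true) :
    T i (FF D j) = FF D j * FF D i - qq • (FF D i * FF D j) := (hT i j).2.1 h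
theorem TF_far (hT : IsLusztigAuts D T) {i j : I} (h : i ≠ j) (h' : D.adj i j = false) :
    T i (FF D j) = FF D j := (hT i j).2.2.1 h h'
theorem TE_self (hT : IsLusztigAuts D T) (i : I) : T i (EE D i) = (-1 : 𝕂) • (FF D i * KK D i) := by
  rw [← negU]; exact (hT i i).2.2.2.1
theorem TE_adj (hT : IsLusztigAuts D T) {i j : I} (h : D.adj i j = true) :
    T i (EE D j) = EE D i * EE D j - qq⁻¹ • (EE D j * EE D i) := (hT i j).2.2.2.2.1 h
theorem TE_far (hT : IsLusztigAuts D T) {i j : I} (h : i ≠ j) (h' : D.adj i j = false) :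
    T i (EE D j) = EE D j := (hT i j).2.2.2.2.2.1 h h'
theorem TK_self (hT : IsLusztigAuts D T) (i : I) : T i (KK D i) = KKinv D i := (hT i i).2.2.2.2.2.2.1
theorem TK_adj (hT : IsLusztigAuts D T) {i j : I} (h : D.adj i j = true) :
    T i (KK D j) = KK D i * KK D j := (hT i j).2.2.2.2.2.2.2.1 h
theorem TK_far (hT : IsLusztigAuts D T) {i j : I} (h : i ≠ j) (h' : D.adj i j = false) :
    T i (KK D j) = KK D j := (hT i j).2.2.2.2.2.2.2.2 h h'

theorem inv_unique {a b c : Uq D} (h : a * b = 1) (h' : c * a = 1) : b = c := by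
  calc b = c * a * b := by rw [h', one_mul]
    _ = c := by rw [mul_assoc, h, mul_one]

theorem TKi_self (hT : IsLusztigAuts D T) (i : I) : T i (KKinv D i) = KK D i :=
  inv_unique (a := T i (KK D i)) (by rw [← map_mul, KKi, map_one]) (by rw [TK_self hT, KKi])
theorem TKi_adj (hT : IsLusztigAuts D T) {i j : I} (h : D.adj i j = true) :
    T i (KKinv D j) = KKinv D i * KKinv D j :=
  inv_unique (a := T i (KK D j)) (by rw [← map_mul, KKi, map_one])
    (by rw [TK_adj hT h, K_comm, mul_assoc, assoc_rw (KiK j), one_mul, KiK])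
theorem TKi_far (hT : IsLusztigAuts D T) {i j : I} (h : i ≠ j) (h' : D.adj i j = false) :
    T i (KKinv D j) = KKinv D j :=
  inv_unique (a := T i (KK D j)) (by rw [← map_mul, KKi, map_one]) (by rw [TK_far hT h h', KiK])

theorem Tsymm_F_self (hT : IsLusztigAuts D T) (i : I) : (T i).symm (FF D i) = (-1 : 𝕂) • (EE D i * KK D i) := by
  rw [AlgEquiv.symm_apply_eq, map_smul, map_mul, TE_self hT, TK_self hT]
  rw [smul_mul_assoc, smul_smul, mul_assoc, KKi, mul_one]; simp

theorem adj_symm {i j : I} (h : D.adj i j = true) : D.adj j i = true := by rw [D.symm]; exact h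
theorem far_symm {i j : I} (h : D.adj i j = false) : D.adj j i = false := by rw [D.symm]; exact h

theorem TT_F (hT : IsLusztigAuts D T) {i j : I} (h : D.adj i j = true) :
    T i (T j (FF D i)) = FF D j := by
  rw [TF_adj hT (adj_symm h), map_sub, map_smul, map_mul, map_mul, TF_adj hT h, TF_self hT]
  have a1 := EF_self (D := D) i
  have a2 := EF_ne (D := D) (adj_ne D h)
  have a3 := Ki_F (D := D) i i
  have a4 := Ki_F (D := D) i j
  have a5 := K_F (D := D) i j
  rw [cartan_self] at a3
  rw [cartan_adj D h] at a4 a5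
  have a6 := KiK (D := D) i
  simp only [neg_mul, mul_neg, mul_sub, sub_mul, mul_add, add_mul, smul_sub, smul_add, smul_neg,
    smul_mul_assoc, mul_smul_comm, smul_smul,
    mul_assoc, a1, a2, a3, a4, a5, a6, assoc_rw a1, assoc_rw a2, assoc_rw a3, assoc_rw a4,
    assoc_rw a5, assoc_rw a6, one_mul, mul_one]
  have := qd_ne
  have h0 := qq_ne
  have hs := qs_ne
  simp only [neg_neg, zpow_neg, zpow_one, zpow_ofNat]
  match_scalars <;> field_simp <;> ring

theorem TT_E (hT : IsLusztigAuts D T) {i j : I} (h : D.adj i j = true) :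
    T i (T j (EE D i)) = EE D j := by
  rw [TE_adj hT (adj_symm h), map_sub, map_smul, map_mul, map_mul, TE_adj hT h, TE_self hT]
  have a1 := EF_self (D := D) i
  have a2 := EF_ne (D := D) (adj_ne D h).symm
  have a3 := K_E (D := D) i i
  have a4 := K_E (D := D) i j
  have a5 := Ki_E (D := D) i j
  rw [cartan_self] at a3
  rw [cartan_adj D h] at a4 a5
  have a6 := KiK (D := D) i
  have a7 := K_F (D := D) i i
  rw [cartan_self] at a7
  simp only [neg_mul, mul_neg, mul_sub, sub_mul, mul_add, add_mul, smul_sub, smul_add, smul_neg,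
    smul_mul_assoc, mul_smul_comm, smul_smul,
    mul_assoc, a1, a2, a3, a4, a5, a6, assoc_rw a1, assoc_rw a2, assoc_rw a3, assoc_rw a4,
    assoc_rw a5, assoc_rw a6, one_mul, mul_one, KKi]
  have := qd_ne
  have h0 := qq_ne
  have hs := qs_ne
  simp only [neg_neg, zpow_neg, zpow_one, zpow_ofNat]
  match_scalars <;> field_simp <;> ring

theorem TT_K (hT : IsLusztigAuts D T) {i j : I} (h : D.adj i j = true) :
    T i (T j (KK D i)) = KK D j := by
  rw [TK_adj hT (adj_symm h), map_mul, TK_adj hT h, TK_self hT, K_comm, mul_assoc, KKi, mul_one]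
theorem TT_Ki (hT : IsLusztigAuts D T) {i j : I} (h : D.adj i j = true) :
    T i (T j (KKinv D i)) = KKinv D j :=
  inv_unique (a := T i (T j (KK D i))) (by rw [← map_mul, ← map_mul, KKi, map_one, map_one])
    (by rw [TT_K hT h, KiK])

theorem no_triangle {i j k : I} (h1 : D.adj i j = true) (h2 : D.adj k i = true)
    (h3 : D.adj k j = true) : False := by
  have hn : (simpleRoot i + simpleRoot j + simpleRoot k : I → ℤ) ≠ 0 := by
    intro h
    have := congrFun h i
    simp [simpleRoot, adj_ne D h1, (adj_ne D h2).symm] at this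
  have := BF_pos D _ hn
  simp only [BF_add_left, BF_add_right, BF_simple_left, pairing_simple, cartan_self,
    cartan_adj D h1, cartan_adj D h2, cartan_adj D h3, cartan_adj D (adj_symm h1),
    cartan_adj D (adj_symm h2), cartan_adj D (adj_symm h3)] at this
  norm_num at this

theorem braid_far (hT : IsLusztigAuts D T) {i j : I} (h : i ≠ j) (h' : D.adj i j = false) (u : Uq D) :
    T i (T j u) = T j (T i u) := by
  have h'' := far_symm h'
  have key : ((T i).toAlgHom.comp (T j).toAlgHom) = ((T j).toAlgHom.comp (T i).toAlgHom) := by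
    apply hom_ext <;> intro k <;> change T i (T j _) = T j (T i _)
    · by_cases hki : i = k
      · subst hki; rw [TE_far hT h.symm h'', TE_self hT]
        simp only [map_smul, map_mul, TF_far hT h.symm h'', TK_far hT h.symm h'']
      by_cases hkj : j = k
      · subst hkj; rw [TE_far hT h h', TE_self hT]
        simp only [map_smul, map_mul, TF_far hT h h', TK_far hT h h']
      cases a1 : D.adj i k <;> cases a2 : D.adj j k <;>
      simp only [TE_far hT hki, TE_far hT hkj, TE_adj hT, TE_far hT h h', TE_far hT h.symm h'',
        a1, a2, map_sub, map_smul, map_mul]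
      have := EE_far h h'
      simp only [mul_sub, sub_mul, smul_sub, mul_smul_comm, smul_mul_assoc, mul_assoc, this, assoc_rw this]
      module
    · by_cases hki : i = k
      · subst hki; rw [TF_far hT h.symm h'', TF_self hT]
        simp only [map_smul, map_mul, TE_far hT h.symm h'', TKi_far hT h.symm h'']
      by_cases hkj : j = k
      · subst hkj; rw [TF_far hT h h', TF_self hT]
        simp only [map_smul, map_mul, TE_far hT h h', TKi_far hT h h']
      cases a1 : D.adj i k <;> cases a2 : D.adj j k <;>
      simp only [TF_far hT hki, TF_far hT hkj, TF_adj hT, TF_far hT h h', TF_far hT h.symm h'',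
        a1, a2, map_sub, map_smul, map_mul]
      have := FF_far h h'
      simp only [mul_sub, sub_mul, smul_sub, mul_smul_comm, smul_mul_assoc, mul_assoc, this, assoc_rw this]
      module
    · by_cases hki : i = k
      · subst hki; rw [TK_far hT h.symm h'', TK_self hT, TKi_far hT h.symm h'']
      by_cases hkj : j = k
      · subst hkj; rw [TK_far hT h h', TK_self hT, TKi_far hT h h']
      cases a1 : D.adj i k <;> cases a2 : D.adj j k <;>
      simp only [TK_far hT hki, TK_far hT hkj, TK_adj hT, TK_far hT h h', TK_far hT h.symm h'',
        a1, a2, map_sub, map_smul, map_mul]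
      rw [assoc_rw (K_comm j i), mul_assoc]
  exact DFunLike.congr_fun key u

theorem braid_near1 (hT : IsLusztigAuts D T) {i j k : I} (h : D.adj i j = true)
    (hik : D.adj i k = true) (hjk : D.adj j k = false) (hne : j ≠ k) :
    T i (T j (T i (FF D k))) = T j (T i (T j (FF D k))) ∧
    T i (T j (T i (EE D k))) = T j (T i (T j (EE D k))) ∧
    T i (T j (T i (KK D k))) = T j (T i (T j (KK D k))) := by
  refine ⟨?_, ?_, ?_⟩
  · have := FF_far hne hjk
    simp only [TF_far hT hne hjk, TF_adj hT hik, map_sub, map_smul, map_mul, TT_F hT h]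
    simp only [TF_adj hT (adj_symm h), TF_far hT hne hjk]
    simp only [mul_sub, sub_mul, smul_sub, mul_smul_comm, smul_mul_assoc, mul_assoc, this, assoc_rw this]
    module
  · have := EE_far hne hjk
    simp only [TE_far hT hne hjk, TE_adj hT hik, map_sub, map_smul, map_mul, TT_E hT h]
    simp only [TE_adj hT (adj_symm h), TE_far hT hne hjk]
    simp only [mul_sub, sub_mul, smul_sub, mul_smul_comm, smul_mul_assoc, mul_assoc, this, assoc_rw this]
    module
  · simp only [TK_far hT hne hjk, TK_adj hT hik, map_sub, map_smul, map_mul, TT_K hT h]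
    simp only [TK_adj hT (adj_symm h), TK_far hT hne hjk]
    simp only [mul_assoc]

theorem braid_near (hT : IsLusztigAuts D T) {i j : I} (h : D.adj i j = true) (u : Uq D) :
    T i (T j (T i u)) = T j (T i (T j u)) := by
  have h' := adj_symm h
  have key : ((T i).toAlgHom.comp ((T j).toAlgHom.comp (T i).toAlgHom)) =
      ((T j).toAlgHom.comp ((T i).toAlgHom.comp (T j).toAlgHom)) := by
    have far2 : ∀ k, i ≠ k → j ≠ k →
       T i (T j (T i (FF D k))) = T j (T i (T j (FF D k))) ∧
       T i (T j (T i (EE D k))) = T j (T i (T j (EE D k))) ∧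
       T i (T j (T i (KK D k))) = T j (T i (T j (KK D k))) := by
      intro k hik hjk
      cases a1 : D.adj i k <;> cases a2 : D.adj j k
      · simp only [TF_far hT hik a1, TF_far hT hjk a2, TE_far hT hik a1, TE_far hT hjk a2,
          TK_far hT hik a1, TK_far hT hjk a2, and_self]
      · have := braid_near1 hT h' a2 a1 hik
        exact ⟨this.1.symm, this.2.1.symm, this.2.2.symm⟩
      · exact braid_near1 hT h a1 a2 hjk
      · exact (no_triangle h (adj_symm a1) (adj_symm a2)).elim
    apply hom_ext <;> intro k <;> change T i (T j (T i _)) = T j (T i (T j _)) <;> by_cases hki : i = k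
    · subst hki
      rw [TT_E hT h, TE_self hT]; simp only [map_smul, map_mul, TT_F hT h, TT_K hT h, TE_self hT]
    · by_cases hkj : j = k
      · subst hkj
        rw [TT_E hT h', TE_self hT]; simp only [map_smul, map_mul, TT_F hT h', TT_K hT h', TE_self hT]
      · exact (far2 k hki hkj).2.1
    · subst hki
      rw [TT_F hT h, TF_self hT]; simp only [map_smul, map_mul, TT_E hT h, TT_Ki hT h, TF_self hT]
    · by_cases hkj : j = k
      · subst hkj
        rw [TT_F hT h', TF_self hT]; simp only [map_smul, map_mul, TT_E hT h', TT_Ki hT h', TF_self hT]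
      · exact (far2 k hki hkj).1
    · subst hki
      rw [TT_K hT h, TK_self hT, TT_Ki hT h, TK_self hT]
    · by_cases hkj : j = k
      · subst hkj
        rw [TT_K hT h', TK_self hT, TK_self hT, TT_Ki hT h']
      · exact (far2 k hki hkj).2.2
  exact DFunLike.congr_fun key u

end Rel
end QProof


namespace QProof
noncomputable section Rank2
set_option linter.unusedSectionVars false
set_option linter.unusedSimpArgs false
set_option linter.unusedVariables false
attribute [local instance] Semiring.toNatAlgebra Ring.toIntAlgebra

/-- quantum integers for integers -/
def qz (n : ℤ) : 𝕂 := (qq ^ n - qq ^ (-n)) * (qq - qq⁻¹)⁻¹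

theorem qInt_eq (n : ℕ) : qInt n = qz n := by
  have h0 := qq_ne
  have h1 := qd_ne
  have hs := qs_ne
  have : qInt n * (qq - qq⁻¹) = qq ^ (n : ℤ) - qq ^ (-(n : ℤ)) := by
    induction n with
    | zero => simp [qInt]
    | succ n ih =>
      have : qInt (n + 1) = qq * qInt n + qq ^ (-(n : ℤ)) := by
        unfold qInt
        rw [Finset.sum_range_succ, Finset.mul_sum]
        congr 1
        · refine Finset.sum_congr rfl fun t _ => ?_
          rw [← zpow_one_add₀ h0]; congr 1; push_cast; ring
        · congr 1; push_cast; ring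
      rw [this, add_mul, mul_assoc, ih]
      push_cast
      simp only [zpow_neg, zpow_add₀ h0, zpow_one]
      field_simp
      ring
  rw [qz, ← this, mul_assoc, mul_inv_cancel₀ h1, mul_one]

theorem qz_zero : qz 0 = 0 := by simp [qz]

theorem qz_one : qz 1 = 1 := by
  simp only [qz, zpow_one, zpow_neg]; exact mul_inv_cancel₀ qd_ne

theorem qz_ne {n : ℤ} (hn : n ≠ 0) : qz n ≠ 0 := by
  intro h
  rcases mul_eq_zero.1 h with h | h
  · have := qq_zpow_inj (sub_eq_zero.1 h)
    omega
  · exact inv_ne_zero qd_ne h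

theorem qz_add (a b : ℤ) : qz (a + b) = qq ^ b * qz a + qq ^ (-a) * qz b := by
  have h0 := qq_ne
  have h1 := qd_ne
  simp only [qz, zpow_neg, zpow_add₀ h0]
  field_simp
  ring

theorem qFact_ne (n : ℕ) : qFact n ≠ 0 := by
  unfold qFact
  refine Finset.prod_ne_zero_iff.2 fun t _ => ?_
  rw [qInt_eq]; exact qz_ne (by omega)

theorem qFact_succ (n : ℕ) : qFact (n + 1) = qFact n * qz (n + 1) := by
  unfold qFact; rw [Finset.prod_range_succ, qInt_eq]; push_cast; rfl

/-- Laurent polynomials as a subring. -/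
def LA : Subring 𝕂 where
  carrier := {c | IsLaurent c}
  zero_mem' := ⟨0, 0, by simp⟩
  one_mem' := ⟨1, 0, by simp⟩
  add_mem' := by
    rintro x y ⟨f, m, rfl⟩ ⟨g, n, rfl⟩
    refine ⟨Polynomial.X ^ n * f + Polynomial.X ^ m * g, m + n, ?_⟩
    have h0 := qq_ne
    simp only [map_add, map_mul, map_pow, Polynomial.aeval_X, inv_pow, pow_add]
    field_simp
  mul_mem' := by
    rintro x y ⟨f, m, rfl⟩ ⟨g, n, rfl⟩
    refine ⟨f * g, m + n, ?_⟩
    simp only [map_mul, pow_add]; ring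
  neg_mem' := by
    rintro x ⟨f, m, rfl⟩
    exact ⟨-f, m, by simp⟩

theorem LA_q : qq ∈ LA := ⟨Polynomial.X, 0, by simp⟩
theorem LA_qi : qq⁻¹ ∈ LA := ⟨1, 1, by simp⟩
theorem LA_zpow (n : ℤ) : qq ^ n ∈ LA := by
  cases n with
  | ofNat n => simpa using LA.pow_mem LA_q n
  | negSucc n => rw [zpow_negSucc, ← inv_pow]; exact LA.pow_mem LA_qi _

theorem LA_qbinom (n : ℕ) : ∀ a b : ℕ, a + b = n → qFact (a + b) * (qFact a)⁻¹ * (qFact b)⁻¹ ∈ LA := by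
  induction n with
  | zero => intro a b h; obtain ⟨rfl, rfl⟩ := Nat.add_eq_zero_iff.1 h; simp [qFact, LA.one_mem]
  | succ n ih =>
    intro a b h
    rcases a with _ | a
    · rw [zero_add]
      have := qFact_ne b
      have h1 : qFact 0 = 1 := by simp [qFact]
      rw [h1, inv_one, mul_one, mul_inv_cancel₀ this]; exact LA.one_mem
    rcases b with _ | b
    · rw [add_zero]
      have := qFact_ne (a + 1)
      have h1 : qFact 0 = 1 := by simp [qFact]
      rw [h1, inv_one, mul_one, mul_inv_cancel₀ this]; exact LA.one_mem
    have h1 := ih a (b + 1) (by omega)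
    have h2 := ih (a + 1) b (by omega)
    have := qFact_ne a
    have := qFact_ne b
    have := qz_ne (n := (a : ℤ) + 1) (by omega)
    have := qz_ne (n := (b : ℤ) + 1) (by omega)
    have key : qFact (a + 1 + (b + 1)) * (qFact (a + 1))⁻¹ * (qFact (b + 1))⁻¹ =
        qq ^ ((b : ℤ) + 1) * (qFact (a + (b + 1)) * (qFact a)⁻¹ * (qFact (b + 1))⁻¹) +
        qq ^ (-((a : ℤ) + 1)) * (qFact (a + 1 + b) * (qFact (a + 1))⁻¹ * (qFact b)⁻¹) := by
      rw [show a + 1 + (b + 1) = (a + b + 1) + 1 by ring, show a + (b + 1) = a + b + 1 by ring,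
        show a + 1 + b = a + b + 1 by ring, qFact_succ (a + b + 1), qFact_succ a, qFact_succ b]
      rw [show (((a + b + 1 : ℕ) : ℤ) + 1) = ((a : ℤ) + 1) + ((b : ℤ) + 1) by push_cast; ring, qz_add]
      field_simp
    rw [key]
    exact LA.add_mem (LA.mul_mem (LA_zpow _) h1) (LA.mul_mem (LA_zpow _) h2)

variable {I : Type} [Fintype I] [DecidableEq I] {D : ADEData I}

theorem dp_zero (x : Uq D) : dp x 0 = 1 := by simp [dp, qFact]
theorem dp_one (x : Uq D) : dp x 1 = x := by
  simp only [dp, qFact_succ 0, pow_one]; simp [qFact, qz_one]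
theorem mul_dp (x : Uq D) (n : ℕ) : x * dp x n = qz (n + 1) • dp x (n + 1) := by
  simp only [dp, mul_smul_comm, smul_smul, qFact_succ, ← pow_succ']
  congr 1
  have := qFact_ne n
  have := qz_ne (n := (n : ℤ) + 1) (by omega)
  field_simp
theorem dp_mul (x : Uq D) (n : ℕ) : dp x n * x = qz (n + 1) • dp x (n + 1) := by
  rw [← mul_dp]; simp [dp, mul_smul_comm, smul_mul_assoc, ← pow_succ, ← pow_succ']
theorem dp_dp (x : Uq D) (a b : ℕ) :
    dp x a * dp x b = (qFact (a + b) * (qFact a)⁻¹ * (qFact b)⁻¹) • dp x (a + b) := by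
  simp only [dp, mul_smul_comm, smul_mul_assoc, smul_smul, pow_add]
  congr 1
  have := qFact_ne a
  have := qFact_ne b
  have := qFact_ne (a + b)
  field_simp
theorem map_dp (f : Uq D ≃ₐ[𝕂] Uq D) (x : Uq D) (n : ℕ) : f (dp x n) = dp (f x) n := by
  simp [dp]

/-- divided powers with integer exponents, zero for negative ones -/
def dpz (x : Uq D) : ℤ → Uq D
  | Int.ofNat n => dp x n
  | Int.negSucc _ => 0

theorem dpz_nat (x : Uq D) (n : ℕ) : dpz x n = dp x n := rfl
theorem dpz_neg (x : Uq D) {n : ℤ} (h : n < 0) : dpz x n = 0 := by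
  cases n with
  | ofNat n => exact absurd h (by simp)
  | negSucc n => rfl
theorem mul_dpz (x : Uq D) (n : ℤ) : x * dpz x n = qz (n + 1) • dpz x (n + 1) := by
  cases n with
  | ofNat n => exact mul_dp x n
  | negSucc n =>
    rw [dpz_neg x (by simp), mul_zero]
    rcases n with _ | n
    · simp [qz_zero]
    · rw [dpz_neg x (by omega), smul_zero]

/-- q-commutation passes to divided powers -/
theorem comm_dpz {X Z : Uq D} {m : ℤ} (h : Z * X = qq ^ m • (X * Z)) (n : ℤ) :
    Z * dpz X n = qq ^ (m * n) • (dpz X n * Z) := by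
  cases n with
  | negSucc n => simp [dpz]
  | ofNat n =>
    show Z * dp X n = _ • (dp X n * Z)
    simp only [dp, mul_smul_comm, smul_mul_assoc]
    rw [smul_comm]; congr 1
    induction n with
    | zero => simp
    | succ n ih =>
      rw [pow_succ, ← mul_assoc, ih, smul_mul_assoc, mul_assoc, h, mul_smul_comm, smul_smul,
        ← zpow_add₀ qq_ne, mul_assoc]
      congr 2
      simp only [Int.ofNat_eq_natCast]; push_cast; ring

theorem comm_dp2 {X Z : Uq D} {m : ℤ} (h : Z * X = qq ^ m • (X * Z)) (a b : ℕ) :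
    dp Z a * dp X b = qq ^ (m * a * b) • (dp X b * dp Z a) := by
  have h1 := comm_dpz h (b : ℤ)
  rw [dpz_nat] at h1
  have h2 : dp X b * Z = qq ^ (-(m * b)) • (Z * dp X b) := by
    rw [h1, smul_smul, ← zpow_add₀ qq_ne, neg_add_cancel, zpow_zero, one_smul]
  have h3 := comm_dpz h2 (a : ℤ)
  rw [dpz_nat] at h3
  rw [h3, smul_smul, ← zpow_add₀ qq_ne]
  rw [show m * a * b + -(m * b) * a = 0 by ring, zpow_zero, one_smul]

section
variable {X Y Z : Uq D} (hYX : Y * X = qq • (X * Y) + Z)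
  (hZX : Z * X = qq ^ (-1 : ℤ) • (X * Z)) (hYZ : Y * Z = qq ^ (-1 : ℤ) • (Z * Y))
include hYX hZX

theorem Y_dpzX (b : ℤ) : Y * dpz X b = qq ^ b • (dpz X b * Y) + dpz X (b - 1) * Z := by
  have h0 := qq_ne
  cases b with
  | negSucc n => rw [dpz_neg X (by simp), dpz_neg X (by omega)]; simp
  | ofNat n =>
    simp only [Int.ofNat_eq_natCast]
    induction n with
    | zero => 
      simp only [Nat.cast_zero, zpow_zero, one_smul]
      rw [dpz_neg X (by simp : (0 : ℤ) - 1 < 0), show dpz X 0 = 1 from dp_zero X]; simp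
    | succ n ih =>
      have hz := qz_ne (n := (n : ℤ) + 1) (by omega)
      have e : dpz X ((n : ℤ) + 1) = (qz (n + 1))⁻¹ • (X * dpz X n) := by
        rw [mul_dpz, smul_smul, inv_mul_cancel₀ hz, one_smul]
      have hx := mul_dpz X ((n : ℤ) - 1)
      rw [sub_add_cancel] at hx
      push_cast
      rw [add_sub_cancel_right, e, mul_smul_comm, assoc_rw hYX, add_mul, comm_dpz hZX,
        smul_mul_assoc, mul_assoc, ih, mul_add, mul_smul_comm, ← mul_assoc X _ Z, hx,
        smul_mul_assoc, smul_mul_assoc, smul_smul]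
      have hq : qz ((n : ℤ) + 1) = qq * qz n + qq ^ (-(n : ℤ)) := by
        rw [qz_add, qz_one]; simp
      have : dpz X n * Z = (qz (n + 1))⁻¹ • ((qq * qz n + qq ^ (-(n : ℤ))) • (dpz X n * Z)) := by
        rw [← hq, smul_smul, inv_mul_cancel₀ hz, one_smul]
      conv_rhs => rw [this]
      rw [zpow_add₀ h0, zpow_one, neg_one_mul]
      simp only [smul_add, mul_assoc]
      module

include hYZ

theorem YX_formula (m : ℕ) (a : ℤ) : dpz Y m * dpz X a = ∑ k ∈ Finset.range (m + 1),
    qq ^ ((a - k) * (m - k)) • (dpz X (a - k) * dpz Z k * dpz Y (m - k)) := by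
  have h0 := qq_ne
  induction m with
  | zero => simp [show dpz Y 0 = 1 from dp_zero Y, show dpz Z 0 = 1 from dp_zero Z]
  | succ m ih =>
    have hz := qz_ne (n := (m : ℤ) + 1) (by omega)
    have e : dpz Y ((m : ℤ) + 1) = (qz (m + 1))⁻¹ • (Y * dpz Y m) := by
      rw [mul_dpz, smul_smul, inv_mul_cancel₀ hz, one_smul]
    push_cast
    rw [e, smul_mul_assoc, mul_assoc, ih, inv_smul_eq_iff₀ hz, Finset.mul_sum, Finset.smul_sum]
    have step : ∀ k ∈ Finset.range (m + 1),
        Y * (qq ^ ((a - k) * (m - k)) • (dpz X (a - k) * dpz Z k * dpz Y (m - k))) =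
        (qq ^ ((a - k) * (m - k) + (a - k) - k) * qz (m + 1 - k)) •
          (dpz X (a - k) * dpz Z k * dpz Y (m + 1 - k)) +
        (qq ^ ((a - (k + 1 : ℕ) + 1) * (m + 1 - (k + 1 : ℕ))) * qz ((k + 1 : ℕ))) •
          (dpz X (a - (k + 1 : ℕ)) * dpz Z (k + 1 : ℕ) * dpz Y (m + 1 - (k + 1 : ℕ))) := by
      intro k _
      have c1 := Y_dpzX hYX hZX (a - k)
      have c2 := comm_dpz hYZ k
      have c3 := mul_dpz Y (m - k)
      have c4 := mul_dpz Z k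
      rw [show (m : ℤ) - k + 1 = m + 1 - k by ring] at c3
      rw [mul_smul_comm, mul_assoc, assoc_rw c1, add_mul, smul_mul_assoc, mul_assoc, assoc_rw c2,
        smul_mul_assoc, mul_assoc _ Y, c3, mul_assoc, assoc_rw c4]
      push_cast
      rw [show a - ((k : ℤ) + 1) = a - k - 1 by ring, show (m : ℤ) + 1 - (k + 1) = m - k by ring,
        sub_add_cancel]
      simp only [smul_add, smul_mul_assoc, mul_smul_comm, smul_smul, mul_assoc]
      congr 2
      have hp : qq ^ ((a - k) * (m - k) + (a - k) - k) =
          qq ^ ((a - k) * (m - k)) * (qq ^ (a - k) * qq ^ (-1 * (k : ℤ))) := by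
        rw [← zpow_add₀ h0, ← zpow_add₀ h0]; congr 1; ring
      rw [hp]; ring
    rw [Finset.sum_congr rfl step, Finset.sum_add_distrib]
    have ext1 : ∀ g : ℕ → Uq D, ∑ k ∈ Finset.range (m + 1), 
        (qq ^ ((a - k) * (m - k) + (a - k) - k) * qz (m + 1 - k)) • g k
        = ∑ k ∈ Finset.range (m + 1 + 1), 
        (qq ^ ((a - k) * (m - k) + (a - k) - k) * qz (m + 1 - k)) • g k := by
      intro g
      rw [Finset.sum_range_succ _ (m + 1)]
      push_cast
      rw [sub_self, qz_zero, mul_zero, zero_smul, add_zero]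
    have ext2 : ∀ g : ℕ → Uq D, ∑ k ∈ Finset.range (m + 1), 
        (qq ^ ((a - (k + 1 : ℕ) + 1) * (m + 1 - (k + 1 : ℕ))) * qz ((k + 1 : ℕ))) • g (k + 1)
        = ∑ k ∈ Finset.range (m + 1 + 1), 
        (qq ^ ((a - k + 1) * (m + 1 - k)) * qz k) • g k := by
      intro g
      rw [Finset.sum_range_succ' _ (m + 1)]
      simp [qz_zero]
    rw [ext1, ext2 (fun k => dpz X (a - k) * dpz Z k * dpz Y (m + 1 - k)), ← Finset.sum_add_distrib]
    refine Finset.sum_congr rfl fun k _ => ?_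
    rw [← add_smul, smul_smul]
    congr 1
    have := qz_add ((k : ℤ)) (m + 1 - k)
    rw [show (k : ℤ) + (m + 1 - k) = m + 1 by ring] at this
    have p1 : qq ^ ((a - k + 1) * (m + 1 - k)) =
        qq ^ ((m : ℤ) + 1 - k) * qq ^ ((a - k) * (m + 1 - k)) := by
      rw [← zpow_add₀ h0]; congr 1; ring
    have p2 : qq ^ ((a - k) * (m - k) + (a - k) - k) =
        qq ^ (-(k : ℤ)) * qq ^ ((a - k) * (m + 1 - k)) := by
      rw [← zpow_add₀ h0]; congr 1; ring
    rw [this, p1, p2]; ring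
end

end Rank2
end QProof


namespace QProof
noncomputable section Lattice
set_option linter.unusedSectionVars false
set_option linter.unusedSimpArgs false
set_option linter.unusedVariables false
attribute [local instance] Semiring.toNatAlgebra Ring.toIntAlgebra

variable {I : Type} [Fintype I] [DecidableEq I] {D : ADEData I}

/-- word automorphism -/
def TW (T : I → (Uq D ≃ₐ[𝕂] Uq D)) : List I → (Uq D ≃ₐ[𝕂] Uq D)
  | [] => AlgEquiv.refl
  | i :: l => (TW T l).trans (T i)

theorem TW_apply (T : I → (Uq D ≃ₐ[𝕂] Uq D)) (l : List I) (u : Uq D) :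
    TW T l u = applyT T l u := by
  induction l with
  | nil => rfl
  | cons i l ih => simp [TW, applyT, ih]

theorem TW_nil (T : I → (Uq D ≃ₐ[𝕂] Uq D)) (u : Uq D) : TW T [] u = u := rfl
theorem TW_cons (T : I → (Uq D ≃ₐ[𝕂] Uq D)) (i : I) (l : List I) (u : Uq D) :
    TW T (i :: l) u = T i (TW T l u) := rfl
theorem TW_append (T : I → (Uq D ≃ₐ[𝕂] Uq D)) (l m : List I) (u : Uq D) :
    TW T (l ++ m) u = TW T l (TW T m u) := by
  induction l with
  | nil => rfl
  | cons i l ih => simp [TW_cons, ih]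
theorem TW_snoc (T : I → (Uq D ≃ₐ[𝕂] Uq D)) (l : List I) (i : I) (u : Uq D) :
    TW T (l ++ [i]) u = TW T l (T i u) := TW_append T l [i] u

/-- the induction principle for root vectors -/
theorem N_ind (P : List I → I → Prop) (h0 : ∀ i, P [] i)
    (hA : ∀ x i j, j ≠ i → D.adj j i = false → IsReducedWord D (x ++ [i]) → P x i → P (x ++ [j]) i)
    (hB : ∀ x y i j, D.adj i j = true → IsReducedWord D x → IsReducedWord D (y ++ [i]) →
      wordAct D x = wordAct D (y ++ [i]) → IsReducedWord D (y ++ [j]) → P y j → P (x ++ [j]) i)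
    (hC : ∀ x i j, D.adj i j = true → IsReducedWord D (x ++ [i]) → IsReducedWord D (x ++ [j]) →
      P x i → P x j → P (x ++ [j]) i) :
    ∀ (n : ℕ) (x : List I) (i : I), x.length = n → IsReducedWord D (x ++ [i]) → P x i := by
  intro n
  induction n using Nat.strong_induction_on with
  | _ n ih =>
  intro x i hl hx
  rcases List.eq_nil_or_concat' x with rfl | ⟨x, j, rfl⟩
  · exact h0 i
  have hji := act_cons_snoc_ne hx
  have hpos := red_pos hx
  rw [act_append, act_single] at hpos
  have hxj := red_left hx
  have hxr := red_left hxj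
  simp at hl
  cases hadj : D.adj j i
  · rw [sref_far D hji hadj] at hpos
    have := red_snoc hxr hpos
    exact hA x i j hji hadj this (ih x.length (by omega) x i rfl this)
  · have hadj' := adj_symm hadj
    by_cases hp : 0 ≤ wordAct D x (simpleRoot i)
    · have h2 := red_snoc hxr hp
      exact hC x i j hadj' h2 hxj (ih x.length (by omega) x i rfl h2)
        (ih x.length (by omega) x j rfl hxj)
    · obtain ⟨y, hy, e⟩ := red_descent hxr (nonpos_of_not D (act_norm D x i) hp)
      have hl2 := red_len hxr hy e
      simp at hl2
      have hyj : IsReducedWord D (y ++ [j]) := by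
        apply red_snoc (red_left hy)
        rw [sref_adj D hadj, ← e, act_append, act_single, add_comm, ← sref_adj D hadj', sref_sref] at hpos
        exact hpos
      exact hB x y i j hadj' hxr hy e.symm hyj (ih y.length (by omega) y j rfl hyj)

instance algLA : Algebra ↥LA (Uq D) := Algebra.compHom (Uq D) LA.subtype

theorem LA_smul (c : ↥LA) (u : Uq D) : c • u = (c : 𝕂) • u := rfl

abbrev Sub (D : ADEData I) := Submodule ↥LA (Uq D)

theorem smul_memS {M : Sub D} {c : 𝕂} (hc : c ∈ LA) {u : Uq D} (hu : u ∈ M) : c • u ∈ M :=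
  M.smul_mem (⟨c, hc⟩ : ↥LA) hu

/-- A-span of divided powers of x -/
def Pw (x : Uq D) : Sub D := Submodule.span ↥LA (Set.range (dp x))

/-- an automorphism as an LA-algebra map -/
def TA (f : Uq D ≃ₐ[𝕂] Uq D) : Uq D →ₐ[↥LA] Uq D :=
  { ((f : Uq D ≃+* Uq D) : Uq D →+* Uq D) with
    commutes' := fun r => f.commutes (r : 𝕂) }

theorem TA_apply (f : Uq D ≃ₐ[𝕂] Uq D) (u : Uq D) : TA f u = f u := rfl

/-- image of a submodule -/
def mp (f : Uq D ≃ₐ[𝕂] Uq D) (M : Sub D) : Sub D := M.map (TA f).toLinearMap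

theorem mp_mul (f : Uq D ≃ₐ[𝕂] Uq D) (M N : Sub D) : mp f (M * N) = mp f M * mp f N :=
  Submodule.map_mul M N (TA f)
theorem mp_one (f : Uq D ≃ₐ[𝕂] Uq D) : mp f (1 : Sub D) = 1 := Submodule.map_one (TA f)
theorem mp_mp (f g : Uq D ≃ₐ[𝕂] Uq D) (M : Sub D) : mp f (mp g M) = mp (g.trans f) M := by
  unfold mp; rw [← Submodule.map_comp]; rfl
theorem mp_refl (M : Sub D) : mp AlgEquiv.refl M = M := Submodule.map_id M
theorem mp_mono (f : Uq D ≃ₐ[𝕂] Uq D) {M N : Sub D} (h : M ≤ N) : mp f M ≤ mp f N := Submodule.map_mono h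
theorem mp_mem (f : Uq D ≃ₐ[𝕂] Uq D) {M : Sub D} {u : Uq D} (h : u ∈ M) : f u ∈ mp f M :=
  Submodule.mem_map_of_mem h
theorem mp_Pw (f : Uq D ≃ₐ[𝕂] Uq D) (x : Uq D) : mp f (Pw x) = Pw (f x) := by
  unfold mp Pw
  rw [Submodule.map_span, ← Set.range_comp]
  congr 2
  ext n
  exact map_dp f x n

theorem dp_mem_Pw (x : Uq D) (n : ℕ) : dp x n ∈ Pw x := Submodule.subset_span ⟨n, rfl⟩
theorem one_le_Pw (x : Uq D) : 1 ≤ Pw x := by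
  rw [Submodule.one_le, ← dp_zero x]; exact dp_mem_Pw x 0

theorem Pw_mul (x : Uq D) : Pw x * Pw x ≤ Pw x := by
  unfold Pw
  rw [Submodule.span_mul_span, Submodule.span_le]
  rintro _ ⟨_, ⟨a, rfl⟩, _, ⟨b, rfl⟩, rfl⟩
  show dp x a * dp x b ∈ _
  rw [dp_dp]
  exact smul_memS (LA_qbinom _ a b rfl) (dp_mem_Pw x _)

theorem Pw_comm {X Z : Uq D} {m : ℤ} (h : Z * X = qq ^ m • (X * Z)) : Pw Z * Pw X ≤ Pw X * Pw Z := by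
  conv_lhs => unfold Pw
  rw [Submodule.span_mul_span, Submodule.span_le]
  rintro _ ⟨_, ⟨a, rfl⟩, _, ⟨b, rfl⟩, rfl⟩
  show dp Z a * dp X b ∈ _
  rw [comm_dp2 h]
  exact smul_memS (LA_zpow _) (Submodule.mul_mem_mul (dp_mem_Pw X _) (dp_mem_Pw Z _))

theorem Pw_comm_eq {X Z : Uq D} (h : Z * X = X * Z) : Pw Z * Pw X = Pw X * Pw Z :=
  le_antisymm (Pw_comm (m := 0) (by simpa using h)) (Pw_comm (m := 0) (by simpa using h.symm))

section
variable {X Y Z : Uq D} (hYX : Y * X = qq • (X * Y) + Z)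
  (hZX : Z * X = qq ^ (-1 : ℤ) • (X * Z)) (hYZ : Y * Z = qq ^ (-1 : ℤ) • (Z * Y))
include hYX hZX hYZ

theorem PwYX : Pw Y * Pw X ≤ Pw X * Pw Z * Pw Y := by
  conv_lhs => unfold Pw
  rw [Submodule.span_mul_span, Submodule.span_le]
  rintro _ ⟨_, ⟨m, rfl⟩, _, ⟨a, rfl⟩, rfl⟩
  show dp Y m * dp X a ∈ _
  rw [← dpz_nat, ← dpz_nat, YX_formula hYX hZX hYZ]
  refine Submodule.sum_mem _ fun k hk => smul_memS (LA_zpow _) ?_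
  have memz : ∀ (x : Uq D) (n : ℤ), dpz x n ∈ Pw x := by
    intro x n
    cases n with
    | ofNat n => exact dp_mem_Pw x n
    | negSucc n => exact Submodule.zero_mem _
  exact Submodule.mul_mem_mul (Submodule.mul_mem_mul (memz _ _) (memz _ _)) (memz _ _)

theorem dpZ_mem (B : Subalgebra ↥LA (Uq D)) (hX : ∀ n, dp X n ∈ B) (hY : ∀ n, dp Y n ∈ B) (m : ℕ) :
    dp Z m ∈ B := by
  induction m using Nat.strong_induction_on with
  | _ m ih =>
  have := YX_formula hYX hZX hYZ m m
  rw [Finset.sum_range_succ, sub_self, mul_zero, zpow_zero, one_smul,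
    show dpz X 0 = 1 from dp_zero X, show dpz Y 0 = 1 from dp_zero Y, one_mul, mul_one, dpz_nat,
    dpz_nat, dpz_nat, ← sub_eq_iff_eq_add'] at this
  rw [← this]
  refine B.sub_mem (B.mul_mem (hY m) (hX m)) (B.sum_mem fun k hk => ?_)
  have hk := Finset.mem_range.1 hk
  obtain ⟨d, hd⟩ : ∃ d : ℕ, (m : ℤ) - k = d := ⟨m - k, by omega⟩
  rw [hd, dpz_nat, dpz_nat, dpz_nat]
  exact B.smul_mem (B.mul_mem (B.mul_mem (hX _) (ih k hk)) (hY _)) (⟨_, LA_zpow _⟩ : ↥LA)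

theorem rank2_eq : Pw X * Pw Z * Pw Y =
    Subalgebra.toSubmodule (Algebra.adjoin ↥LA (Set.range (dp X) ∪ Set.range (dp Y))) := by
  set B := Algebra.adjoin ↥LA (Set.range (dp X) ∪ Set.range (dp Y)) with hB
  have hXB : ∀ n, dp X n ∈ B := fun n => Algebra.subset_adjoin (Or.inl ⟨n, rfl⟩)
  have hYB : ∀ n, dp Y n ∈ B := fun n => Algebra.subset_adjoin (Or.inr ⟨n, rfl⟩)
  have hZB := dpZ_mem hYX hZX hYZ B hXB hYB
  have le : ∀ x : Uq D, (∀ n, dp x n ∈ B) → Pw x ≤ Subalgebra.toSubmodule B := fun x h => by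
    unfold Pw; rw [Submodule.span_le]; rintro _ ⟨n, rfl⟩; exact h n
  apply le_antisymm
  · calc Pw X * Pw Z * Pw Y ≤ Subalgebra.toSubmodule B * Subalgebra.toSubmodule B * Subalgebra.toSubmodule B :=
          mul_le_mul' (mul_le_mul' (le _ hXB) (le _ hZB)) (le _ hYB)
      _ = _ := by rw [Subalgebra.isIdempotentElem_toSubmodule B, Subalgebra.isIdempotentElem_toSubmodule B]
  · set M := Pw X * Pw Z * Pw Y with hM
    have h1 : 1 ≤ M := by
      calc (1 : Sub D) = 1 * 1 * 1 := by simp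
        _ ≤ M := mul_le_mul' (mul_le_mul' (one_le_Pw _) (one_le_Pw _)) (one_le_Pw _)
    have hX : Pw X * M ≤ M := by
      rw [hM, ← mul_assoc, ← mul_assoc]
      exact mul_le_mul' (mul_le_mul' (Pw_mul X) le_rfl) le_rfl
    have hY : Pw Y * M ≤ M := by
      calc Pw Y * M = (Pw Y * Pw X) * Pw Z * Pw Y := by rw [hM]; simp only [mul_assoc]
        _ ≤ (Pw X * Pw Z * Pw Y) * Pw Z * Pw Y :=
          mul_le_mul' (mul_le_mul' (PwYX hYX hZX hYZ) le_rfl) le_rfl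
        _ = Pw X * (Pw Z * ((Pw Y * Pw Z) * Pw Y)) := by simp only [mul_assoc]
        _ ≤ Pw X * (Pw Z * ((Pw Z * Pw Y) * Pw Y)) :=
          mul_le_mul' le_rfl (mul_le_mul' le_rfl (mul_le_mul' (Pw_comm hYZ) le_rfl))
        _ = Pw X * (Pw Z * Pw Z) * (Pw Y * Pw Y) := by simp only [mul_assoc]
        _ ≤ M := mul_le_mul' (mul_le_mul' le_rfl (Pw_mul Z)) (Pw_mul Y)
    intro b hb
    have key : ∀ m ∈ M, b * m ∈ M := by
      induction hb using Algebra.adjoin_induction with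
      | mem x hx =>
        intro m hm
        rcases hx with ⟨n, rfl⟩ | ⟨n, rfl⟩
        · exact hX (Submodule.mul_mem_mul (dp_mem_Pw X n) hm)
        · exact hY (Submodule.mul_mem_mul (dp_mem_Pw Y n) hm)
      | algebraMap r => intro m hm; rw [← Algebra.smul_def]; exact M.smul_mem r hm
      | add x y _ _ hx hy => intro m hm; rw [add_mul]; exact M.add_mem (hx m hm) (hy m hm)
      | mul x y _ _ hx hy => intro m hm; rw [mul_assoc]; exact hx _ (hy m hm)
    have := key 1 (Submodule.one_le.1 h1)
    rwa [mul_one] at this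
end

/-- the rank two relations in Uq -/
theorem rank2_rel {i j : I} (h : D.adj i j = true) {X Y Z : Uq D} (hX : X = FF D j) (hY : Y = FF D i)
    (hZ : Z = FF D i * FF D j - qq • (FF D j * FF D i)) :
    Y * X = qq • (X * Y) + Z ∧ Z * X = qq ^ (-1 : ℤ) • (X * Z) ∧ Y * Z = qq ^ (-1 : ℤ) • (Z * Y) := by
  have s1 := serreF' h
  have s2 := serreF' (adj_symm h)
  have h0 := qq_ne
  subst hX hY hZ
  have e1 := eq_sub_of_add_eq s1
  have e2 := eq_sub_of_add_eq' s2
  simp only [pow_two, mul_assoc] at e1 e2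
  refine ⟨by module, ?_, ?_⟩
  · simp only [zpow_neg, zpow_one, mul_sub, sub_mul, smul_sub, mul_smul_comm, smul_mul_assoc, smul_smul,
      mul_assoc, e2]
    match_scalars <;> field_simp <;> ring
  · simp only [zpow_neg, zpow_one, mul_sub, sub_mul, smul_sub, mul_smul_comm, smul_mul_assoc, smul_smul,
      mul_assoc, e1]
    match_scalars <;> field_simp <;> ring

variable {T : I → (Uq D ≃ₐ[𝕂] Uq D)}

/-- A-span of PBW monomials -/
def SS (T : I → (Uq D ≃ₐ[𝕂] Uq D)) : List I → Sub D
  | [] => 1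
  | i :: w => Pw (FF D i) * mp (T i) (SS T w)

theorem SS_append (u v : List I) : SS T (u ++ v) = SS T u * mp (TW T u) (SS T v) := by
  induction u with
  | nil => simp only [List.nil_append, SS, one_mul]; exact (mp_refl _).symm
  | cons i u ih => simp only [List.cons_append, SS, ih, mp_mul, mp_mp, mul_assoc, TW]

theorem SS_single (i : I) : SS T [i] = Pw (FF D i) := by simp [SS, mp_one]

theorem SS_two (i j : I) : SS T [i, j] = Pw (FF D i) * Pw (T i (FF D j)) := by
  rw [SS, SS_single, mp_Pw]
theorem SS_three (i j k : I) : SS T [i, j, k] = Pw (FF D i) * Pw (T i (FF D j)) * Pw (T i (T j (FF D k))) := by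
  rw [SS, SS_two, mp_mul, mp_Pw, mp_Pw, mul_assoc]

variable (hT : IsLusztigAuts D T)
include hT

theorem SS_far {i j : I} (h : i ≠ j) (h' : D.adj i j = false) : SS T [i, j] = SS T [j, i] := by
  rw [SS_two, SS_two, TF_far hT h h', TF_far hT h.symm (far_symm h')]
  exact Pw_comm_eq (FF_far h h')

theorem SS_near_eq {i j : I} (h : D.adj i j = true) : SS T [j, i, j] =
    Subalgebra.toSubmodule (Algebra.adjoin ↥LA (Set.range (dp (FF D j)) ∪ Set.range (dp (FF D i)))) := by
  have h' := adj_symm h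
  rw [SS_three, TT_F hT h']
  obtain ⟨h1, h2, h3⟩ := rank2_rel h rfl rfl (TF_adj hT h')
  exact rank2_eq h1 h2 h3

theorem SS_near {i j : I} (h : D.adj i j = true) : SS T [i, j, i] = SS T [j, i, j] := by
  rw [SS_near_eq hT h, SS_near_eq hT (adj_symm h), Set.union_comm]

theorem braid_inv {u v : List I} (hu : IsReducedWord D u) (hv : IsReducedWord D v)
    (e : wordAct D u = wordAct D v) : TW T u = TW T v ∧ SS T u = SS T v := by
  refine matsumoto (r := fun u v => TW T u = TW T v ∧ SS T u = SS T v) (fun x => ⟨rfl, rfl⟩)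
    (fun x y h => ⟨h.1.symm, h.2.symm⟩) (fun x y z h1 h2 => ⟨h1.1.trans h2.1, h1.2.trans h2.2⟩)
    ?_ ?_ ?_ u.length u v rfl hu hv e
  · rintro x y i ⟨h1, h2⟩
    exact ⟨by ext z; rw [TW_append, TW_append, h1], by rw [SS_append, SS_append, h1, h2]⟩
  · intro z i j h h'
    constructor
    · ext u; simp only [TW_snoc]; rw [braid_far hT h h']
    · simp only [List.append_assoc, List.cons_append, List.nil_append]
      rw [SS_append, SS_append z, SS_far hT h h']
  · intro z i j h
    constructor
    · ext u; simp only [TW_snoc]; rw [braid_near hT h]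
    · simp only [List.append_assoc, List.cons_append, List.nil_append]
      rw [SS_append, SS_append z, SS_near hT h]

theorem TW_eq {u v : List I} (hu : IsReducedWord D u) (hv : IsReducedWord D v)
    (e : wordAct D u = wordAct D v) : TW T u = TW T v := (braid_inv hT hu hv e).1

omit hT in
/-- integral form of `U^-` -/
def UA (D : ADEData I) : Subalgebra ↥LA (Uq D) :=
  Algebra.adjoin ↥LA {u | ∃ i n, u = dp (FF D i) n}

theorem UA_le_SS {w : List I} (hw : IsRedW0 D w) : Subalgebra.toSubmodule (UA D) ≤ SS T w := by
  have hone : ∀ l, (1 : Sub D) ≤ SS T l := by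
    intro l
    induction l with
    | nil => exact le_rfl
    | cons i l ih =>
      calc (1 : Sub D) = 1 * mp (T i) 1 := by simp [mp_one]
        _ ≤ _ := mul_le_mul' (one_le_Pw _) (mp_mono _ ih)
  have hl : ∀ i, Pw (FF D i) * SS T w ≤ SS T w := by
    intro i
    obtain ⟨y, hy⟩ := w0_start hw i
    rw [(braid_inv hT hw.1 hy.1 (w0_act hw hy)).2, SS, ← mul_assoc]
    exact mul_le_mul' (Pw_mul _) le_rfl
  intro b hb
  have key : ∀ m ∈ SS T w, b * m ∈ SS T w := by
    change b ∈ Algebra.adjoin _ _ at hb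
    induction hb using Algebra.adjoin_induction with
    | mem x hx =>
      obtain ⟨i, n, rfl⟩ := hx
      intro m hm
      exact hl i (Submodule.mul_mem_mul (dp_mem_Pw _ n) hm)
    | algebraMap r => intro m hm; rw [← Algebra.smul_def]; exact Submodule.smul_mem _ r hm
    | add x y _ _ hx hy => intro m hm; rw [add_mul]; exact Submodule.add_mem _ (hx m hm) (hy m hm)
    | mul x y _ _ hx hy => intro m hm; rw [mul_assoc]; exact hx _ (hy m hm)
  have := key 1 (Submodule.one_le.1 (hone w))
  rwa [mul_one] at this

theorem rootdp_mem_UA (x : List I) (i : I) (hx : IsReducedWord D (x ++ [i])) (n : ℕ) :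
    TW T x (dp (FF D i) n) ∈ UA D := by
  refine N_ind (D := D) (fun x i => ∀ n, TW T x (dp (FF D i) n) ∈ UA D) ?_ ?_ ?_ ?_ x.length x i rfl hx n
  · intro i n; exact Algebra.subset_adjoin ⟨i, n, rfl⟩
  · intro x i j hne hf _ ih n
    rw [TW_snoc, map_dp, TF_far hT hne hf]; exact ih n
  · intro x y i j h hx hy e _ ih n
    rw [TW_snoc, TW_eq hT hx hy e, TW_snoc, map_dp, map_dp, TT_F hT h]; exact ih n
  · intro x i j h _ _ hi hj n
    rw [TW_snoc, map_dp]
    obtain ⟨h1, h2, h3⟩ := rank2_rel h rfl rfl (TF_adj hT (adj_symm h))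
    have := dpZ_mem h1 h2 h3 ((UA D).comap (TA (TW T x))) hj hi n
    exact this

end Lattice
end QProof


namespace QProof
noncomputable section Verma
set_option linter.unusedSectionVars false
set_option linter.unusedSimpArgs false
set_option linter.unusedVariables false
attribute [local instance] Semiring.toNatAlgebra Ring.toIntAlgebra

variable {I : Type} [Fintype I] [DecidableEq I]

inductive PRel (D : ADEData I) : FreeAlgebra 𝕂 I → FreeAlgebra 𝕂 I → Prop
  | serre (i j : I) (h : D.adj i j = true) :
      PRel D (FreeAlgebra.ι 𝕂 i * (FreeAlgebra.ι 𝕂 i * FreeAlgebra.ι 𝕂 j)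
        + FreeAlgebra.ι 𝕂 j * (FreeAlgebra.ι 𝕂 i * FreeAlgebra.ι 𝕂 i))
        ((qq + qq⁻¹) • (FreeAlgebra.ι 𝕂 i * (FreeAlgebra.ι 𝕂 j * FreeAlgebra.ι 𝕂 i)))
  | far (i j : I) (h : i ≠ j) (h' : D.adj i j = false) :
      PRel D (FreeAlgebra.ι 𝕂 i * FreeAlgebra.ι 𝕂 j) (FreeAlgebra.ι 𝕂 j * FreeAlgebra.ι 𝕂 i)

abbrev PP (D : ADEData I) := RingQuot (PRel D)

def pf (D : ADEData I) (i : I) : PP D := RingQuot.mkAlgHom 𝕂 (PRel D) (FreeAlgebra.ι 𝕂 i)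

variable {D : ADEData I}

theorem pf_serre {i j : I} (h : D.adj i j = true) :
    pf D i * (pf D i * pf D j) + pf D j * (pf D i * pf D i) = (qq + qq⁻¹) • (pf D i * (pf D j * pf D i)) := by
  have := RingQuot.mkAlgHom_rel 𝕂 (PRel.serre i j h)
  simp only [map_add, map_mul, map_smul] at this
  exact this

theorem pf_far {i j : I} (h : i ≠ j) (h' : D.adj i j = false) : pf D i * pf D j = pf D j * pf D i := by
  have := RingQuot.mkAlgHom_rel 𝕂 (PRel.far i j h h')
  simp only [map_mul] at this
  exact this

/-- lift from P -/
def plift {A : Type} [Ring A] [Algebra 𝕂 A] (g : I → A)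
    (h1 : ∀ i j, D.adj i j = true → g i * (g i * g j) + g j * (g i * g i) = (qq + qq⁻¹) • (g i * (g j * g i)))
    (h2 : ∀ i j, i ≠ j → D.adj i j = false → g i * g j = g j * g i) : PP D →ₐ[𝕂] A :=
  RingQuot.liftAlgHom 𝕂 ⟨FreeAlgebra.lift 𝕂 g, by
    intro x y h
    cases h with
    | serre i j h => simpa using h1 i j h
    | far i j h h' => simpa using h2 i j h h'⟩

theorem plift_pf {A : Type} [Ring A] [Algebra 𝕂 A] (g : I → A)
    (h1 : ∀ i j, D.adj i j = true → g i * (g i * g j) + g j * (g i * g i) = (qq + qq⁻¹) • (g i * (g j * g i)))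
    (h2 : ∀ i j, i ≠ j → D.adj i j = false → g i * g j = g j * g i) (i : I) :
    plift (D := D) g h1 h2 (pf D i) = g i := by
  simp [plift, pf]

theorem P_ind {C : PP D → Prop} (h1 : C 1) (ha : ∀ x y, C x → C y → C (x + y))
    (hs : ∀ (c : 𝕂) x, C x → C (c • x)) (hm : ∀ x j, C x → C (x * pf D j)) (p : PP D) : C p := by
  have key : ∀ a : FreeAlgebra 𝕂 I, ∀ x, C x → C (x * RingQuot.mkAlgHom 𝕂 (PRel D) a) := by
    intro a
    induction a using FreeAlgebra.induction with
    | grade0 r => intro x hx; rw [AlgHom.commutes, ← Algebra.commutes, ← Algebra.smul_def]; exact hs r x hx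
    | grade1 j => intro x hx; exact hm x j hx
    | mul a b iha ihb => intro x hx; rw [map_mul, ← mul_assoc]; exact ihb _ (iha _ hx)
    | add a b iha ihb => intro x hx; rw [map_add, mul_add]; exact ha _ _ (iha _ hx) (ihb _ hx)
  obtain ⟨a, rfl⟩ := RingQuot.mkAlgHom_surjective 𝕂 (PRel D) p
  have := key a 1 h1
  rwa [one_mul] at this

theorem lin_ext {M : Type} [AddCommGroup M] [Module 𝕂 M] {X Y : PP D →ₗ[𝕂] M} (h1 : X 1 = Y 1)
    (hm : ∀ x j, X x = Y x → X (x * pf D j) = Y (x * pf D j)) : X = Y := by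
  ext p
  induction p using P_ind with
  | h1 => exact h1
  | ha x y hx hy => rw [map_add, map_add, hx, hy]
  | hs c x hx => rw [map_smul, map_smul, hx]
  | hm x j hx => exact hm x j hx

/-- matrix coefficient -/
def cE (D : ADEData I) (e : 𝕂) (i j : I) : 𝕂 := e ^ (cartan D i j)

def RM (e : 𝕂) (i j : I) : Matrix (Fin 2) (Fin 2) (PP D) :=
  !![cE D e i j • pf D j, (if i = j then 1 else 0); 0, pf D j]

theorem cE_self (e : 𝕂) (i : I) : cE D e i i = e ^ 2 := by
  rw [cE, cartan_self]; norm_cast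
theorem cE_adj (e : 𝕂) {i j : I} (h : D.adj i j = true) : cE D e i j = e⁻¹ := by
  rw [cE, cartan_adj D h, zpow_neg_one]
theorem cE_far (e : 𝕂) {i j : I} (h : i ≠ j) (h' : D.adj i j = false) : cE D e i j = 1 := by
  rw [cE, cartan_far D h h', zpow_zero]

theorem RM_serre {e : 𝕂} (he : e ≠ 0) (hq : e + e⁻¹ = qq + qq⁻¹) (l i j : I) (h : D.adj i j = true) :
    RM (D := D) e l i * (RM e l i * RM e l j) + RM e l j * (RM e l i * RM e l i) =
      (qq + qq⁻¹) • (RM e l i * (RM e l j * RM e l i)) := by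
  have hs := pf_serre h
  have hs' := eq_sub_of_add_eq' hs
  have hij := adj_ne D h
  have hji := hij.symm
  rw [← hq] at *
  have h01 : (RM (D := D) e l i * (RM e l i * RM e l j) + RM e l j * (RM e l i * RM e l i) : Matrix (Fin 2) (Fin 2) (PP D)) 0 1 =
      ((e + e⁻¹) • (RM (D := D) e l i * (RM e l j * RM e l i)) : Matrix (Fin 2) (Fin 2) (PP D)) 0 1 := by
    simp only [RM, Matrix.add_apply, Matrix.smul_apply, Matrix.mul_apply, Fin.sum_univ_two]
    simp
    by_cases hi : l = i
    · subst hi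
      simp only [hij, if_true, if_false, cE_self, cE_adj e h, mul_zero, zero_mul, mul_one, one_mul, add_zero, zero_add, smul_mul_assoc, mul_smul_comm, mul_add, smul_add, smul_smul, smul_zero]
      match_scalars <;> field_simp <;> ring
    · by_cases hj : l = j
      · subst hj
        simp only [hji, if_true, if_false, cE_self, cE_adj e (adj_symm h), mul_zero, zero_mul, mul_one, one_mul, add_zero, zero_add, smul_mul_assoc, mul_smul_comm, mul_add, smul_add, smul_smul, smul_zero]
        match_scalars <;> field_simp <;> ring
      · simp [hi, hj]
  have h00 : (RM (D := D) e l i * (RM e l i * RM e l j) + RM e l j * (RM e l i * RM e l i) : Matrix (Fin 2) (Fin 2) (PP D)) 0 0 =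
      ((e + e⁻¹) • (RM (D := D) e l i * (RM e l j * RM e l i)) : Matrix (Fin 2) (Fin 2) (PP D)) 0 0 := by
    simp only [RM, Matrix.add_apply, Matrix.smul_apply, Matrix.mul_apply, Fin.sum_univ_two]
    simp
    rw [hs']
    module
  ext a b
  fin_cases a <;> fin_cases b
  · exact h00
  · exact h01
  · simp [RM, Matrix.mul_apply, Fin.sum_univ_two]
  · simp [RM, Matrix.mul_apply, Fin.sum_univ_two, hs]

theorem RM_far (e : 𝕂) (l i j : I) (h : i ≠ j) (h' : D.adj i j = false) :
    RM (D := D) e l i * RM e l j = RM e l j * RM e l i := by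
  have hs := pf_far h h'
  ext a b
  fin_cases a <;> fin_cases b
  · simp [RM, Matrix.mul_apply, Fin.sum_univ_two, hs, smul_smul, mul_comm]
  · by_cases hi : l = i
    · subst hi
      simp [RM, Matrix.mul_apply, Fin.sum_univ_two, h, cE_far e h h']
    · by_cases hj : l = j
      · subst hj
        simp [RM, Matrix.mul_apply, Fin.sum_univ_two, hi, cE_far e hi (far_symm h')]
      · simp [RM, Matrix.mul_apply, Fin.sum_univ_two, hi, hj]
  · simp [RM, Matrix.mul_apply, Fin.sum_univ_two]
  · simp [RM, Matrix.mul_apply, Fin.sum_univ_two, hs]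

structure Good (e : 𝕂) : Prop where
  ne : e ≠ 0
  eq : e + e⁻¹ = qq + qq⁻¹

theorem good_q : Good qq := ⟨qq_ne, rfl⟩
theorem good_qi : Good qq⁻¹ := ⟨inv_ne_zero qq_ne, by rw [inv_inv, add_comm]⟩

def RR {e : 𝕂} (he : Good e) (l : I) : PP D →ₐ[𝕂] Matrix (Fin 2) (Fin 2) (PP D) :=
  plift (RM e l) (RM_serre he.ne he.eq l) (RM_far e l)

theorem RR_pf {e : 𝕂} (he : Good e) (l j : I) : RR he l (pf D j) = RM e l j := plift_pf _ _ _ _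

def phi {e : 𝕂} (he : Good e) (l : I) : PP D →ₗ[𝕂] PP D :=
  { toFun := fun p => RR he l p 0 0
    map_add' := fun x y => by simp
    map_smul' := fun c x => by simp }

def rr {e : 𝕂} (he : Good e) (l : I) : PP D →ₗ[𝕂] PP D :=
  { toFun := fun p => RR he l p 0 1
    map_add' := fun x y => by simp
    map_smul' := fun c x => by simp }

theorem phi_one {e : 𝕂} (he : Good e) (l : I) : phi (D := D) he l 1 = 1 := by simp [phi]
theorem rr_one {e : 𝕂} (he : Good e) (l : I) : rr (D := D) he l 1 = 0 := by simp [rr]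
theorem phi_mul {e : 𝕂} (he : Good e) (l j : I) (p : PP D) :
    phi he l (p * pf D j) = cE D e l j • (phi he l p * pf D j) := by
  simp [phi, RR_pf, Matrix.mul_apply, Fin.sum_univ_two, RM]
theorem rr_mul {e : 𝕂} (he : Good e) (l j : I) (p : PP D) :
    rr he l (p * pf D j) = (if l = j then phi he l p else 0) + rr he l p * pf D j := by
  simp [phi, rr, RR_pf, Matrix.mul_apply, Fin.sum_univ_two, RM]

/-- the operators -/
def oK (D : ADEData I) (i : I) : PP D →ₗ[𝕂] PP D := qq • phi good_q i
def oKi (D : ADEData I) (i : I) : PP D →ₗ[𝕂] PP D := qq⁻¹ • phi good_qi i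
def oH (D : ADEData I) (i : I) : PP D →ₗ[𝕂] PP D := (qq - qq⁻¹)⁻¹ • (oK D i - oKi D i)
def oE (D : ADEData I) (i : I) : PP D →ₗ[𝕂] PP D :=
  (qq - qq⁻¹)⁻¹ • (qq⁻¹ • rr good_qi i - qq • rr good_q i)
def oF (D : ADEData I) (i : I) : PP D →ₗ[𝕂] PP D := LinearMap.mulRight 𝕂 (pf D i)

theorem oK_one (i : I) : oK D i 1 = qq • 1 := by simp [oK, phi_one]
theorem oKi_one (i : I) : oKi D i 1 = qq⁻¹ • 1 := by simp [oKi, phi_one]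
theorem oE_one (i : I) : oE D i 1 = 0 := by simp [oE, rr_one]
theorem oF_apply (i : I) (p : PP D) : oF D i p = p * pf D i := rfl
theorem oK_mul (i j : I) (p : PP D) : oK D i (p * pf D j) = cE D qq i j • (oK D i p * pf D j) := by
  simp only [oK, LinearMap.smul_apply, phi_mul, smul_mul_assoc]; module
theorem oKi_mul (i j : I) (p : PP D) : oKi D i (p * pf D j) = (cE D qq i j)⁻¹ • (oKi D i p * pf D j) := by
  simp only [oKi, LinearMap.smul_apply, phi_mul, smul_mul_assoc, cE, inv_zpow]; module
theorem oH_apply (i : I) (p : PP D) : oH D i p = (qq - qq⁻¹)⁻¹ • (oK D i p - oKi D i p) := rfl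
theorem oE_mul_ne {i j : I} (h : i ≠ j) (p : PP D) : oE D i (p * pf D j) = oE D i p * pf D j := by
  simp only [oE, LinearMap.smul_apply, LinearMap.sub_apply, rr_mul, h, if_false, zero_add, smul_mul_assoc, sub_mul]
theorem oE_mul_self (i : I) (p : PP D) : oE D i (p * pf D i) = oE D i p * pf D i - oH D i p := by
  simp only [oE, oH, oK, oKi, LinearMap.smul_apply, LinearMap.sub_apply, rr_mul, if_true, smul_mul_assoc, sub_mul]
  module

theorem cE_ne (i j : I) : cE D qq i j ≠ 0 := zpow_ne_zero _ qq_ne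

theorem oKKi (i : I) (p : PP D) : oK D i (oKi D i p) = p := by
  have h0 := qq_ne
  have : oK D i ∘ₗ oKi D i = LinearMap.id := by
    apply lin_ext
    · simp [oK_one, oKi_one, smul_smul, h0]
    · intro x j h
      have := cE_ne (D := D) i j
      change oK D i (oKi D i x) = x at h
      change oK D i (oKi D i _) = _
      rw [oKi_mul, map_smul, oK_mul, h, smul_smul, inv_mul_cancel₀ this, one_smul]; rfl
  exact LinearMap.congr_fun this p

theorem oKiK (i : I) (p : PP D) : oKi D i (oK D i p) = p := by
  have h0 := qq_ne
  have : oKi D i ∘ₗ oK D i = LinearMap.id := by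
    apply lin_ext
    · simp [oK_one, oKi_one, smul_smul, h0]
    · intro x j h
      have := cE_ne (D := D) i j
      change oKi D i (oK D i x) = x at h
      change oKi D i (oK D i _) = _
      rw [oK_mul, map_smul, oKi_mul, h, smul_smul, mul_inv_cancel₀ this, one_smul]; rfl
  exact LinearMap.congr_fun this p

theorem oK_comm (i j : I) (p : PP D) : oK D i (oK D j p) = oK D j (oK D i p) := by
  have : oK D i ∘ₗ oK D j = oK D j ∘ₗ oK D i := by
    apply lin_ext
    · simp [oK_one]
    · intro x l h
      change oK D i (oK D j x) = oK D j (oK D i x) at h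
      change oK D i (oK D j _) = oK D j (oK D i _)
      rw [oK_mul, oK_mul, map_smul, map_smul, oK_mul, oK_mul, h, smul_comm]
  exact LinearMap.congr_fun this p

theorem oKKi_comm (i j : I) (p : PP D) : oK D i (oKi D j p) = oKi D j (oK D i p) := by
  rw [← oKiK j (oK D i (oKi D j p)), oK_comm, oKKi]

theorem oEK (i j : I) (p : PP D) : oE D j (oK D i p) = cE D qq i j • oK D i (oE D j p) := by
  have : oE D j ∘ₗ oK D i = cE D qq i j • (oK D i ∘ₗ oE D j) := by
    apply lin_ext
    · simp [oK_one, oE_one]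
    · intro x l h
      change oE D j (oK D i x) = cE D qq i j • oK D i (oE D j x) at h
      change oE D j (oK D i _) = cE D qq i j • oK D i (oE D j _)
      by_cases hl : j = l
      · subst hl
        simp only [oK_mul, map_smul, map_sub, oE_mul_self, oH_apply, h, oK_comm j i, oKKi_comm i j, smul_mul_assoc]
      · simp only [oK_mul, map_smul, oE_mul_ne hl, h, smul_mul_assoc]
        module
  exact LinearMap.congr_fun this p

theorem oEKi (i j : I) (p : PP D) : oE D j (oKi D i p) = (cE D qq i j)⁻¹ • oKi D i (oE D j p) := by
  have := oEK i j (oKi D i p)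
  rw [oKKi] at this
  rw [this, map_smul, oKiK, smul_smul, inv_mul_cancel₀ (cE_ne i j), one_smul]

theorem oE_serre {i j : I} (h : D.adj i j = true) (p : PP D) :
    oE D j (oE D i (oE D i p)) + oE D i (oE D i (oE D j p)) = (qq + qq⁻¹) • oE D i (oE D j (oE D i p)) := by
  have h0 := qq_ne
  have hd := qd_ne
  have hs := qs_ne
  have hij := adj_ne D h
  have hji := hij.symm
  have : oE D j ∘ₗ oE D i ∘ₗ oE D i + oE D i ∘ₗ oE D i ∘ₗ oE D j =
      (qq + qq⁻¹) • (oE D i ∘ₗ oE D j ∘ₗ oE D i) := by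
    apply lin_ext
    · simp [oE_one]
    · intro x l hx
      change oE D j (oE D i (oE D i x)) + oE D i (oE D i (oE D j x)) = (qq + qq⁻¹) • oE D i (oE D j (oE D i x)) at hx
      change oE D j (oE D i (oE D i _)) + oE D i (oE D i (oE D j _)) = (qq + qq⁻¹) • oE D i (oE D j (oE D i _))
      have hx' := eq_sub_of_add_eq hx
      by_cases hi : i = l
      · subst hi
        simp only [oE_mul_self, oE_mul_ne hji, map_sub, oH_apply, map_smul, oEK, oEKi, cE_self, cE_adj _ h,
          cE_adj _ (adj_symm h), hx', sub_mul, smul_mul_assoc]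
        match_scalars <;> field_simp <;> ring
      · by_cases hj : j = l
        · subst hj
          simp only [oE_mul_self, oE_mul_ne hij, map_sub, oH_apply, map_smul, oEK, oEKi, cE_self, cE_adj _ h,
            cE_adj _ (adj_symm h), hx', sub_mul, smul_mul_assoc]
          match_scalars <;> field_simp <;> ring
        · simp only [oE_mul_ne hi, oE_mul_ne hj, ← add_mul, hx, smul_mul_assoc]
  exact LinearMap.congr_fun this p

theorem oE_far {i j : I} (h : i ≠ j) (h' : D.adj i j = false) (p : PP D) :
    oE D j (oE D i p) = oE D i (oE D j p) := by
  have : oE D j ∘ₗ oE D i = oE D i ∘ₗ oE D j := by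
    apply lin_ext
    · simp [oE_one]
    · intro x l hx
      change oE D j (oE D i x) = oE D i (oE D j x) at hx
      change oE D j (oE D i _) = oE D i (oE D j _)
      by_cases hi : i = l
      · subst hi
        simp only [oE_mul_self, oE_mul_ne h.symm, map_sub, oH_apply, map_smul, oEK, oEKi, cE_far _ h h', hx, inv_one, one_smul]
      · by_cases hj : j = l
        · subst hj
          simp only [oE_mul_self, oE_mul_ne h, map_sub, oH_apply, map_smul, oEK, oEKi, cE_far _ h.symm (far_symm h'), hx, inv_one, one_smul]
        · simp only [oE_mul_ne hi, oE_mul_ne hj, hx]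
  exact LinearMap.congr_fun this p

end Verma
end QProof


namespace QProof
noncomputable section Verma2
set_option linter.unusedSectionVars false
set_option linter.unusedSimpArgs false
set_option linter.unusedVariables false
attribute [local instance] Semiring.toNatAlgebra Ring.toIntAlgebra

variable {I : Type} [Fintype I] [DecidableEq I] {D : ADEData I}

def rgen (D : ADEData I) : Gen I → (Module.End 𝕂 (PP D))ᵐᵒᵖ
  | Gen.E i => MulOpposite.op (oE D i)
  | Gen.F i => MulOpposite.op (oF D i)
  | Gen.K i => MulOpposite.op (oK D i)
  | Gen.Kinv i => MulOpposite.op (oKi D i)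

def rho (D : ADEData I) : Uq D →ₐ[𝕂] (Module.End 𝕂 (PP D))ᵐᵒᵖ :=
  RingQuot.liftAlgHom 𝕂 ⟨FreeAlgebra.lift 𝕂 (rgen D), by
    have h0 := qq_ne
    have hk : ∀ (i j : I) (c : 𝕂), cE D qq i j = c → ∀ p : PP D, oKi D i (oE D j (oK D i p)) = c • oE D j p := by
      intro i j c hc p
      rw [oEK, map_smul, oKiK, hc]
    have hf : ∀ (i j : I) (c : 𝕂), (cE D qq i j)⁻¹ = c → ∀ p : PP D, oKi D i (oF D j (oK D i p)) = c • oF D j p := by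
      intro i j c hc p
      rw [oF_apply, oKi_mul, oKiK, hc, oF_apply]
    intro x y h
    cases h with
    | KKinv i =>
      simp only [gK, gKinv, map_mul, FreeAlgebra.lift_ι_apply, rgen, map_one]
      apply MulOpposite.unop_injective; ext p; exact oKiK i p
    | KinvK i =>
      simp only [gK, gKinv, map_mul, FreeAlgebra.lift_ι_apply, rgen, map_one]
      apply MulOpposite.unop_injective; ext p; exact oKKi i p
    | KcommK i j =>
      simp only [gK, gKinv, map_mul, FreeAlgebra.lift_ι_apply, rgen, map_one]
      apply MulOpposite.unop_injective; ext p; exact oK_comm j i p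
    | KEself i =>
      simp only [gK, gE, gKinv, map_mul, map_smul, FreeAlgebra.lift_ι_apply, rgen, map_one]
      apply MulOpposite.unop_injective; ext p; exact hk i i _ (cE_self _ _) p
    | KFself i =>
      simp only [gK, gF, gKinv, map_mul, map_smul, FreeAlgebra.lift_ι_apply, rgen, map_one]
      apply MulOpposite.unop_injective; ext p; exact hf i i _ (by rw [cE_self]) p
    | EFdiff i j h =>
      simp only [gE, gF, map_mul, map_sub, map_smul, FreeAlgebra.lift_ι_apply, rgen, map_one, map_zero]
      apply MulOpposite.unop_injective; ext p
      change oF D j (oE D i p) - oE D i (oF D j p) = 0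
      rw [oF_apply, oF_apply, oE_mul_ne h, sub_self]
    | EFself i =>
      simp only [gE, gF, gK, gKinv, map_mul, map_sub, map_smul, FreeAlgebra.lift_ι_apply, rgen, map_one, map_zero]
      apply MulOpposite.unop_injective; ext p
      change oF D i (oE D i p) - oE D i (oF D i p) = oH D i p
      rw [oF_apply, oF_apply, oE_mul_self]; module
    | serreE i j h =>
      simp only [gE, gF, gK, gKinv, map_mul, map_add, map_pow, map_smul, FreeAlgebra.lift_ι_apply, rgen, map_one, map_zero]
      apply MulOpposite.unop_injective; ext p
      exact oE_serre h p
    | serreF i j h =>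
      simp only [gE, gF, gK, gKinv, map_mul, map_add, map_pow, map_smul, FreeAlgebra.lift_ι_apply, rgen, map_one, map_zero]
      apply MulOpposite.unop_injective; ext p
      change p * pf D i * pf D i * pf D j + p * pf D j * pf D i * pf D i = (qq + qq⁻¹) • (p * pf D i * pf D j * pf D i)
      simp only [mul_assoc, ← mul_add, pf_serre h, mul_smul_comm]
    | KEadj i j h =>
      simp only [gK, gE, gKinv, map_mul, map_smul, FreeAlgebra.lift_ι_apply, rgen, map_one]
      apply MulOpposite.unop_injective; ext p; exact hk i j _ (cE_adj _ h) p
    | KFadj i j h =>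
      simp only [gK, gF, gKinv, map_mul, map_smul, FreeAlgebra.lift_ι_apply, rgen, map_one]
      apply MulOpposite.unop_injective; ext p; exact hf i j _ (by rw [cE_adj _ h, inv_inv]) p
    | EEfar i j h h' =>
      simp only [gK, gE, gKinv, map_mul, map_smul, FreeAlgebra.lift_ι_apply, rgen, map_one]
      apply MulOpposite.unop_injective; ext p; exact oE_far h h' p
    | FFfar i j h h' =>
      simp only [gK, gF, gKinv, map_mul, map_smul, FreeAlgebra.lift_ι_apply, rgen, map_one]
      apply MulOpposite.unop_injective; ext p
      change p * pf D i * pf D j = p * pf D j * pf D i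
      simp only [mul_assoc, pf_far h h']
    | KEfar i j h h' =>
      simp only [gK, gE, gKinv, map_mul, map_smul, FreeAlgebra.lift_ι_apply, rgen, map_one]
      apply MulOpposite.unop_injective; ext p
      exact (hk i j _ (cE_far _ h h') p).trans (one_smul _ _)
    | KFfar i j h h' =>
      simp only [gK, gF, gKinv, map_mul, map_smul, FreeAlgebra.lift_ι_apply, rgen, map_one]
      apply MulOpposite.unop_injective; ext p
      exact (hf i j _ (by rw [cE_far _ h h', inv_one]) p).trans (one_smul _ _)⟩

/-- right action -/
def ra (u : Uq D) : PP D →ₗ[𝕂] PP D := (rho D u).unop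

theorem ra_mul (u v : Uq D) (p : PP D) : ra (u * v) p = ra v (ra u p) := by
  simp only [ra, map_mul, MulOpposite.unop_mul]; rfl
theorem ra_add (u v : Uq D) (p : PP D) : ra (u + v) p = ra u p + ra v p := by
  simp only [ra, map_add, MulOpposite.unop_add]; rfl
theorem ra_smul (c : 𝕂) (u : Uq D) (p : PP D) : ra (c • u) p = c • ra u p := by
  simp only [ra, map_smul, MulOpposite.unop_smul]; rfl
theorem ra_zero (p : PP D) : ra (0 : Uq D) p = 0 := by simp only [ra, map_zero]; rfl
theorem ra_one (p : PP D) : ra (1 : Uq D) p = p := by simp only [ra, map_one]; rfl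
theorem ra_sum {ι : Type} (s : Finset ι) (g : ι → Uq D) (p : PP D) :
    ra (∑ n ∈ s, g n) p = ∑ n ∈ s, ra (g n) p := by
  classical
  induction s using Finset.induction_on with
  | empty => simp [ra_zero]
  | insert a s h ih => rw [Finset.sum_insert h, Finset.sum_insert h, ra_add, ih]
theorem ra_E (i : I) (p : PP D) : ra (EE D i) p = oE D i p := by
  simp [ra, rho, EE, gE, rgen]
theorem ra_F (i : I) (p : PP D) : ra (FF D i) p = p * pf D i := by
  simp [ra, rho, FF, gF, rgen, oF_apply]
theorem ra_K (i : I) (p : PP D) : ra (KK D i) p = oK D i p := by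
  simp [ra, rho, KK, gK, rgen]

/-- P maps onto U^- -/
def piP (D : ADEData I) : PP D →ₐ[𝕂] Uq D :=
  plift (FF D) (fun i j h => by
    have := serreF' h
    simpa only [pow_two, mul_assoc] using this) (fun i j h h' => FF_far h h')

theorem piP_pf (i : I) : piP D (pf D i) = FF D i := plift_pf _ _ _ _

theorem ra_piP (p : PP D) (x : PP D) : ra (piP D p) x = x * p := by
  induction p using P_ind generalizing x with
  | h1 => rw [map_one, ra_one, mul_one]
  | ha p q hp hq => rw [map_add, ra_add, hp, hq, mul_add]
  | hs c p hp => rw [map_smul, ra_smul, hp, mul_smul_comm]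
  | hm p j hp => rw [map_mul, ra_mul, hp, piP_pf, ra_F, mul_assoc]

theorem piP_surj {z : Uq D} (hz : z ∈ Uminus D) : ∃ p, piP D p = z := by
  have : Uminus D ≤ (piP D).range := by
    apply Algebra.adjoin_le
    rintro _ ⟨i, rfl⟩
    exact ⟨pf D i, piP_pf i⟩
  exact this hz

theorem R2 {z : Uq D} (hz : z ∈ Uminus D) (h : ra z 1 = 0) : z = 0 := by
  obtain ⟨p, rfl⟩ := piP_surj hz
  rw [ra_piP, one_mul] at h
  rw [h, map_zero]

/-- the right ideal `Σ E_j U` -/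
def EU (D : ADEData I) : Submodule 𝕂 (Uq D) := Submodule.span 𝕂 {v | ∃ j u, v = EE D j * u}

theorem V1 {z : Uq D} (hz : z ∈ Uminus D) (h : z ∈ EU D) : z = 0 := by
  apply R2 hz
  clear hz
  unfold EU at h
  induction h using Submodule.span_induction with
  | mem x hx => obtain ⟨j, u, rfl⟩ := hx; rw [ra_mul, ra_E, oE_one, map_zero]
  | zero => exact ra_zero 1
  | add x y _ _ hx hy => rw [ra_add, hx, hy, add_zero]
  | smul c x _ hx => rw [ra_smul, hx, smul_zero]

theorem oK_pow (i : I) (m : ℕ) : oK D i (pf D i ^ m) = qq ^ (2 * m + 1 : ℤ) • pf D i ^ m := by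
  have h0 := qq_ne
  induction m with
  | zero => simp [oK_one]
  | succ m ih =>
    rw [pow_succ, oK_mul, ih, cE_self, smul_mul_assoc, smul_smul]
    congr 1
    rw [← zpow_natCast qq 2, ← zpow_add₀ h0]; congr 1; push_cast; ring

theorem oKi_pow (i : I) (m : ℕ) : oKi D i (pf D i ^ m) = qq ^ (-(2 * m + 1) : ℤ) • pf D i ^ m := by
  have h0 := qq_ne
  have := congrArg (oKi D i) (oK_pow (D := D) i m)
  rw [oKiK, map_smul] at this
  conv_rhs => rw [this]
  rw [smul_smul, ← zpow_add₀ h0, neg_add_cancel, zpow_zero, one_smul]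

theorem oE_pow (i : I) (m : ℕ) : oE D i (pf D i ^ (m + 1)) = (-(qz (m + 1)) ^ 2) • pf D i ^ m := by
  have h0 := qq_ne
  have hd := qd_ne
  induction m with
  | zero =>
    have := oE_mul_self (D := D) i 1
    rw [oE_one, one_mul, oH_apply, oK_one, oKi_one] at this
    have e1 : qz (((0:ℕ):ℤ) + 1) = 1 := by rw [Nat.cast_zero, zero_add]; exact qz_one
    rw [zero_add, pow_one, this, zero_mul, e1, pow_zero]
    have e2 := inv_mul_cancel₀ hd
    match_scalars
    linear_combination (-1) * e2
  | succ m ih =>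
    rw [pow_succ, oE_mul_self, ih, oH_apply, oK_pow, oKi_pow, smul_mul_assoc, ← pow_succ]
    match_scalars
    simp only [qz]
    have e : ∀ n : ℤ, qq ^ (-n) = (qq ^ n)⁻¹ := fun n => zpow_neg _ _
    have e1 : qq ^ ((m : ℤ) + 1) = qq ^ (m : ℤ) * qq := by rw [zpow_add₀ h0, zpow_one]
    have e2 : qq ^ ((m : ℤ) + 1 + 1) = qq ^ (m : ℤ) * qq * qq := by rw [zpow_add₀ h0, zpow_one, e1]
    have e3 : qq ^ (2 * ((m : ℤ) + 1) + 1) = (qq ^ (m : ℤ)) ^ 2 * qq ^ 3 := by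
      rw [← zpow_natCast, ← zpow_natCast, ← zpow_mul, ← zpow_add₀ h0]; congr 1; push_cast; ring
    push_cast
    rw [e, e, e, e1, e2, e3]
    have hm : qq ^ (m : ℤ) ≠ 0 := zpow_ne_zero _ h0
    generalize qq ^ (m : ℤ) = y at *
    field_simp
    ring

theorem ra_Epow_lt (i : I) {m n : ℕ} (h : m < n) : ra (EE D i ^ n) (pf D i ^ m) = 0 := by
  induction m generalizing n with
  | zero =>
    obtain ⟨n, rfl⟩ := Nat.exists_eq_add_of_lt h
    rw [zero_add, pow_succ', ra_mul, ra_E, pow_zero, oE_one, map_zero]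
  | succ m ih =>
    obtain ⟨n, rfl⟩ : ∃ k, n = k + 1 := ⟨n - 1, by omega⟩
    rw [pow_succ', ra_mul, ra_E, oE_pow, map_smul, ih (by omega), smul_zero]

theorem ra_Epow_eq (i : I) (m : ℕ) : ∃ c : 𝕂, c ≠ 0 ∧ ra (EE D i ^ m) (pf D i ^ m) = c • 1 := by
  induction m with
  | zero => exact ⟨1, one_ne_zero, by simp [ra_one]⟩
  | succ m ih =>
    obtain ⟨c, hc, h⟩ := ih
    refine ⟨-(qz (m + 1)) ^ 2 * c, ?_, ?_⟩
    · exact mul_ne_zero (neg_ne_zero.2 (pow_ne_zero _ (qz_ne (by omega)))) hc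
    · rw [pow_succ', ra_mul, ra_E, oE_pow, map_smul, h, smul_smul]

theorem ra_Kpow (i : I) (n : ℕ) : ra (KK D i ^ n) 1 = qq ^ n • 1 := by
  induction n with
  | zero => simp [ra_one]
  | succ n ih => rw [pow_succ, ra_mul, ih, map_smul, ra_K, oK_one, smul_smul, pow_succ]

theorem Ind (i : I) (s : Finset ℕ) (z : ℕ → Uq D) (hz : ∀ n, z n ∈ Uminus D)
    (h : ∑ n ∈ s, EE D i ^ n * KK D i ^ n * z n = 0) : ∀ n ∈ s, z n = 0 := by
  intro n
  induction n using Nat.strong_induction_on with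
  | _ m ih =>
  intro hm
  have h2 := congrArg (fun u => ra u (pf D i ^ m)) h
  simp only [ra_sum, ra_zero] at h2
  rw [Finset.sum_eq_single m] at h2
  · obtain ⟨c, hc, e⟩ := ra_Epow_eq (D := D) i m
    rw [ra_mul, ra_mul, e, map_smul, map_smul, ra_Kpow, map_smul, smul_smul] at h2
    exact R2 (hz m) ((smul_eq_zero.1 h2).resolve_left (mul_ne_zero hc (pow_ne_zero m qq_ne)))
  · intro n hn hne
    rcases lt_or_gt_of_ne hne with hlt | hgt
    · rw [ih n hlt hn, mul_zero, ra_zero]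
    · rw [ra_mul, ra_mul, ra_Epow_lt i hgt, map_zero, map_zero]
  · intro h; exact absurd hm h

end Verma2
end QProof


namespace QProof
noncomputable section Sigma
set_option linter.unusedSectionVars false
set_option linter.unusedSimpArgs false
set_option linter.unusedVariables false
set_option linter.unusedTactic false
attribute [local instance] Semiring.toNatAlgebra Ring.toIntAlgebra

variable {I : Type} [Fintype I] [DecidableEq I] {D : ADEData I}

def sgen (D : ADEData I) : Gen I → (Uq D)ᵐᵒᵖ
  | Gen.E i => MulOpposite.op (EE D i)
  | Gen.F i => MulOpposite.op (FF D i)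
  | Gen.K i => MulOpposite.op (KKinv D i)
  | Gen.Kinv i => MulOpposite.op (KK D i)

def sgm (D : ADEData I) : Uq D →ₐ[𝕂] (Uq D)ᵐᵒᵖ :=
  RingQuot.liftAlgHom 𝕂 ⟨FreeAlgebra.lift 𝕂 (sgen D), by
    intro x y h
    cases h with
    | KKinv i =>
      simp only [gK, gKinv, map_mul, FreeAlgebra.lift_ι_apply, sgen, map_one]
      apply MulOpposite.unop_injective; exact KKi i
    | KinvK i =>
      simp only [gK, gKinv, map_mul, FreeAlgebra.lift_ι_apply, sgen, map_one]
      apply MulOpposite.unop_injective; exact KiK i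
    | KcommK i j =>
      simp only [gK, gKinv, map_mul, FreeAlgebra.lift_ι_apply, sgen, map_one]
      apply MulOpposite.unop_injective; exact Ki_Ki j i
    | KEself i =>
      simp only [gK, gE, gKinv, map_mul, map_smul, FreeAlgebra.lift_ι_apply, sgen, map_one]
      apply MulOpposite.unop_injective
      change KK D i * (EE D i * KKinv D i) = qq ^ 2 • EE D i
      rw [← mul_assoc, KEK, cartan_self]; rfl
    | KFself i =>
      simp only [gK, gF, gKinv, map_mul, map_smul, FreeAlgebra.lift_ι_apply, sgen, map_one]
      apply MulOpposite.unop_injective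
      change KK D i * (FF D i * KKinv D i) = (qq ^ 2)⁻¹ • FF D i
      rw [← mul_assoc, KFK, cartan_self]; rfl
    | EFdiff i j h =>
      simp only [gE, gF, map_mul, map_sub, map_smul, FreeAlgebra.lift_ι_apply, sgen, map_one, map_zero]
      apply MulOpposite.unop_injective
      change FF D j * EE D i - EE D i * FF D j = 0
      rw [EF_ne h, sub_self]
    | EFself i =>
      simp only [gE, gF, gK, gKinv, map_mul, map_sub, map_smul, FreeAlgebra.lift_ι_apply, sgen, map_one, map_zero]
      apply MulOpposite.unop_injective
      change FF D i * EE D i - EE D i * FF D i = (qq - qq⁻¹)⁻¹ • (KKinv D i - KK D i)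
      rw [EF_self]; module
    | serreE i j h =>
      simp only [gE, gF, gK, gKinv, map_mul, map_add, map_pow, map_smul, FreeAlgebra.lift_ι_apply, sgen, map_one, map_zero]
      apply MulOpposite.unop_injective
      change EE D j * EE D i ^ 2 + EE D i ^ 2 * EE D j = (qq + qq⁻¹) • (EE D i * (EE D j * EE D i))
      rw [add_comm, serreE' h, mul_assoc]
    | serreF i j h =>
      simp only [gE, gF, gK, gKinv, map_mul, map_add, map_pow, map_smul, FreeAlgebra.lift_ι_apply, sgen, map_one, map_zero]
      apply MulOpposite.unop_injective
      change FF D j * FF D i ^ 2 + FF D i ^ 2 * FF D j = (qq + qq⁻¹) • (FF D i * (FF D j * FF D i))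
      rw [add_comm, serreF' h, mul_assoc]
    | KEadj i j h =>
      simp only [gK, gE, gKinv, map_mul, map_smul, FreeAlgebra.lift_ι_apply, sgen, map_one]
      apply MulOpposite.unop_injective
      change KK D i * (EE D j * KKinv D i) = qq⁻¹ • EE D j
      rw [← mul_assoc, KEK, cartan_adj D h, zpow_neg, zpow_one]
    | KFadj i j h =>
      simp only [gK, gF, gKinv, map_mul, map_smul, FreeAlgebra.lift_ι_apply, sgen, map_one]
      apply MulOpposite.unop_injective
      change KK D i * (FF D j * KKinv D i) = qq • FF D j
      rw [← mul_assoc, KFK, cartan_adj D h, neg_neg, zpow_one]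
    | EEfar i j h h' =>
      simp only [gK, gE, gKinv, map_mul, map_smul, FreeAlgebra.lift_ι_apply, sgen, map_one]
      apply MulOpposite.unop_injective; exact (EE_far h h').symm
    | FFfar i j h h' =>
      simp only [gK, gF, gKinv, map_mul, map_smul, FreeAlgebra.lift_ι_apply, sgen, map_one]
      apply MulOpposite.unop_injective; exact (FF_far h h').symm
    | KEfar i j h h' =>
      simp only [gK, gE, gKinv, map_mul, map_smul, FreeAlgebra.lift_ι_apply, sgen, map_one]
      apply MulOpposite.unop_injective
      change KK D i * (EE D j * KKinv D i) = EE D j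
      rw [← mul_assoc, KEK, cartan_far D h h', zpow_zero, one_smul]
    | KFfar i j h h' =>
      simp only [gK, gF, gKinv, map_mul, map_smul, FreeAlgebra.lift_ι_apply, sgen, map_one]
      apply MulOpposite.unop_injective
      change KK D i * (FF D j * KKinv D i) = FF D j
      rw [← mul_assoc, KFK, cartan_far D h h', neg_zero, zpow_zero, one_smul]⟩

/-- the anti-involution -/
def su : Uq D →ₗ[𝕂] Uq D := (MulOpposite.opLinearEquiv 𝕂).symm.toLinearMap ∘ₗ (sgm D).toLinearMap

theorem su_mul (u v : Uq D) : su (u * v) = su v * su u := by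
  change (sgm D (u * v)).unop = (sgm D v).unop * (sgm D u).unop
  rw [map_mul]; rfl
theorem su_one : su (1 : Uq D) = 1 := by
  change (sgm D 1).unop = 1
  rw [map_one]; rfl
theorem su_E (i : I) : su (EE D i) = EE D i := by
  change (sgm D (EE D i)).unop = _
  simp [sgm, EE, gE, sgen]
theorem su_F (i : I) : su (FF D i) = FF D i := by
  change (sgm D (FF D i)).unop = _
  simp [sgm, FF, gF, sgen]
theorem su_K (i : I) : su (KK D i) = KKinv D i := by
  change (sgm D (KK D i)).unop = _
  simp [sgm, KK, gK, sgen]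
theorem su_Ki (i : I) : su (KKinv D i) = KK D i := by
  change (sgm D (KKinv D i)).unop = _
  simp [sgm, KKinv, gKinv, sgen]

def conjS (f : Uq D →ₐ[𝕂] Uq D) : Uq D →ₐ[𝕂] Uq D :=
  AlgHom.ofLinearMap (su ∘ₗ f.toLinearMap ∘ₗ su)
    (by change su (f (su 1)) = 1; rw [su_one, map_one, su_one])
    (by intro x y; change su (f (su (x * y))) = su (f (su x)) * su (f (su y))
        rw [su_mul, map_mul, su_mul])
theorem conjS_apply (f : Uq D →ₐ[𝕂] Uq D) (u : Uq D) : conjS f u = su (f (su u)) := rfl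

theorem su_su (u : Uq D) : su (su u) = u := by
  have : conjS (AlgHom.id 𝕂 (Uq D)) = AlgHom.id 𝕂 (Uq D) := by
    apply hom_ext
    · intro i; change su (su _) = _; rw [su_E, su_E]; rfl
    · intro i; change su (su _) = _; rw [su_F, su_F]; rfl
    · intro i; change su (su _) = _; rw [su_K, su_Ki]; rfl
  exact congrArg (fun f => f u) this

variable {T : I → (Uq D ≃ₐ[𝕂] Uq D)}
theorem T_su_T_su (hT : IsLusztigAuts D T) (i : I) (u : Uq D) : T i (su (T i (su u))) = u := by
  have key : (T i).toAlgHom.comp (conjS (T i).toAlgHom) = AlgHom.id 𝕂 (Uq D) := by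
    have hd := qd_ne
    have h0 := qq_ne
    have hs := qs_ne
    apply hom_ext
    · intro j
      change T i (su (T i (su (EE D j)))) = EE D j
      rw [su_E]
      by_cases hij : i = j
      · subst hij
        rw [TE_self hT, map_smul, su_mul, su_K, su_F, map_smul, map_mul, TKi_self hT, TF_self hT,
          mul_smul_comm, smul_smul, ← mul_assoc, KKi, one_mul]; simp
      cases h : D.adj i j
      · rw [TE_far hT hij h, su_E, TE_far hT hij h]
      · rw [TE_adj hT h, map_sub, map_smul, su_mul, su_mul, su_E, su_E, map_sub, map_smul, map_mul, map_mul,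
          TE_adj hT h, TE_self hT]
        have a1 := EF_self (D := D) i
        have a2 := EF_ne (D := D) hij
        have a22 := EF_ne (D := D) (Ne.symm hij)
        have a3 := K_E (D := D) i i
        have a4 := K_E (D := D) i j
        have a5 := Ki_E (D := D) i j
        rw [cartan_self] at a3
        rw [cartan_adj D h] at a4 a5
        have a6 := KiK (D := D) i
        have a7 := K_F (D := D) i i
        rw [cartan_self] at a7
        simp only [neg_mul, mul_neg, mul_sub, sub_mul, mul_add, add_mul, smul_sub, smul_add, smul_neg,
          smul_mul_assoc, mul_smul_comm, smul_smul,
          mul_assoc, a1, a22, a3, a4, a5, a6, assoc_rw a1, assoc_rw a22, assoc_rw a3, assoc_rw a4,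
          assoc_rw a5, assoc_rw a6, one_mul, mul_one, KKi]
        simp only [neg_neg, zpow_neg, zpow_one, zpow_ofNat]
        match_scalars <;> field_simp <;> ring
    · intro j
      change T i (su (T i (su (FF D j)))) = FF D j
      rw [su_F]
      by_cases hij : i = j
      · subst hij
        rw [TF_self hT, map_smul, su_mul, su_Ki, su_E, map_smul, map_mul, TK_self hT, TE_self hT,
          smul_mul_assoc, smul_smul, mul_assoc, KKi, mul_one]; simp
      cases h : D.adj i j
      · rw [TF_far hT hij h, su_F, TF_far hT hij h]
      · rw [TF_adj hT h, map_sub, map_smul, su_mul, su_mul, su_F, su_F, map_sub, map_smul, map_mul, map_mul,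
          TF_adj hT h, TF_self hT]
        have a1 := EF_self (D := D) i
        have a2 := EF_ne (D := D) (adj_ne D h)
        have a3 := Ki_F (D := D) i i
        have a4 := Ki_F (D := D) i j
        have a5 := K_F (D := D) i j
        rw [cartan_self] at a3
        rw [cartan_adj D h] at a4 a5
        have a6 := KiK (D := D) i
        simp only [neg_mul, mul_neg, mul_sub, sub_mul, mul_add, add_mul, smul_sub, smul_add, smul_neg,
          smul_mul_assoc, mul_smul_comm, smul_smul,
          mul_assoc, a1, a2, a3, a4, a5, a6, assoc_rw a1, assoc_rw a2, assoc_rw a3, assoc_rw a4,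
          assoc_rw a5, assoc_rw a6, one_mul, mul_one]
        simp only [neg_neg, zpow_neg, zpow_one, zpow_ofNat]
        match_scalars <;> field_simp <;> ring
    · intro j
      change T i (su (T i (su (KK D j)))) = KK D j
      rw [su_K]
      by_cases hij : i = j
      · subst hij
        rw [TKi_self hT, su_K, TKi_self hT]
      cases h : D.adj i j
      · rw [TKi_far hT hij h, su_Ki, TK_far hT hij h]
      · rw [TKi_adj hT h, su_mul, su_Ki, su_Ki, map_mul, TK_self hT, TK_adj hT h, K_comm, mul_assoc, KKi, mul_one]
  exact congrArg (fun f => f u) key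

theorem T_symm (hT : IsLusztigAuts D T) (i : I) (u : Uq D) : (T i).symm u = su (T i (su u)) := by
  rw [AlgEquiv.symm_apply_eq, T_su_T_su hT]

theorem TW_su (hT : IsLusztigAuts D T) (z : List I) (u : Uq D) :
    TW T z (su (TW T z.reverse (su u))) = u := by
  induction z generalizing u with
  | nil => exact su_su u
  | cons i z ih =>
    rw [List.reverse_cons, TW_snoc, TW_cons, ← su_su (T i (su u)), ih, T_su_T_su hT]

theorem TW_symm (hT : IsLusztigAuts D T) (z : List I) (u : Uq D) :
    (TW T z).symm u = su (TW T z.reverse (su u)) := by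
  rw [AlgEquiv.symm_apply_eq, TW_su hT]

end Sigma
end QProof


namespace QProof
noncomputable section GWsec
set_option linter.unusedSectionVars false
set_option linter.unusedSimpArgs false
set_option linter.unusedVariables false
set_option linter.unusedTactic false
attribute [local instance] Semiring.toNatAlgebra Ring.toIntAlgebra

variable {I : Type} [Fintype I] [DecidableEq I] {D : ADEData I}
variable {T : I → (Uq D ≃ₐ[𝕂] Uq D)}

/-- weight spaces of the subalgebra generated by `G` -/
def GW (G : I → Uq D) (μ : I → ℤ) : Submodule 𝕂 (Uq D) :=
  Submodule.span 𝕂 {u | ∃ l : List I, (l.map simpleRoot).sum = μ ∧ u = (l.map G).prod}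

theorem GW_gen (G : I → Uq D) (i : I) : G i ∈ GW G (simpleRoot i) :=
  Submodule.subset_span ⟨[i], by simp, by simp⟩

theorem GW_mul (G : I → Uq D) {μ ν : I → ℤ} {u v : Uq D} (hu : u ∈ GW G μ) (hv : v ∈ GW G ν) :
    u * v ∈ GW G (μ + ν) := by
  have := Submodule.mul_mem_mul hu hv
  unfold GW at this
  rw [Submodule.span_mul_span] at this
  refine Submodule.span_mono ?_ this
  rintro _ ⟨_, ⟨l, hl, rfl⟩, _, ⟨m, hm, rfl⟩, rfl⟩
  exact ⟨l ++ m, by simp [hl, hm], by simp⟩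

theorem su_GW (G : I → Uq D) (hG : ∀ i, su (G i) = G i) {μ : I → ℤ} {u : Uq D} (hu : u ∈ GW G μ) :
    su u ∈ GW G μ := by
  have hl : ∀ l : List I, su ((l.map G).prod) = (l.reverse.map G).prod := by
    intro l
    induction l with
    | nil => exact su_one
    | cons i l ih =>
      rw [List.map_cons, List.prod_cons, su_mul, ih, hG]; simp
  unfold GW at hu ⊢
  induction hu using Submodule.span_induction with
  | mem x hx =>
    obtain ⟨l, h, rfl⟩ := hx
    exact Submodule.subset_span ⟨l.reverse, by rw [List.map_reverse, List.sum_reverse, h], hl l⟩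
  | zero => rw [map_zero]; exact Submodule.zero_mem _
  | add x y _ _ hx hy => rw [map_add]; exact Submodule.add_mem _ hx hy
  | smul c x _ hx => rw [map_smul]; exact Submodule.smul_mem _ c hx

theorem GW_K {μ : I → ℤ} {u : Uq D} (hu : u ∈ GW (FF D) μ) (k : I) :
    KK D k * u = qq ^ (-pairing D μ k) • (u * KK D k) := by
  have h0 := qq_ne
  unfold GW at hu
  induction hu using Submodule.span_induction with
  | mem x hx =>
    obtain ⟨l, rfl, rfl⟩ := hx
    induction l with
    | nil => simp [pairing]
    | cons i l ih =>
      rw [List.map_cons, List.prod_cons, ← mul_assoc, K_F, smul_mul_assoc, mul_assoc, ih, List.map_cons,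
        List.sum_cons, pairing_add, pairing_simple, mul_smul_comm, smul_smul, ← zpow_add₀ h0, mul_assoc,
        cartan_symm]
      congr 2; ring
  | zero => rw [mul_zero, zero_mul, smul_zero]
  | add x y _ _ hx hy => rw [mul_add, hx, hy, add_mul, smul_add]
  | smul c x _ hx => rw [mul_smul_comm, hx, smul_mul_assoc, smul_comm]

theorem act_B {x y : List I} {i j : I} (h : D.adj i j = true) (e : wordAct D x = wordAct D (y ++ [i])) :
    wordAct D (x ++ [j]) (simpleRoot i) = wordAct D y (simpleRoot j) := by
  rw [act_append, act_single, e, act_append, act_single, sref_adj D (adj_symm h), add_comm,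
    ← sref_adj D h, sref_sref]

theorem act_C {x : List I} {i j : I} (h : D.adj i j = true) :
    wordAct D (x ++ [j]) (simpleRoot i) = wordAct D x (simpleRoot i) + wordAct D x (simpleRoot j) := by
  rw [act_append, act_single, sref_adj D (adj_symm h), act_add, add_comm]

theorem act_A {x : List I} {i j : I} (hne : j ≠ i) (h : D.adj j i = false) :
    wordAct D (x ++ [j]) (simpleRoot i) = wordAct D x (simpleRoot i) := by
  rw [act_append, act_single, sref_far D hne h]

theorem TW_GW (hT : IsLusztigAuts D T) (x : List I) (i : I) (hx : IsReducedWord D (x ++ [i])) :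
    TW T x (FF D i) ∈ GW (FF D) (wordAct D x (simpleRoot i)) ∧
    TW T x (EE D i) ∈ GW (EE D) (wordAct D x (simpleRoot i)) := by
  refine N_ind (D := D) (fun x i => TW T x (FF D i) ∈ GW (FF D) (wordAct D x (simpleRoot i)) ∧
    TW T x (EE D i) ∈ GW (EE D) (wordAct D x (simpleRoot i))) ?_ ?_ ?_ ?_ x.length x i rfl hx
  · intro i; exact ⟨GW_gen _ i, GW_gen _ i⟩
  · intro x i j hne hf _ ih
    rw [TW_snoc, TW_snoc, TF_far hT hne hf, TE_far hT hne hf, act_A hne hf]; exact ih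
  · intro x y i j h hx hy e _ ih
    rw [TW_snoc, TW_snoc, TW_eq hT hx hy e, TW_snoc, TW_snoc, TT_F hT h, TT_E hT h, act_B h e]; exact ih
  · intro x i j h _ _ hi hj
    rw [TW_snoc, TW_snoc, TF_adj hT (adj_symm h), TE_adj hT (adj_symm h), act_C h]
    simp only [map_sub, map_mul, map_smul]
    constructor
    · refine Submodule.sub_mem _ (GW_mul _ hi.1 hj.1) (Submodule.smul_mem _ _ ?_)
      rw [add_comm]; exact GW_mul _ hj.1 hi.1
    · refine Submodule.sub_mem _ ?_ (Submodule.smul_mem _ _ (GW_mul _ hi.2 hj.2))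
      rw [add_comm]; exact GW_mul _ hj.2 hi.2

theorem simple_inj {i j : I} (h : (simpleRoot i : I → ℤ) = simpleRoot j) : i = j := by
  by_contra hne
  have := congrFun h i
  simp [simpleRoot, hne] at this

theorem not_sum_simple {v w : I → ℤ} (hv : 0 ≤ v) (hw : 0 ≤ w) (hv0 : v ≠ 0) (hw0 : w ≠ 0) (k : I)
    (h : v + w = simpleRoot k) : False := by
  have h0 : ∀ u : I → ℤ, 0 ≤ u → u ≠ 0 → (∀ j, j ≠ k → u j = 0) → 1 ≤ u k := by
    intro u hu hne hj
    by_contra hc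
    apply hne
    ext j
    by_cases hjk : j = k
    · subst hjk; have := hu j; simp at this ⊢; omega
    · simpa using hj j hjk
  have hz : ∀ j, j ≠ k → v j = 0 ∧ w j = 0 := by
    intro j hj
    have h1 := congrFun h j
    have h2 := hv j
    have h3 := hw j
    simp [simpleRoot, hj] at h1 h2 h3
    omega
  have h1 := h0 v hv hv0 (fun j hj => (hz j hj).1)
  have h2 := h0 w hw hw0 (fun j hj => (hz j hj).2)
  have h3 := congrFun h k
  simp [simpleRoot] at h3
  omega

theorem simple_lemma (hT : IsLusztigAuts D T) (x : List I) (i : I) (hx : IsReducedWord D (x ++ [i])) :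
    ∀ k, wordAct D x (simpleRoot i) = simpleRoot k → TW T x (FF D i) = FF D k := by
  refine N_ind (D := D) (fun x i => ∀ k, wordAct D x (simpleRoot i) = simpleRoot k →
    TW T x (FF D i) = FF D k) ?_ ?_ ?_ ?_ x.length x i rfl hx
  · intro i k h; rw [TW_nil, simple_inj h]
  · intro x i j hne hf _ ih
    rw [TW_snoc, TF_far hT hne hf, act_A hne hf]; exact ih
  · intro x y i j h hx hy e _ ih
    rw [TW_snoc, TW_eq hT hx hy e, TW_snoc, TT_F hT h, act_B h e]; exact ih
  · intro x i j h h1 h2 hi hj k hk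
    rw [act_C h] at hk
    exact (not_sum_simple (red_pos h1) (red_pos h2) (norm_ne_zero D (act_norm D x i))
      (norm_ne_zero D (act_norm D x j)) k hk).elim

/-! ### bar -/
variable {bar : Uq D →+* Uq D}

theorem bar_rat (hbar : IsBar D bar) (r : ℚ) :
    bar (algebraMap 𝕂 (Uq D) (algebraMap ℚ 𝕂 r)) = algebraMap 𝕂 (Uq D) (algebraMap ℚ 𝕂 r) := by
  have : bar.comp ((algebraMap 𝕂 (Uq D)).comp (algebraMap ℚ 𝕂)) = (algebraMap 𝕂 (Uq D)).comp (algebraMap ℚ 𝕂) :=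
    RingHom.ext_rat _ _
  exact congrArg (fun f => f r) this

theorem algMapU (c : 𝕂) : algebraMap 𝕂 (Uq D) c = c • 1 := Algebra.algebraMap_eq_smul_one c

theorem bar_qi (hbar : IsBar D bar) : bar (algebraMap 𝕂 (Uq D) qq⁻¹) = algebraMap 𝕂 (Uq D) qq := by
  rw [← hbar.2.2.2.1, hbar.2.2.2.2]

theorem bar_poly (hbar : IsBar D bar) (f : Polynomial ℚ) :
    ∃ c' ∈ LA, bar (algebraMap 𝕂 (Uq D) (Polynomial.aeval qq f)) = algebraMap 𝕂 (Uq D) c' := by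
  induction f using Polynomial.induction_on' with
  | add p q hp hq =>
    obtain ⟨a, ha, e⟩ := hp
    obtain ⟨b, hb, e'⟩ := hq
    exact ⟨a + b, LA.add_mem ha hb, by simp only [map_add, e, e']⟩
  | monomial n r =>
    refine ⟨algebraMap ℚ 𝕂 r * qq⁻¹ ^ n, LA.mul_mem ⟨Polynomial.C r, 0, by simp⟩ (LA.pow_mem LA_qi n), ?_⟩
    rw [Polynomial.aeval_monomial]
    simp only [map_mul, map_pow]
    rw [bar_rat hbar, hbar.2.2.2.1]

theorem bar_LA (hbar : IsBar D bar) {c : 𝕂} (hc : c ∈ LA) :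
    ∃ c' ∈ LA, bar (algebraMap 𝕂 (Uq D) c) = algebraMap 𝕂 (Uq D) c' := by
  obtain ⟨f, m, rfl⟩ := hc
  obtain ⟨c', h', e⟩ := bar_poly hbar f
  refine ⟨qq ^ m * c', LA.mul_mem (LA.pow_mem LA_q m) h', ?_⟩
  simp only [map_mul, map_pow]
  rw [e, bar_qi hbar]

theorem bar_smulA (hbar : IsBar D bar) {c : 𝕂} (hc : c ∈ LA) :
    ∃ c' ∈ LA, ∀ u, bar (c • u) = c' • bar u := by
  obtain ⟨c', h', e⟩ := bar_LA hbar hc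
  exact ⟨c', h', fun u => by rw [Algebra.smul_def, map_mul, e, ← Algebra.smul_def]⟩

theorem bar_q (hbar : IsBar D bar) (u : Uq D) : bar (qq • u) = qq⁻¹ • bar u := by
  rw [Algebra.smul_def, map_mul, hbar.2.2.2.1, ← Algebra.smul_def]

theorem bar_qpow (hbar : IsBar D bar) (n : ℕ) :
    bar (algebraMap 𝕂 (Uq D) (qq ^ n)) = algebraMap 𝕂 (Uq D) (qq⁻¹ ^ n) := by
  simp only [map_pow]; rw [hbar.2.2.2.1]

theorem bar_qz (hbar : IsBar D bar) (n : ℕ) :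
    bar (algebraMap 𝕂 (Uq D) (qz n)) = algebraMap 𝕂 (Uq D) (qz n) := by
  induction n with
  | zero => simp [qz_zero]
  | succ n ih =>
    have e1 : qz (n + 1) = qq * qz n + qq⁻¹ ^ n := by
      rw [qz_add, qz_one, zpow_one, mul_one, zpow_neg, zpow_natCast, inv_pow]
    have e2 : qz (n + 1) = qq⁻¹ * qz n + qq ^ n := by
      rw [add_comm, qz_add, qz_one, zpow_natCast, zpow_neg, zpow_one]; ring
    push_cast
    conv_lhs => rw [e1]
    rw [e2]
    simp only [map_add, map_mul, map_pow]
    rw [bar_qi hbar, hbar.2.2.2.1, ih]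

theorem bar_qFact (hbar : IsBar D bar) (n : ℕ) :
    bar (algebraMap 𝕂 (Uq D) (qFact n)) = algebraMap 𝕂 (Uq D) (qFact n) := by
  induction n with
  | zero => simp [qFact]
  | succ n ih =>
    rw [qFact_succ, map_mul, map_mul, ih]
    have := bar_qz hbar (n + 1)
    push_cast at this
    rw [this]

theorem bar_dp (hbar : IsBar D bar) (x : Uq D) (n : ℕ) : bar (dp x n) = dp (bar x) n := by
  have h := qFact_ne n
  have e : qFact n • dp x n = x ^ n := by rw [dp, smul_smul, mul_inv_cancel₀ h, one_smul]
  have e2 := congrArg bar e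
  rw [Algebra.smul_def, map_mul, bar_qFact hbar, map_pow, ← Algebra.smul_def] at e2
  rw [dp.eq_def (bar x), ← e2, smul_smul, inv_mul_cancel₀ h, one_smul]

theorem UA_ind {P : Uq D → Prop} (h1 : ∀ i n, P (dp (FF D i) n)) (h2 : ∀ c ∈ LA, P (algebraMap 𝕂 (Uq D) c))
    (h3 : ∀ x y, x ∈ UA D → y ∈ UA D → P x → P y → P (x + y))
    (h4 : ∀ x y, x ∈ UA D → y ∈ UA D → P x → P y → P (x * y)) {u : Uq D} (hu : u ∈ UA D) : P u := by
  unfold UA at hu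
  induction hu using Algebra.adjoin_induction with
  | mem x hx => obtain ⟨i, n, rfl⟩ := hx; exact h1 i n
  | algebraMap r => exact h2 r.1 r.2
  | add x y a b hx hy => exact h3 x y a b hx hy
  | mul x y a b hx hy => exact h4 x y a b hx hy

theorem UA_dpF (i : I) (n : ℕ) : dp (FF D i) n ∈ UA D := Algebra.subset_adjoin ⟨i, n, rfl⟩
theorem UA_alg {c : 𝕂} (hc : c ∈ LA) : algebraMap 𝕂 (Uq D) c ∈ UA D :=
  (UA D).algebraMap_mem (⟨c, hc⟩ : ↥LA)

theorem bar_UA (hbar : IsBar D bar) {u : Uq D} (hu : u ∈ UA D) : bar u ∈ UA D := by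
  refine UA_ind (P := fun u => bar u ∈ UA D) ?_ ?_ ?_ ?_ hu
  · intro i n; rw [bar_dp hbar, hbar.2.1]; exact UA_dpF i n
  · intro c hc; obtain ⟨c', h', e⟩ := bar_LA hbar hc; rw [e]; exact UA_alg (D := D) h'
  · intro x y _ _ hx hy; rw [map_add]; exact (UA D).add_mem hx hy
  · intro x y _ _ hx hy; rw [map_mul]; exact (UA D).mul_mem hx hy

theorem su_pow (u : Uq D) (n : ℕ) : su (u ^ n) = su u ^ n := by
  induction n with
  | zero => rw [pow_zero, pow_zero]; exact su_one (D := D)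
  | succ n ih => rw [pow_succ, su_mul, ih, pow_succ']

theorem su_dp (u : Uq D) (n : ℕ) : su (dp u n) = dp (su u) n := by
  rw [dp, map_smul, su_pow, dp]

theorem su_alg (c : 𝕂) : su (algebraMap 𝕂 (Uq D) c) = algebraMap 𝕂 (Uq D) c := by
  rw [algMapU, map_smul, su_one]

theorem bar_su (hbar : IsBar D bar) {u : Uq D} (hu : u ∈ UA D) : bar (su u) = su (bar u) := by
  refine UA_ind (P := fun u => bar (su u) = su (bar u)) ?_ ?_ ?_ ?_ hu
  · intro i n; rw [su_dp, su_F, bar_dp hbar, hbar.2.1, su_dp, su_F]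
  · intro c hc; obtain ⟨c', h', e⟩ := bar_LA hbar hc; rw [su_alg, e, su_alg]
  · intro x y _ _ hx hy; simp only [map_add]; rw [hx, hy]
  · intro x y _ _ hx hy; rw [su_mul, map_mul, map_mul, su_mul, hx, hy]

theorem UA_Uminus {u : Uq D} (hu : u ∈ UA D) : u ∈ Uminus D := by
  refine UA_ind (P := fun u => u ∈ Uminus D) ?_ ?_ ?_ ?_ hu
  · intro i n
    have : FF D i ∈ Uminus D := Algebra.subset_adjoin ⟨i, rfl⟩
    rw [dp]
    exact Subalgebra.smul_mem _ (Subalgebra.pow_mem _ this n) _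
  · intro c hc; exact Subalgebra.algebraMap_mem _ c
  · intro x y _ _ hx hy; exact Subalgebra.add_mem _ hx hy
  · intro x y _ _ hx hy; exact Subalgebra.mul_mem _ hx hy

/-! ### pbw -/
theorem pbw_nil (a : Fin ([] : List I).length → ℕ) : pbw T [] a = 1 := by
  simp [pbw]

theorem pbw_cons (i : I) (w : List I) (a : Fin (w.length + 1) → ℕ) :
    pbw T (i :: w) a = dp (FF D i) (a 0) * T i (pbw T w (Fin.tail a)) := by
  unfold pbw
  rw [map_list_prod, List.map_map]
  change ((List.finRange (w.length + 1)).map _).prod = _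
  rw [List.finRange_succ, List.map_cons, List.prod_cons, List.map_map]
  congr 1
  congr 1
  apply List.map_congr_left
  intro k _
  change dp (T i (applyT T (w.take k) (FF D (w.get k)))) (a k.succ) = T i (dp _ _)
  rw [map_dp]; rfl

theorem SS_eq_span (w : List I) : SS T w = Submodule.span ↥LA (Set.range (pbw T w)) := by
  induction w with
  | nil =>
    rw [SS, Submodule.one_eq_span]
    congr 1
    ext u
    constructor
    · rintro rfl; exact ⟨fun _ => 0, pbw_nil _⟩
    · rintro ⟨a, rfl⟩; exact pbw_nil a
  | cons i w ih =>
    rw [SS, ih, Pw, mp, Submodule.map_span, Submodule.span_mul_span]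
    congr 1
    ext u
    constructor
    · rintro ⟨_, ⟨n, rfl⟩, _, ⟨_, ⟨a, rfl⟩, rfl⟩, rfl⟩
      exact ⟨Fin.cons (α := fun _ => ℕ) n a, by rw [pbw_cons]; rfl⟩
    · rintro ⟨a, rfl⟩
      exact ⟨_, ⟨a 0, rfl⟩, _, ⟨_, ⟨Fin.tail a, rfl⟩, rfl⟩, (pbw_cons i w a).symm⟩

theorem pbw_mem_SS (w : List I) (a : Fin w.length → ℕ) : pbw T w a ∈ SS T w := by
  rw [SS_eq_span]; exact Submodule.subset_span ⟨a, rfl⟩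

theorem TW_SS_UA (hT : IsLusztigAuts D T) (x v : List I) (h : IsReducedWord D (x ++ v)) :
    mp (TW T x) (SS T v) ≤ Subalgebra.toSubmodule (UA D) := by
  induction v generalizing x with
  | nil =>
    rw [SS, mp_one, Submodule.one_le]; exact (UA D).one_mem
  | cons i v ih =>
    have h2 : IsReducedWord D (x ++ [i] ++ v) := by simpa using h
    rw [SS, mp_mul, mp_Pw, mp_mp]
    have h3 : mp ((T i).trans (TW T x)) (SS T v) ≤ Subalgebra.toSubmodule (UA D) := by
      have := ih (x ++ [i]) h2
      have e : TW T (x ++ [i]) = (T i).trans (TW T x) := by ext u; rw [TW_snoc]; rfl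
      rwa [e] at this
    have h4 : Pw (TW T x (FF D i)) ≤ Subalgebra.toSubmodule (UA D) := by
      unfold Pw; rw [Submodule.span_le]; rintro _ ⟨n, rfl⟩
      rw [← map_dp]; exact rootdp_mem_UA hT x i (red_left h2) n
    exact (mul_le_mul' h4 h3).trans (le_of_eq (Subalgebra.isIdempotentElem_toSubmodule (UA D)))

theorem SS_UA (hT : IsLusztigAuts D T) {v : List I} (h : IsReducedWord D v) {s : Uq D} (hs : s ∈ SS T v) :
    s ∈ UA D := by
  have := TW_SS_UA hT [] v h (mp_mem _ hs)
  exact this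

theorem SS_UA' (hT : IsLusztigAuts D T) {x v : List I} (h : IsReducedWord D (x ++ v)) {s : Uq D} (hs : s ∈ SS T v) :
    TW T x s ∈ UA D := TW_SS_UA hT x v h (mp_mem _ hs)

end GWsec
end QProof


namespace QProof
noncomputable section LeftA
set_option linter.unusedSectionVars false
set_option linter.unusedSimpArgs false
set_option linter.unusedVariables false
set_option linter.unusedTactic false
attribute [local instance] Semiring.toNatAlgebra Ring.toIntAlgebra

variable {I : Type} [Fintype I] [DecidableEq I] {D : ADEData I}
variable {T : I → (Uq D ≃ₐ[𝕂] Uq D)}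

def JJ (D : ADEData I) (i : I) : Submodule 𝕂 (Uq D) :=
  Submodule.span 𝕂 {v | ∃ (m : ℕ) (j : I) (u : Uq D), j ≠ i ∧ v = EE D i ^ m * (EE D j * u)}

def RIdeal (R : Submodule 𝕂 (Uq D)) : Prop := ∀ u ∈ R, ∀ v, u * v ∈ R

theorem EU_right : RIdeal (EU D) := by
  intro u hu v
  unfold EU at hu ⊢
  induction hu using Submodule.span_induction with
  | mem x hx => obtain ⟨j, u, rfl⟩ := hx; exact Submodule.subset_span ⟨j, u * v, by rw [mul_assoc]⟩
  | zero => rw [zero_mul]; exact Submodule.zero_mem _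
  | add x y _ _ hx hy => rw [add_mul]; exact Submodule.add_mem _ hx hy
  | smul c x _ hx => rw [smul_mul_assoc]; exact Submodule.smul_mem _ c hx

theorem JJ_right (i : I) : RIdeal (JJ D i) := by
  intro u hu v
  unfold JJ at hu ⊢
  induction hu using Submodule.span_induction with
  | mem x hx =>
    obtain ⟨m, j, u, h, rfl⟩ := hx
    exact Submodule.subset_span ⟨m, j, u * v, h, by simp only [mul_assoc]⟩
  | zero => rw [zero_mul]; exact Submodule.zero_mem _
  | add x y _ _ hx hy => rw [add_mul]; exact Submodule.add_mem _ hx hy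
  | smul c x _ hx => rw [smul_mul_assoc]; exact Submodule.smul_mem _ c hx

theorem JJ_le_EU (i : I) : JJ D i ≤ EU D := by
  unfold JJ
  rw [Submodule.span_le]
  rintro _ ⟨m, j, u, h, rfl⟩
  cases m with
  | zero => rw [pow_zero, one_mul]; exact Submodule.subset_span ⟨j, u, rfl⟩
  | succ m => rw [pow_succ', mul_assoc]; exact Submodule.subset_span ⟨i, _, rfl⟩

theorem JJ_leftmul {i : I} {X : Uq D} (h : ∀ m j u, j ≠ i → X * (EE D i ^ m * (EE D j * u)) ∈ JJ D i)
    {v : Uq D} (hv : v ∈ JJ D i) : X * v ∈ JJ D i := by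
  conv at hv => unfold JJ
  induction hv using Submodule.span_induction with
  | mem x hx => obtain ⟨m, j, u, h', rfl⟩ := hx; exact h m j u h'
  | zero => rw [mul_zero]; exact Submodule.zero_mem _
  | add x y _ _ hx hy => rw [mul_add]; exact Submodule.add_mem _ hx hy
  | smul c x _ hx => rw [mul_smul_comm]; exact Submodule.smul_mem _ c hx

theorem JJ_base {i j : I} (h : j ≠ i) (m : ℕ) (u : Uq D) : EE D i ^ m * (EE D j * u) ∈ JJ D i :=
  Submodule.subset_span ⟨m, j, u, h, rfl⟩

theorem JJ_E (i : I) {v : Uq D} (hv : v ∈ JJ D i) : EE D i * v ∈ JJ D i := by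
  refine JJ_leftmul ?_ hv
  intro m j u h
  rw [← mul_assoc, ← pow_succ']; exact JJ_base h _ _

theorem JJ_K (i k : I) {v : Uq D} (hv : v ∈ JJ D i) : KK D k * v ∈ JJ D i := by
  refine JJ_leftmul ?_ hv
  intro m j u h
  induction m with
  | zero =>
    rw [pow_zero, one_mul, ← mul_assoc, K_E, smul_mul_assoc, mul_assoc]
    have := JJ_base (D := D) h 0 (KK D k * u)
    rw [pow_zero, one_mul] at this
    exact Submodule.smul_mem _ _ this
  | succ m ih =>
    rw [pow_succ', mul_assoc, ← mul_assoc, K_E, smul_mul_assoc, mul_assoc]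
    exact Submodule.smul_mem _ _ (JJ_E i ih)

theorem JJ_Ki (i k : I) {v : Uq D} (hv : v ∈ JJ D i) : KKinv D k * v ∈ JJ D i := by
  refine JJ_leftmul ?_ hv
  intro m j u h
  induction m with
  | zero =>
    rw [pow_zero, one_mul, ← mul_assoc, Ki_E, smul_mul_assoc, mul_assoc]
    have := JJ_base (D := D) h 0 (KKinv D k * u)
    rw [pow_zero, one_mul] at this
    exact Submodule.smul_mem _ _ this
  | succ m ih =>
    rw [pow_succ', mul_assoc, ← mul_assoc, Ki_E, smul_mul_assoc, mul_assoc]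
    exact Submodule.smul_mem _ _ (JJ_E i ih)

theorem JJ_F (i : I) {v : Uq D} (hv : v ∈ JJ D i) : FF D i * v ∈ JJ D i := by
  refine JJ_leftmul ?_ hv
  intro m j u h
  induction m with
  | zero =>
    rw [pow_zero, one_mul, ← mul_assoc, ← EF_ne h, mul_assoc]
    have := JJ_base (D := D) h 0 (FF D i * u)
    rwa [pow_zero, one_mul] at this
  | succ m ih =>
    have e : FF D i * EE D i = EE D i * FF D i - (qq - qq⁻¹)⁻¹ • (KK D i - KKinv D i) := by
      rw [EF_self]; module
    rw [pow_succ', mul_assoc, ← mul_assoc, e, sub_mul, smul_mul_assoc, sub_mul, mul_assoc]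
    exact Submodule.sub_mem _ (JJ_E i ih) (Submodule.smul_mem _ _ (Submodule.sub_mem _
      (JJ_K i i (JJ_base h m u)) (JJ_Ki i i (JJ_base h m u))))

theorem JJ_Fdp (i : I) (n : ℕ) {v : Uq D} (hv : v ∈ JJ D i) : dp (FF D i) n * v ∈ JJ D i := by
  rw [dp, smul_mul_assoc]
  refine Submodule.smul_mem _ _ ?_
  induction n with
  | zero => rwa [pow_zero, one_mul]
  | succ n ih => rw [pow_succ', mul_assoc]; exact JJ_F i ih

theorem GW_JJ {γ : I → ℤ} {i k : I} (hk : k ≠ i) (h : γ k ≠ 0) {u : Uq D} (hu : u ∈ GW (EE D) γ) :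
    u ∈ JJ D i := by
  have key : ∀ l : List I, ((l.map simpleRoot).sum : I → ℤ) k ≠ 0 → (l.map (EE D)).prod ∈ JJ D i := by
    intro l
    induction l with
    | nil => intro h; simp at h
    | cons a l ih =>
      intro h
      rw [List.map_cons, List.prod_cons]
      by_cases ha : a = i
      · subst ha
        apply JJ_E
        apply ih
        intro h0; apply h
        rw [List.map_cons, List.sum_cons, Pi.add_apply, h0]; simp [simpleRoot, hk]
      · have := JJ_base (D := D) ha 0 (l.map (EE D)).prod
        rwa [pow_zero, one_mul] at this
  have : GW (EE D) γ ≤ JJ D i := by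
    unfold GW
    rw [Submodule.span_le]
    rintro _ ⟨l, rfl, rfl⟩
    exact key l h
  exact this hu

theorem GW_EU {γ : I → ℤ} (h : γ ≠ 0) {u : Uq D} (hu : u ∈ GW (EE D) γ) : u ∈ EU D := by
  have : GW (EE D) γ ≤ EU D := by
    unfold GW
    rw [Submodule.span_le]
    rintro _ ⟨l, rfl, rfl⟩
    cases l with
    | nil => simp at h
    | cons a l => rw [List.map_cons, List.prod_cons]; exact Submodule.subset_span ⟨a, _, rfl⟩
  exact this hu

/-! ### positions of root vectors -/

theorem key1 (hT : IsLusztigAuts D T) (p z : List I) (j : I) :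
    (TW T (p ++ j :: z)).symm (TW T p (FF D j)) = (-1 : 𝕂) • ((TW T z).symm (EE D j) * (TW T z).symm (KK D j)) := by
  rw [AlgEquiv.symm_apply_eq, TW_append]
  congr 1
  rw [TW_cons, map_smul, map_mul, AlgEquiv.apply_symm_apply, AlgEquiv.apply_symm_apply,
    ← AlgEquiv.symm_apply_eq, Tsymm_F_self hT]

theorem key2 (hT : IsLusztigAuts D T) (z : List I) (j : I) (h : IsReducedWord D (j :: z)) :
    (TW T z).symm (EE D j) ∈ GW (EE D) (wordAct D z.reverse (simpleRoot j)) := by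
  rw [TW_symm hT, su_E]
  apply su_GW _ su_E
  apply (TW_GW hT _ _ _).2
  have := red_rev h
  rwa [List.reverse_cons] at this

theorem pos_EU (hT : IsLusztigAuts D T) (p z : List I) (j : I) (h : IsReducedWord D (p ++ j :: z)) :
    (TW T (p ++ j :: z)).symm (TW T p (FF D j)) ∈ EU D := by
  rw [key1 hT]
  exact Submodule.smul_mem _ _ (EU_right _ (GW_EU (norm_ne_zero D (act_norm D _ _)) (key2 hT z j (red_right h))) _)

theorem pos_JJ (hT : IsLusztigAuts D T) (p z : List I) (i j : I) (h : IsReducedWord D (p ++ j :: z ++ [i])) :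
    (TW T (p ++ j :: z)).symm (TW T p (FF D j)) ∈ JJ D i := by
  have h2 : IsReducedWord D (j :: z ++ [i]) := by
    rw [List.append_assoc] at h; exact red_right h
  have h3 := red_left h2
  have hpos : 0 ≤ wordAct D z.reverse (simpleRoot j) := by
    apply red_pos
    have := red_rev h3
    rwa [List.reverse_cons] at this
  rw [key1 hT]
  refine Submodule.smul_mem _ _ (JJ_right i _ ?_ _)
  have : ∃ k, k ≠ i ∧ wordAct D z.reverse (simpleRoot j) k ≠ 0 := by
    by_contra hc
    push Not at hc
    have e := pos_eq_simple D (act_norm D _ _) hpos i hc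
    have e2 := act_rev (D := D) z (simpleRoot j)
    rw [e] at e2
    have h4 := red_pos h2
    rw [act_cons, e2, sref_self] at h4
    have h5 := h4 j
    simp [simpleRoot] at h5
  obtain ⟨k, hk, hk2⟩ := this
  exact GW_JJ hk hk2 (key2 hT z j h3)

/-! ### decomposition -/
def RI (f : Uq D ≃ₐ[𝕂] Uq D) (N : Submodule 𝕂 (Uq D)) : Submodule 𝕂 (Uq D) :=
  N.comap f.symm.toLinearMap
theorem mem_RI {f : Uq D ≃ₐ[𝕂] Uq D} {N : Submodule 𝕂 (Uq D)} {u : Uq D} : u ∈ RI f N ↔ f.symm u ∈ N := Iff.rfl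
theorem RI_right {f : Uq D ≃ₐ[𝕂] Uq D} {N : Submodule 𝕂 (Uq D)} (h : RIdeal N) : RIdeal (RI f N) := by
  intro u hu v
  rw [mem_RI] at hu ⊢
  rw [map_mul]; exact h _ hu _
theorem inf_right {M N : Submodule 𝕂 (Uq D)} (h : RIdeal M) (h' : RIdeal N) : RIdeal (M ⊓ N) :=
  fun u hu v => ⟨h u hu.1 v, h' u hu.2 v⟩

def Gens (T : I → (Uq D ≃ₐ[𝕂] Uq D)) (x : List I) (R : Submodule 𝕂 (Uq D)) : Prop :=
  ∀ p j q, x = p ++ j :: q → TW T p (FF D j) ∈ R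

theorem Dec (x v : List I) : ∀ R : Submodule 𝕂 (Uq D), RIdeal R → Gens T x R →
    ∀ u ∈ SS T (x ++ v), ∃ s ∈ SS T v, u - TW T x s ∈ R := by
  induction x with
  | nil => intro R _ _ u hu; exact ⟨u, hu, by rw [TW_nil, sub_self]; exact R.zero_mem⟩
  | cons j x ih =>
    intro R hR hG u hu
    rw [SS_eq_span] at hu
    induction hu using Submodule.span_induction with
    | mem y hy =>
      obtain ⟨a, rfl⟩ := hy
      revert a
      intro (a : Fin ((x ++ v).length + 1) → ℕ)
      change ∃ s ∈ _, pbw T (j :: (x ++ v)) a - _ ∈ R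
      rw [pbw_cons]
      rcases Nat.eq_zero_or_eq_succ_pred (a 0) with h0 | h0
      · have hR' : RIdeal (R.comap (T j).toLinearMap) := by
          intro u hu v
          change T j (u * v) ∈ R
          rw [map_mul]; exact hR _ hu _
        have hG' : Gens T x (R.comap (T j).toLinearMap) := by
          rintro p k q rfl
          exact hG (j :: p) k q rfl
        obtain ⟨s, hs, h⟩ := ih _ hR' hG' _ (pbw_mem_SS (x ++ v) (Fin.tail a))
        refine ⟨s, hs, ?_⟩
        change T j (_ - _) ∈ R at h
        rw [map_sub] at h
        rw [h0, dp_zero, one_mul]; exact h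
      · refine ⟨0, Submodule.zero_mem _, ?_⟩
        rw [map_zero, sub_zero]
        rw [h0]
        apply hR
        rw [dp, pow_succ']
        exact R.smul_mem _ (hR _ (hG [] j x rfl) _)
    | zero => exact ⟨0, Submodule.zero_mem _, by rw [map_zero, sub_zero]; exact R.zero_mem⟩
    | add y z _ _ hy hz =>
      obtain ⟨s, hs, h⟩ := hy
      obtain ⟨t, ht, h'⟩ := hz
      refine ⟨s + t, Submodule.add_mem _ hs ht, ?_⟩
      rw [map_add, add_sub_add_comm]; exact R.add_mem h h'
    | smul c y _ hy =>
      obtain ⟨s, hs, h⟩ := hy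
      refine ⟨c • s, Submodule.smul_mem _ c hs, ?_⟩
      change (c:𝕂) • y - TW T (j :: x) ((c:𝕂) • s) ∈ R
      rw [map_smul]
      convert R.smul_mem (c:𝕂) h using 1
      module

theorem gens_EU (hT : IsLusztigAuts D T) (x y : List I) (h : IsReducedWord D (x ++ y)) :
    Gens T x (RI (TW T (x ++ y)) (EU D)) := by
  rintro p j q rfl
  rw [mem_RI]
  have := pos_EU hT p (q ++ y) j (by simpa using h)
  simpa using this

theorem gens_JJ (hT : IsLusztigAuts D T) (x y : List I) (i : I) (h : IsReducedWord D (x ++ y ++ [i])) :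
    Gens T x (RI (TW T (x ++ y)) (JJ D i)) := by
  rintro p j q rfl
  rw [mem_RI]
  have := pos_JJ hT p (q ++ y) i j (by simpa using h)
  simpa using this

theorem gens_inf {x : List I} {M N : Submodule 𝕂 (Uq D)} (h : Gens T x M) (h' : Gens T x N) : Gens T x (M ⊓ N) :=
  fun p j q e => ⟨h p j q e, h' p j q e⟩

theorem Mgen (hT : IsLusztigAuts D T) {w : List I} (hw : IsRedW0 D w) (x : List I) (hx : IsReducedWord D x)
    {R : Submodule 𝕂 (Uq D)} (hR : RIdeal R) (hG : Gens T x R) {u : Uq D} (hu : u ∈ UA D)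
    (h : (TW T x).symm u ∈ EU D) : u ∈ R := by
  obtain ⟨v, hv⟩ := w0_extend hw _ x hx rfl
  have hG1 : Gens T x (RI (TW T x) (EU D)) := by
    have := gens_EU hT x [] (by simpa using hx)
    simpa using this
  obtain ⟨s, hs, h1, h2⟩ := Dec x v _ (inf_right (RI_right (f := TW T x) EU_right) hR) (gens_inf hG1 hG) u
    (UA_le_SS hT hv hu)
  have h3 : (TW T x).symm (u - TW T x s) ∈ EU D := h1
  rw [map_sub, AlgEquiv.symm_apply_apply] at h3
  have h4 : s ∈ EU D := by
    have := Submodule.sub_mem _ h h3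
    rwa [sub_sub_cancel] at this
  have h5 : s = 0 := V1 (UA_Uminus (SS_UA hT (red_right hv.1) hs)) h4
  have h6 : u - TW T x s ∈ R := h2
  rwa [h5, map_zero, sub_zero] at h6

theorem M_EU (hT : IsLusztigAuts D T) {w : List I} (hw : IsRedW0 D w) (x y : List I)
    (hx : IsReducedWord D (x ++ y)) {u : Uq D} (hu : u ∈ UA D)
    (h : (TW T x).symm u ∈ EU D) : (TW T (x ++ y)).symm u ∈ EU D :=
  Mgen hT hw x (red_left hx) (RI_right EU_right) (gens_EU hT x y hx) hu h

theorem M_JJ (hT : IsLusztigAuts D T) {w : List I} (hw : IsRedW0 D w) (x : List I) (i : I)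
    (hx : IsReducedWord D (x ++ [i])) {u : Uq D} (hu : u ∈ UA D)
    (h : (TW T x).symm u ∈ EU D) : (TW T x).symm u ∈ JJ D i := by
  have := Mgen hT hw x (red_left hx) (RI_right (JJ_right i)) (gens_JJ hT x [] i (by simpa using hx)) hu h
  simpa [mem_RI] using this

end LeftA
end QProof


namespace QProof
noncomputable section LeftB
set_option linter.unusedSectionVars false
set_option linter.unusedSimpArgs false
set_option linter.unusedVariables false
set_option linter.unusedTactic false
attribute [local instance] Semiring.toNatAlgebra Ring.toIntAlgebra

variable {I : Type} [Fintype I] [DecidableEq I] {D : ADEData I}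
variable {T : I → (Uq D ≃ₐ[𝕂] Uq D)} {bar : Uq D →+* Uq D}

theorem rv_UA (hT : IsLusztigAuts D T) (x : List I) (i : I) (hx : IsReducedWord D (x ++ [i])) :
    TW T x (FF D i) ∈ UA D := by
  have := rootdp_mem_UA hT x i hx 1
  rwa [dp_one] at this

theorem bdiff_UA (hT : IsLusztigAuts D T) (hbar : IsBar D bar) (x : List I) (i : I) (hx : IsReducedWord D (x ++ [i])) :
    bar (TW T x (FF D i)) - TW T x (FF D i) ∈ UA D :=
  (UA D).sub_mem (bar_UA hbar (rv_UA hT x i hx)) (rv_UA hT x i hx)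

theorem expandC (fi fj Gi Gj bi bj : Uq D) (hi : bi = fi + Gi) (hj : bj = fj + Gj) :
    (bi * bj - qq⁻¹ • (bj * bi)) - (fi * fj - qq • (fj * fi)) =
      fi * Gj + Gi * bj + (-qq⁻¹) • (fj * Gi) + (-qq⁻¹) • (Gj * bi) + (qq - qq⁻¹) • (fj * fi) := by
  subst hi hj
  simp only [mul_add, add_mul]
  module

theorem bdiff (hT : IsLusztigAuts D T) (hbar : IsBar D bar) {w : List I} (hw : IsRedW0 D w) (x : List I) (i : I)
    (hx : IsReducedWord D (x ++ [i])) :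
    (TW T x).symm (bar (TW T x (FF D i)) - TW T x (FF D i)) ∈ EU D := by
  refine N_ind (D := D) (fun x i => IsReducedWord D (x ++ [i]) →
    (TW T x).symm (bar (TW T x (FF D i)) - TW T x (FF D i)) ∈ EU D) ?_ ?_ ?_ ?_ x.length x i rfl hx hx
  · intro i _
    rw [TW_nil, hbar.2.1, sub_self, map_zero]; exact Submodule.zero_mem _
  · intro x i j hne hf hxi ih h
    have e : TW T (x ++ [j]) (FF D i) = TW T x (FF D i) := by rw [TW_snoc, TF_far hT hne hf]
    rw [e]
    exact M_EU hT hw x [j] (red_left h) (bdiff_UA hT hbar x i hxi) (ih hxi)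
  · intro x y i j h hx hy e hyj ih h2
    have e1 : TW T (x ++ [j]) (FF D i) = TW T y (FF D j) := by
      rw [TW_snoc, TW_eq hT hx hy e, TW_snoc, TT_F hT h]
    rw [e1]
    have e2 : wordAct D (y ++ [i, j]) = wordAct D (x ++ [j]) := by
      rw [act_snoc_congr [j] e]; simp
    have hl := red_len hy hx e
    have h3 : IsReducedWord D (y ++ [i, j]) := red_congr (red_left h2) e2 (by simp at hl ⊢; omega)
    rw [TW_eq hT (red_left h2) h3 e2.symm]
    exact M_EU hT hw y [i, j] h3 (bdiff_UA hT hbar y j hyj) (ih hyj)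
  · intro x i j h hxi hxj hi hj h2
    replace hi := hi hxi
    replace hj := hj hxj
    have ui := bdiff_UA hT hbar x i hxi
    have uj := bdiff_UA hT hbar x j hxj
    have e : TW T (x ++ [j]) (FF D i) = TW T x (FF D i) * TW T x (FF D j) - qq • (TW T x (FF D j) * TW T x (FF D i)) := by
      rw [TW_snoc, TF_adj hT (adj_symm h), map_sub, map_smul, map_mul, map_mul]
    have e' : bar (TW T (x ++ [j]) (FF D i)) = bar (TW T x (FF D i)) * bar (TW T x (FF D j))
        - qq⁻¹ • (bar (TW T x (FF D j)) * bar (TW T x (FF D i))) := by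
      rw [e, map_sub, bar_q hbar, map_mul, map_mul]
    rw [e', e]
    rw [expandC _ _ (bar (TW T x (FF D i)) - TW T x (FF D i)) (bar (TW T x (FF D j)) - TW T x (FF D j)) _ _
      (add_sub_cancel _ _).symm (add_sub_cancel _ _).symm]
    rw [← mem_RI]
    have hR : RIdeal (RI (TW T (x ++ [j])) (EU D)) := RI_right EU_right
    have m1 : TW T x (FF D j) ∈ RI (TW T (x ++ [j])) (EU D) := pos_EU hT x [] j hxj
    have m2 : bar (TW T x (FF D i)) - TW T x (FF D i) ∈ RI (TW T (x ++ [j])) (EU D) := M_EU hT hw x [j] hxj ui hi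
    have m3 : bar (TW T x (FF D j)) - TW T x (FF D j) ∈ RI (TW T (x ++ [j])) (EU D) := M_EU hT hw x [j] hxj uj hj
    have m4 : TW T x (FF D i) * (bar (TW T x (FF D j)) - TW T x (FF D j)) ∈ RI (TW T (x ++ [j])) (EU D) := by
      refine M_EU hT hw x [j] hxj ((UA D).mul_mem (rv_UA hT x i hxi) uj) ?_
      rw [map_mul, AlgEquiv.symm_apply_apply]
      exact JJ_le_EU i (JJ_F i (M_JJ hT hw x i hxi uj hj))
    exact Submodule.add_mem _ (Submodule.add_mem _ (Submodule.add_mem _ (Submodule.add_mem _ m4 (hR _ m2 _))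
      (Submodule.smul_mem _ _ (hR _ m1 _))) (Submodule.smul_mem _ _ (hR _ m3 _))) (Submodule.smul_mem _ _ (hR _ m1 _))

theorem bpow (hT : IsLusztigAuts D T) (hbar : IsBar D bar) {w : List I} (hw : IsRedW0 D w) (x : List I) (i : I)
    (hx : IsReducedWord D (x ++ [i])) (n : ℕ) :
    (TW T x).symm (dp (bar (TW T x (FF D i))) n - dp (TW T x (FF D i)) n) ∈ JJ D i := by
  have h1 := M_JJ hT hw x i hx (bdiff_UA hT hbar x i hx) (bdiff hT hbar hw x i hx)
  have h2 : (TW T x).symm (bar (TW T x (FF D i)) ^ n - TW T x (FF D i) ^ n) ∈ JJ D i := by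
    induction n with
    | zero => rw [pow_zero, pow_zero, sub_self, map_zero]; exact Submodule.zero_mem _
    | succ n ih =>
      have e : bar (TW T x (FF D i)) ^ (n + 1) - TW T x (FF D i) ^ (n + 1) =
        TW T x (FF D i) * (bar (TW T x (FF D i)) ^ n - TW T x (FF D i) ^ n) +
        (bar (TW T x (FF D i)) - TW T x (FF D i)) * bar (TW T x (FF D i)) ^ n := by
        rw [pow_succ', pow_succ', mul_sub, sub_mul]; module
      rw [e, map_add, map_mul, map_mul, AlgEquiv.symm_apply_apply]
      exact Submodule.add_mem _ (JJ_F i ih) (JJ_right i _ h1 _)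
  have e : dp (bar (TW T x (FF D i))) n - dp (TW T x (FF D i)) n =
    (qFact n)⁻¹ • (bar (TW T x (FF D i)) ^ n - TW T x (FF D i) ^ n) := by
    unfold dp; module
  rw [e, map_smul]
  exact Submodule.smul_mem _ _ h2

def LT (T : I → (Uq D ≃ₐ[𝕂] Uq D)) (v : List I) (a : Fin v.length → ℕ) : Sub D :=
  Submodule.span ↥LA {u | ∃ c, LtLeft c a ∧ u = pbw T v c}

def LP (T : I → (Uq D ≃ₐ[𝕂] Uq D)) (i : I) (v : List I) : Sub D :=
  Submodule.span ↥LA {u | ∃ c : Fin (v.length + 1) → ℕ, 0 < c 0 ∧ u = pbw T (i :: v) c}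

theorem LT_le (v : List I) (a : Fin v.length → ℕ) : LT T v a ≤ SS T v := by
  unfold LT; rw [Submodule.span_le]; rintro _ ⟨c, _, rfl⟩; exact pbw_mem_SS v c

theorem LT_step1 (i : I) (v : List I) (a : Fin (v.length + 1) → ℕ) {t : Uq D} (ht : t ∈ LT T v (Fin.tail a)) :
    dp (FF D i) (a 0) * T i t ∈ LT T (i :: v) a := by
  conv at ht => unfold LT
  induction ht using Submodule.span_induction with
  | mem x hx =>
    obtain ⟨c, ⟨k, hk, hk'⟩, rfl⟩ := hx
    refine Submodule.subset_span ⟨(Fin.cons (α := fun _ => ℕ) (a 0) c : Fin (v.length + 1) → ℕ), ?_, ?_⟩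
    · refine ⟨(k.succ : Fin (v.length + 1)), hk, ?_⟩
      intro l hl
      revert l
      intro (l : Fin (v.length + 1))
      refine Fin.cases ?_ ?_ l
      · intro _; rfl
      · intro l hl; exact hk' l (Fin.succ_lt_succ_iff.1 hl)
    · rw [pbw_cons]; rfl
  | zero => rw [map_zero, mul_zero]; exact Submodule.zero_mem _
  | add x y _ _ hx hy => rw [map_add, mul_add]; exact Submodule.add_mem _ hx hy
  | smul c x _ hx =>
    change dp (FF D i) (a 0) * T i ((c:𝕂) • x) ∈ _
    rw [map_smul, mul_smul_comm]; exact Submodule.smul_mem _ c hx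

theorem LT_step2 (i : I) (v : List I) (a : Fin (v.length + 1) → ℕ) {s : Uq D} (hs : s ∈ LP T i v) :
    dp (FF D i) (a 0) * s ∈ LT T (i :: v) a := by
  conv at hs => unfold LP
  induction hs using Submodule.span_induction with
  | mem x hx =>
    obtain ⟨c, hc, rfl⟩ := hx
    rw [pbw_cons, ← mul_assoc, dp_dp, smul_mul_assoc]
    refine smul_memS (LA_qbinom _ _ _ rfl) ?_
    refine Submodule.subset_span ⟨(Fin.cons (α := fun _ => ℕ) (a 0 + c 0) (Fin.tail c) : Fin (v.length + 1) → ℕ), ?_, ?_⟩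
    · refine ⟨(0 : Fin (v.length + 1)), ?_, ?_⟩
      · change a 0 < a 0 + c 0; omega
      · intro l hl; exact absurd hl (Fin.not_lt_zero _)
    · rw [pbw_cons]; rfl
  | zero => rw [mul_zero]; exact Submodule.zero_mem _
  | add x y _ _ hx hy => rw [mul_add]; exact Submodule.add_mem _ hx hy
  | smul c x _ hx =>
    change dp (FF D i) (a 0) * ((c:𝕂) • x) ∈ _
    rw [mul_smul_comm]; exact Submodule.smul_mem _ c hx

theorem LP_EU (hT : IsLusztigAuts D T) (i : I) (v : List I) {s : Uq D} (hs : s ∈ LP T i v) : (T i).symm s ∈ EU D := by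
  conv at hs => unfold LP
  induction hs using Submodule.span_induction with
  | mem x hx =>
    obtain ⟨c, hc, rfl⟩ := hx
    obtain ⟨m, hm⟩ := Nat.exists_eq_succ_of_ne_zero hc.ne'
    rw [pbw_cons, hm, dp, pow_succ', smul_mul_assoc, map_smul, mul_assoc, map_mul, Tsymm_F_self hT, smul_mul_assoc, mul_assoc]
    exact Submodule.smul_mem _ _ (Submodule.smul_mem _ _ (Submodule.subset_span ⟨i, _, rfl⟩))
  | zero => rw [map_zero]; exact Submodule.zero_mem _
  | add x y _ _ hx hy => rw [map_add]; exact Submodule.add_mem _ hx hy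
  | smul c x _ hx =>
    change (T i).symm ((c:𝕂) • x) ∈ _
    rw [map_smul]; exact Submodule.smul_mem _ (c:𝕂) hx

theorem SS_split (i : I) (v : List I) {s : Uq D} (hs : s ∈ SS T (i :: v)) :
    ∃ s0 ∈ SS T v, ∃ s1 ∈ LP T i v, s = T i s0 + s1 := by
  rw [SS_eq_span] at hs
  induction hs using Submodule.span_induction with
  | mem x hx =>
    obtain ⟨c, rfl⟩ := hx
    revert c
    intro (c : Fin (v.length + 1) → ℕ)
    rcases Nat.eq_zero_or_pos (c 0) with h | h
    · refine ⟨_, pbw_mem_SS v (Fin.tail c), 0, Submodule.zero_mem _, ?_⟩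
      rw [pbw_cons, h, dp_zero, one_mul, add_zero]
    · exact ⟨0, Submodule.zero_mem _, _, Submodule.subset_span ⟨c, h, rfl⟩, by rw [map_zero, zero_add]⟩
  | zero => exact ⟨0, Submodule.zero_mem _, 0, Submodule.zero_mem _, by rw [map_zero, zero_add]⟩
  | add x y _ _ hx hy =>
    obtain ⟨s0, h0, s1, h1, rfl⟩ := hx
    obtain ⟨t0, g0, t1, g1, rfl⟩ := hy
    exact ⟨s0 + t0, Submodule.add_mem _ h0 g0, s1 + t1, Submodule.add_mem _ h1 g1, by rw [map_add]; abel⟩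
  | smul c x _ hx =>
    obtain ⟨s0, h0, s1, h1, rfl⟩ := hx
    refine ⟨c • s0, Submodule.smul_mem _ c h0, c • s1, Submodule.smul_mem _ c h1, ?_⟩
    change (c:𝕂) • (T i s0 + s1) = T i ((c:𝕂) • s0) + (c:𝕂) • s1
    rw [map_smul, smul_add]

theorem Sstep (hT : IsLusztigAuts D T) (hbar : IsBar D bar) (v : List I) : ∀ (x : List I), IsRedW0 D (x ++ v) →
    ∀ a, ∃ t ∈ LT T v a, (TW T x).symm (bar (TW T x (pbw T v a)) - TW T x (pbw T v a) - TW T x t) ∈ EU D := by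
  induction v with
  | nil =>
    intro x _ a
    refine ⟨0, Submodule.zero_mem _, ?_⟩
    rw [pbw_nil, map_one, map_one, map_zero, sub_self, sub_zero, map_zero]
    exact Submodule.zero_mem _
  | cons i v ih =>
    intro x hw (a : Fin (v.length + 1) → ℕ)
    have hw2 : IsRedW0 D (x ++ [i] ++ v) := by simpa using hw
    have hxi := red_left hw2.1
    obtain ⟨t', ht', hE⟩ := ih (x ++ [i]) hw2 (Fin.tail a)
    set m' := TW T (x ++ [i]) (pbw T v (Fin.tail a)) with hm'
    set r' := bar m' - m' - TW T (x ++ [i]) t' with hr'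
    have um : m' ∈ UA D := SS_UA' hT hw2.1 (pbw_mem_SS _ _)
    have ur : r' ∈ UA D := (UA D).sub_mem ((UA D).sub_mem (bar_UA hbar um) um) (SS_UA' hT hw2.1 (LT_le _ _ ht'))
    have hG1 : Gens T x (RI (TW T x) (JJ D i)) := by
      have := gens_JJ hT x [] i (by simpa using hxi)
      simpa using this
    obtain ⟨s, hs, h1, h2⟩ := Dec x (i :: v) _ (inf_right (RI_right (f := TW T x) (JJ_right i))
      (RI_right (f := TW T (x ++ [i])) EU_right)) (gens_inf hG1 (gens_EU hT x [i] hxi)) r' (UA_le_SS hT hw ur)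
    have h1' : (TW T x).symm (r' - TW T x s) ∈ JJ D i := h1
    have h2' : (TW T (x ++ [i])).symm (r' - TW T x s) ∈ EU D := h2
    obtain ⟨s0, hs0, s1, hs1, rfl⟩ := SS_split i v hs
    have hs0' : s0 ∈ EU D := by
      have e : (TW T (x ++ [i])).symm (TW T x (T i s0 + s1)) = s0 + (T i).symm s1 := by
        rw [AlgEquiv.symm_apply_eq, TW_snoc, map_add (T i), AlgEquiv.apply_symm_apply]
      rw [map_sub, e] at h2'
      have h3 := Submodule.sub_mem _ (Submodule.sub_mem _ hE h2') (LP_EU hT i v hs1)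
      have e2 : (TW T (x ++ [i])).symm r' - ((TW T (x ++ [i])).symm r' - (s0 + (T i).symm s1)) - (T i).symm s1 = s0 := by
        abel
      rwa [e2] at h3
    have h00 : s0 = 0 := V1 (UA_Uminus (SS_UA hT (red_right hw2.1) hs0)) hs0'
    rw [h00, map_zero, zero_add] at h1'
    refine ⟨dp (FF D i) (a 0) * T i t' + dp (FF D i) (a 0) * s1,
      Submodule.add_mem _ (LT_step1 i v a ht') (LT_step2 i v a hs1), ?_⟩
    have ep : TW T x (pbw T (i :: v) a) = dp (TW T x (FF D i)) (a 0) * m' := by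
      rw [pbw_cons, map_mul, map_dp, hm', TW_snoc]
    have eb : bar (TW T x (pbw T (i :: v) a)) = dp (bar (TW T x (FF D i))) (a 0) * bar m' := by
      rw [ep, map_mul, bar_dp hbar]
    have et : TW T x (dp (FF D i) (a 0) * T i t' + dp (FF D i) (a 0) * s1) =
      dp (TW T x (FF D i)) (a 0) * TW T (x ++ [i]) t' + dp (TW T x (FF D i)) (a 0) * TW T x s1 := by
      rw [map_add, map_mul, map_mul, map_dp, TW_snoc]
    have er : bar m' = m' + TW T (x ++ [i]) t' + r' := by rw [hr']; abel
    have etot : bar (TW T x (pbw T (i :: v) a)) - TW T x (pbw T (i :: v) a)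
        - TW T x (dp (FF D i) (a 0) * T i t' + dp (FF D i) (a 0) * s1) =
        (dp (bar (TW T x (FF D i))) (a 0) - dp (TW T x (FF D i)) (a 0)) * bar m' +
        dp (TW T x (FF D i)) (a 0) * (r' - TW T x s1) := by
      rw [eb, ep, et, sub_mul, er]
      simp only [mul_add, mul_sub]
      abel
    rw [etot, map_add, map_mul, map_mul, map_dp, AlgEquiv.symm_apply_apply]
    exact JJ_le_EU i (Submodule.add_mem _ (JJ_right i _ (bpow hT hbar hw x i hxi _) _) (JJ_Fdp i _ h1'))

theorem left_final (hT : IsLusztigAuts D T) (hbar : IsBar D bar) {w : List I} (hw : IsRedW0 D w)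
    (a : Fin w.length → ℕ) : bar (pbw T w a) - pbw T w a ∈ LT T w a := by
  obtain ⟨t, ht, h⟩ := Sstep hT hbar w [] hw a
  have u1 : pbw T w a ∈ UA D := SS_UA hT hw.1 (pbw_mem_SS _ _)
  have u2 : bar (pbw T w a) - pbw T w a - t ∈ UA D :=
    (UA D).sub_mem ((UA D).sub_mem (bar_UA hbar u1) u1) (SS_UA hT hw.1 (LT_le _ _ ht))
  have h' : bar (pbw T w a) - pbw T w a - t ∈ EU D := h
  have := V1 (UA_Uminus u2) h'
  rw [sub_eq_zero.1 this]; exact ht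

end LeftB
end QProof


namespace QProof
noncomputable section RightA
set_option linter.unusedSectionVars false
set_option linter.unusedSimpArgs false
set_option linter.unusedVariables false
set_option linter.unusedTactic false
attribute [local instance] Semiring.toNatAlgebra Ring.toIntAlgebra

variable {I : Type} [Fintype I] [DecidableEq I] {D : ADEData I}
variable {T : I → (Uq D ≃ₐ[𝕂] Uq D)} {bar : Uq D →+* Uq D}

theorem w0_rev {w : List I} (hw : IsRedW0 D w) : IsRedW0 D w.reverse :=
  ⟨red_rev hw.1, fun w' h => by rw [List.length_reverse]; exact hw.2 w' h⟩

theorem w0_sq {w : List I} (hw : IsRedW0 D w) (v : I → ℤ) : wordAct D w (wordAct D w v) = v := by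
  conv_lhs => rw [w0_act hw (w0_rev hw)]
  rw [← w0_act hw (w0_rev hw)]
  conv_lhs => rw [w0_act hw (w0_rev hw)]
  rw [← w0_act hw (w0_rev hw)]
  have := act_rev (D := D) w v
  rwa [← w0_act hw (w0_rev hw)] at this

theorem ht_pos {v : I → ℤ} (h : 0 ≤ v) (h0 : v ≠ 0) : 1 ≤ ∑ k, v k := by
  by_contra hc
  have h1 : ∑ k, v k = 0 := le_antisymm (by omega) (Finset.sum_nonneg fun k _ => h k)
  apply h0
  ext k
  exact (Finset.sum_eq_zero_iff_of_nonneg fun k _ => h k).1 h1 k (Finset.mem_univ k)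

theorem star_ex {w : List I} (hw : IsRedW0 D w) (i : I) : ∃ j, wordAct D w (simpleRoot i) = -simpleRoot j := by
  set v := -wordAct D w (simpleRoot i) with hv
  have hv0 : 0 ≤ v := by rw [hv]; exact neg_nonneg.2 (w0_neg hw i)
  have hne : v ≠ 0 := by
    rw [hv, neg_ne_zero]; exact norm_ne_zero D (act_norm D _ _)
  have h1 : -wordAct D w v = simpleRoot i := by
    rw [hv, act_neg, neg_neg, w0_sq hw]
  have h2 : simpleRoot i = ∑ j, v j • (-wordAct D w (simpleRoot j)) := by
    rw [← h1]
    conv_lhs => rw [eq_sum_simple v, act_sum]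
    rw [← Finset.sum_neg_distrib]
    refine Finset.sum_congr rfl fun j _ => ?_
    rw [act_smul, smul_neg]
  have h3 : (1 : ℤ) = ∑ j, v j * ∑ k, (-wordAct D w (simpleRoot j)) k := by
    have e : ∑ k, (simpleRoot i : I → ℤ) k = 1 := by simp [simpleRoot]
    rw [← e, h2]
    simp only [Finset.sum_apply, Pi.smul_apply, smul_eq_mul, Finset.mul_sum]
    rw [Finset.sum_comm]
  have h4 : ∑ j, v j ≤ 1 := by
    rw [h3]
    refine Finset.sum_le_sum fun j _ => ?_
    have := ht_pos (v := -wordAct D w (simpleRoot j)) (neg_nonneg.2 (w0_neg hw j))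
      (by rw [neg_ne_zero]; exact norm_ne_zero D (act_norm D _ _))
    exact le_mul_of_one_le_right (hv0 j) this
  obtain ⟨j, hj⟩ : ∃ j, v j ≠ 0 := by
    by_contra hc; push Not at hc; exact hne (funext hc)
  refine ⟨j, ?_⟩
  have hj1 : 1 ≤ v j := by have := hv0 j; simp at this; omega
  have h5 : v = simpleRoot j := by
    have h6 : ∑ k, (v - simpleRoot j) k ≤ 0 := by
      have e : ∑ k, (simpleRoot j : I → ℤ) k = 1 := by simp [simpleRoot]
      simp only [Pi.sub_apply, Finset.sum_sub_distrib, e]; omega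
    have h7 : 0 ≤ v - simpleRoot j := by
      intro k
      have := hv0 k
      simp only [Pi.zero_apply, Pi.sub_apply, simpleRoot] at this ⊢
      split_ifs with hk
      · subst hk; omega
      · omega
    by_contra hc
    have := ht_pos h7 (sub_ne_zero.2 hc)
    omega
  rw [← h5, hv, neg_neg]

section star
variable {w : List I} {st : I → I}

theorem star_inv (hw : IsRedW0 D w) (hst : ∀ i, wordAct D w (simpleRoot i) = -simpleRoot (st i)) (i : I) :
    st (st i) = i := by
  have := w0_sq hw (simpleRoot i)
  rw [hst, act_neg, hst, neg_neg] at this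
  exact simple_inj this

theorem star_sref (hst : ∀ i, wordAct D w (simpleRoot i) = -simpleRoot (st i)) (i : I) (v : I → ℤ) :
    sref D (st i) (wordAct D w v) = wordAct D w (sref D i v) := by
  have h : pairing D (wordAct D w v) (st i) = - pairing D v i := by
    rw [← BF_simple_right, ← BF_simple_right, ← BF_act D w v, hst]
    have := BF_smul_right D (-1) (wordAct D w v) (simpleRoot (st i))
    rw [neg_one_smul] at this
    rw [this]; ring
  rw [sref_eq, sref_eq, act_sub, act_smul, hst, h]
  simp

theorem star_act (hst : ∀ i, wordAct D w (simpleRoot i) = -simpleRoot (st i)) (u : List I) (v : I → ℤ) :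
    wordAct D (u.map st) (wordAct D w v) = wordAct D w (wordAct D u v) := by
  induction u with
  | nil => rfl
  | cons i u ih => rw [List.map_cons, act_cons, act_cons, ih, star_sref hst]

theorem star_red (hw : IsRedW0 D w) (hst : ∀ i, wordAct D w (simpleRoot i) = -simpleRoot (st i)) {u : List I}
    (hu : IsReducedWord D u) : IsReducedWord D (u.map st) := by
  intro w' h
  have := hu (w'.map st) ?_
  · simpa using this
  ext1 v
  rw [← w0_sq hw v, star_act hst, h, ← star_act hst, List.map_map]
  congr 1
  rw [show st ∘ st = id from funext (star_inv hw hst), List.map_id]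

theorem star_w0 (hw : IsRedW0 D w) (hst : ∀ i, wordAct D w (simpleRoot i) = -simpleRoot (st i)) :
    IsRedW0 D (w.map st).reverse := by
  refine ⟨red_rev (star_red hw hst hw.1), fun w' h => ?_⟩
  rw [List.length_reverse, List.length_map]; exact hw.2 w' h

theorem su_root (hT : IsLusztigAuts D T) (hw : IsRedW0 D w)
    (hst : ∀ i, wordAct D w (simpleRoot i) = -simpleRoot (st i)) (x y : List I) (i : I) (e : w = x ++ i :: y) :
    su (TW T x (FF D i)) = TW T (y.map st).reverse (FF D (st i)) := by
  have h1 := TW_symm hT x.reverse (FF D i)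
  rw [su_F, List.reverse_reverse] at h1
  rw [← h1, AlgEquiv.symm_apply_eq, ← TW_append]
  have hwa : ∀ v, wordAct D w v = wordAct D x (sref D i (wordAct D y v)) := by
    intro v; rw [e, act_append, act_cons]
  have hA : ∀ v, wordAct D (x.reverse ++ (y.map st).reverse) (wordAct D w v) = sref D i v := by
    intro v
    rw [act_append, ← List.map_reverse, star_act hst, hwa, act_rev, rev_act]
  symm
  apply simple_lemma hT
  · refine red_congr hw.1 ?_ ?_
    · ext1 v
      rw [act_append, act_single, ← w0_sq hw v, star_sref hst, hA, sref_sref, w0_sq hw]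
    · rw [e]; simp
  · have h2 := hA (simpleRoot i)
    rw [hst, act_neg, sref_self] at h2
    exact neg_injective h2

def flip (w : List I) (st : I → I) (a : Fin w.length → ℕ) : Fin (w.map st).reverse.length → ℕ :=
  fun k => a ⟨w.length - 1 - k, by have := k.2; simp at this; omega⟩

def unflip (w : List I) (st : I → I) (c : Fin (w.map st).reverse.length → ℕ) : Fin w.length → ℕ :=
  fun k => c ⟨w.length - 1 - k, by have := k.2; simp; omega⟩

theorem flip_unflip (c : Fin (w.map st).reverse.length → ℕ) : flip w st (unflip w st c) = c := by
  ext k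
  unfold flip unflip
  congr 1
  ext
  have := k.2
  simp at this ⊢; omega

theorem su_prod (l : List (Uq D)) : su l.prod = (l.reverse.map su).prod := by
  induction l with
  | nil => simp [su_one]
  | cons a l ih => simp [su_mul, ih]

theorem su_pbw (hT : IsLusztigAuts D T) (hw : IsRedW0 D w)
    (hst : ∀ i, wordAct D w (simpleRoot i) = -simpleRoot (st i)) (a : Fin w.length → ℕ) :
    su (pbw T w a) = pbw T (w.map st).reverse (flip w st a) := by
  unfold pbw
  rw [su_prod]
  congr 1
  apply List.ext_getElem
  · simp
  intro n h1 h2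
  have hn : n < w.length := by simpa using h2
  simp only [List.getElem_map, List.getElem_reverse, List.getElem_finRange, List.length_map, List.length_finRange]
  rw [su_dp]
  congr 1
  unfold rootVec
  rw [← TW_apply, ← TW_apply]
  have hk : w.length - 1 - n < w.length := by omega
  have e : w = w.take (w.length - 1 - n) ++ w[w.length - 1 - n] :: w.drop (w.length - 1 - n + 1) := by
    rw [List.cons_getElem_drop_succ, List.take_append_drop]
  have := su_root hT hw hst _ _ _ e
  refine Eq.trans rfl (this.trans ?_)
  have hn' : n < (w.map st).reverse.length := by simpa using hn
  change _ = TW T ((w.map st).reverse.take n) (FF D ((w.map st).reverse[n]))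
  have e1 : (List.map st (List.drop (w.length - 1 - n + 1) w)).reverse = (w.map st).reverse.take n := by
    rw [List.take_reverse, List.map_drop, List.length_map]
    congr 2
    omega
  have e2 : (w.map st).reverse[n] = st w[w.length - 1 - n] := by simp
  rw [e1, e2]

def RT (T : I → (Uq D ≃ₐ[𝕂] Uq D)) (v : List I) (a : Fin v.length → ℕ) : Sub D :=
  Submodule.span ↥LA {u | ∃ c, LtRight c a ∧ u = pbw T v c}

theorem LR {a c' : Fin w.length → ℕ} (h : LtLeft (flip w st c') (flip w st a)) : LtRight c' a := by
  obtain ⟨k, hk, hk'⟩ := h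
  have hk2 := k.2
  simp at hk2
  refine ⟨_, hk, ?_⟩
  intro l hl
  have hl' : w.length - 1 - k.1 < l.1 := hl
  have := l.2
  have h2 := hk' ⟨w.length - 1 - l.1, by simp; omega⟩ (by change w.length - 1 - l.1 < k.1; omega)
  unfold flip at h2
  have e : (⟨w.length - 1 - (w.length - 1 - l.1), by omega⟩ : Fin w.length) = l := by ext; simp; omega
  simp only [e] at h2
  exact h2

theorem right_final (hT : IsLusztigAuts D T) (hbar : IsBar D bar) (hw : IsRedW0 D w)
    (a : Fin w.length → ℕ) : bar (pbw T w a) - pbw T w a ∈ RT T w a := by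
  choose st hst using star_ex hw
  have hL := left_final hT hbar (star_w0 hw hst) (flip w st a)
  have u1 : pbw T w a ∈ UA D := SS_UA hT hw.1 (pbw_mem_SS _ _)
  rw [← su_pbw hT hw hst, bar_su hbar u1, ← map_sub] at hL
  rw [← su_su (bar (pbw T w a) - pbw T w a)]
  generalize su (bar (pbw T w a) - pbw T w a) = y at hL
  unfold LT at hL
  induction hL using Submodule.span_induction with
  | mem x hx =>
    obtain ⟨c, hc, rfl⟩ := hx
    rw [← flip_unflip c] at hc ⊢
    rw [← su_pbw hT hw hst, su_su]
    exact Submodule.subset_span ⟨_, LR hc, rfl⟩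
  | zero => rw [map_zero]; exact Submodule.zero_mem _
  | add x y _ _ hx hy => rw [map_add]; exact Submodule.add_mem _ hx hy
  | smul c x _ hx =>
    change su ((c:𝕂) • x) ∈ _
    rw [map_smul]; exact Submodule.smul_mem _ c hx
end star

end RightA
end QProof


namespace QProof
noncomputable section FinalA
set_option linter.unusedSectionVars false
set_option linter.unusedSimpArgs false
set_option linter.unusedVariables false
set_option linter.unusedTactic false
attribute [local instance] Semiring.toNatAlgebra Ring.toIntAlgebra

variable {I : Type} [Fintype I] [DecidableEq I] {D : ADEData I}
variable {T : I → (Uq D ≃ₐ[𝕂] Uq D)} {bar : Uq D →+* Uq D}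

/-! ### weights -/
theorem GW_one (G : I → Uq D) : (1 : Uq D) ∈ GW G 0 :=
  Submodule.subset_span ⟨[], by simp, by simp⟩

theorem GW_dp (G : I → Uq D) {μ : I → ℤ} {u : Uq D} (hu : u ∈ GW G μ) (n : ℕ) : dp u n ∈ GW G ((n : ℤ) • μ) := by
  refine Submodule.smul_mem _ _ ?_
  induction n with
  | zero => rw [pow_zero, Nat.cast_zero, zero_smul]; exact GW_one G
  | succ n ih =>
    rw [pow_succ, Nat.cast_succ, add_smul, one_smul]; exact GW_mul G ih hu

theorem GW_list (G : I → Uq D) {ι : Type} (f : ι → Uq D) (μ : ι → I → ℤ) (h : ∀ k, f k ∈ GW G (μ k)) (l : List ι) :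
    (l.map f).prod ∈ GW G (l.map μ).sum := by
  induction l with
  | nil => exact GW_one G
  | cons a l ih => rw [List.map_cons, List.map_cons, List.prod_cons, List.sum_cons]; exact GW_mul G (h a) ih

theorem pbw_GW (hT : IsLusztigAuts D T) {w : List I} (hw : IsReducedWord D w) (a : Fin w.length → ℕ) :
    pbw T w a ∈ GW (FF D) (wtData D w a) := by
  unfold wtData
  rw [Fin.sum_univ_def]
  unfold pbw
  apply GW_list
  intro k
  apply GW_dp
  unfold rootVec beta
  rw [← TW_apply]
  refine (TW_GW hT _ _ ?_).1
  have e : w = w.take k ++ [w.get k] ++ w.drop (k + 1) := by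
    rw [List.append_assoc, List.singleton_append, List.get_eq_getElem, List.cons_getElem_drop_succ, List.take_append_drop]
  rw [e] at hw
  exact red_left hw

/-! ### linear independence -/
theorem KpowE (i : I) (n : ℕ) : ∃ c : 𝕂, c ≠ 0 ∧ KK D i ^ n * EE D i = c • (EE D i * KK D i ^ n) := by
  induction n with
  | zero => exact ⟨1, one_ne_zero, by rw [pow_zero, one_mul, mul_one, one_smul]⟩
  | succ n ih =>
    obtain ⟨c, hc, e⟩ := ih
    refine ⟨qq ^ cartan D i i * c, mul_ne_zero (zpow_ne_zero _ qq_ne) hc, ?_⟩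
    rw [pow_succ, mul_assoc, K_E, mul_smul_comm, ← mul_assoc, e, smul_mul_assoc, smul_smul, mul_assoc]

theorem EKpow (i : I) (n : ℕ) : ∃ c : 𝕂, c ≠ 0 ∧ (EE D i * KK D i) ^ n = c • (EE D i ^ n * KK D i ^ n) := by
  induction n with
  | zero => exact ⟨1, one_ne_zero, by simp⟩
  | succ n ih =>
    obtain ⟨c, hc, e⟩ := ih
    obtain ⟨d, hd, e2⟩ := KpowE (D := D) i n
    refine ⟨c * d, mul_ne_zero hc hd, ?_⟩
    rw [pow_succ, e, smul_mul_assoc, mul_assoc, ← mul_assoc (KK D i ^ n), e2, smul_mul_assoc, mul_smul_comm, smul_smul,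
      pow_succ, pow_succ]
    simp only [mul_assoc]

theorem Tsymm_dp (hT : IsLusztigAuts D T) (i : I) (n : ℕ) :
    ∃ c : 𝕂, c ≠ 0 ∧ (T i).symm (dp (FF D i) n) = c • (EE D i ^ n * KK D i ^ n) := by
  obtain ⟨c, hc, e⟩ := EKpow (D := D) i n
  refine ⟨(qFact n)⁻¹ * ((-1) ^ n * c), mul_ne_zero (inv_ne_zero (qFact_ne n)) (mul_ne_zero (pow_ne_zero _ (by norm_num)) hc), ?_⟩
  rw [dp, map_smul, map_pow, Tsymm_F_self hT, smul_pow, e, smul_smul, smul_smul]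
  congr 1; ring

theorem pbw_Um (hT : IsLusztigAuts D T) {w : List I} (hw : IsReducedWord D w) (a : Fin w.length → ℕ) :
    pbw T w a ∈ Uminus D := UA_Uminus (SS_UA hT hw (pbw_mem_SS _ _))

theorem tail_inj {n m : ℕ} {a b : Fin (n + 1) → ℕ} (ha : a 0 = m) (hb : b 0 = m) (h : Fin.tail a = Fin.tail b) : a = b := by
  rw [← Fin.cons_self_tail a, ← Fin.cons_self_tail b, h, ha, hb]

theorem pbw_li (hT : IsLusztigAuts D T) (w : List I) (hw : IsReducedWord D w) : LinearIndependent 𝕂 (pbw T w) := by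
  induction w with
  | nil =>
    rw [linearIndependent_iff']
    intro s g h a ha
    have hone : (1 : Uq D) ≠ 0 := by
      intro h0
      have h1 : (1 : PP D) = 0 := by
        have h2 := ra_one (D := D) (1 : PP D)
        rw [h0, ra_zero] at h2
        exact h2.symm
      have h3 := congrArg (plift (D := D) (A := 𝕂) (fun _ => 0) (by intros; simp) (by intros; simp)) h1
      rw [map_one, map_zero] at h3
      exact one_ne_zero h3
    have e : ∀ b : Fin ([] : List I).length → ℕ, b = a := fun b => Subsingleton.elim (α := Fin 0 → ℕ) b a
    have hs : s = {a} := by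
      ext b; rw [e b]; simp [ha]
    rw [hs, Finset.sum_singleton, pbw_nil] at h
    exact (smul_eq_zero.1 h).resolve_right hone
  | cons i w ih =>
    have hwr : IsReducedWord D w := red_right (x := [i]) hw
    replace ih := ih hwr
    choose κ hκ eκ using Tsymm_dp hT i
    have key : ∀ (s : Finset (Fin (w.length + 1) → ℕ)) (g : (Fin (w.length + 1) → ℕ) → 𝕂),
        ∑ a ∈ s, g a • pbw T (i :: w) a = 0 → ∀ a ∈ s, g a = 0 := by
      intro s g h a ha
      have h1 : ∑ a ∈ s, (κ (a 0) * g a) • (EE D i ^ (a 0) * KK D i ^ (a 0) * pbw T w (Fin.tail a)) = 0 := by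
        have h2 := congrArg (T i).symm h
        rw [map_sum, map_zero] at h2
        rw [← h2]
        refine Finset.sum_congr rfl fun a _ => ?_
        rw [pbw_cons, map_smul, map_mul, AlgEquiv.symm_apply_apply, eκ, smul_mul_assoc, smul_smul, mul_comm]
      have h3 : ∑ n ∈ s.image (fun a => a 0), EE D i ^ n * KK D i ^ n *
          (∑ a ∈ s with a 0 = n, (κ n * g a) • pbw T w (Fin.tail a)) = 0 := by
        rw [← h1, ← Finset.sum_fiberwise_of_maps_to (g := fun a : Fin (w.length + 1) → ℕ => a 0)
          (fun a ha => Finset.mem_image_of_mem (fun a : Fin (w.length + 1) → ℕ => a 0) ha)]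
        refine Finset.sum_congr rfl fun n _ => ?_
        rw [Finset.mul_sum]
        refine Finset.sum_congr rfl fun a ha => ?_
        rw [(Finset.mem_filter.1 ha).2, mul_smul_comm]
      have h4 := Ind i _ _ (fun n => Subalgebra.sum_mem _ fun a _ => Subalgebra.smul_mem _ (pbw_Um hT hwr _) _) h3 (a 0)
        (Finset.mem_image_of_mem (fun a : Fin (w.length + 1) → ℕ => a 0) ha)
      have h5 : LinearIndependent 𝕂 (fun b : {b : Fin (w.length + 1) → ℕ // b 0 = a 0} => pbw T w (Fin.tail b.1)) := by
        refine ih.comp (fun b : {b : Fin (w.length + 1) → ℕ // b 0 = a 0} => Fin.tail b.1) ?_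
        intro b c hbc
        exact Subtype.ext (tail_inj b.2 c.2 hbc)
      rw [linearIndependent_iff'] at h5
      have h6 := h5 (s.subtype (fun b => b 0 = a 0)) (fun b => κ (a 0) * g b.1) (by
        rw [← h4]
        exact Finset.sum_subtype_eq_sum_filter (s := s) (p := fun b => b 0 = a 0)
          (fun b => (κ (a 0) * g b) • pbw T w (Fin.tail b))) ⟨a, rfl⟩ (by simpa using ha)
      exact (mul_eq_zero.1 h6).resolve_left (hκ _)
    exact linearIndependent_iff'.2 key

/-! ### final assembly -/
theorem bar_zq (hbar : IsBar D bar) (n : ℤ) (u : Uq D) : bar (qq ^ n • u) = qq ^ (-n) • bar u := by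
  have hnat : ∀ (n : ℕ) (u : Uq D), bar (qq ^ (n : ℤ) • u) = qq ^ (-(n : ℤ)) • bar u := by
    intro n u
    rw [Algebra.smul_def, map_mul, zpow_natCast, bar_qpow hbar, ← Algebra.smul_def, inv_pow, zpow_neg, zpow_natCast]
  rcases Int.eq_nat_or_neg n with ⟨m, rfl | rfl⟩
  · exact hnat m u
  · have h := hnat m (qq ^ (-(m : ℤ)) • u)
    rw [smul_smul, ← zpow_add₀ qq_ne, add_neg_cancel, zpow_zero, one_smul] at h
    rw [h, smul_smul, ← zpow_add₀ qq_ne]; simp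

theorem bar_K (hbar : IsBar D bar) {m : ℤ} {u : Uq D} (k : I) (h : KK D k * u = qq ^ m • (u * KK D k)) :
    KK D k * bar u = qq ^ m • (bar u * KK D k) := by
  have h1 := congrArg bar h
  rw [map_mul, bar_zq hbar, map_mul, hbar.2.2.1] at h1
  have h2 := congrArg (fun z => qq ^ m • (KK D k * z * KK D k)) h1
  simp only [mul_smul_comm, smul_mul_assoc, smul_smul, ← zpow_add₀ qq_ne, add_neg_cancel, zpow_zero, one_smul] at h2
  rw [← mul_assoc, KKi, one_mul, mul_assoc, mul_assoc, KiK, mul_one] at h2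
  exact h2.symm

theorem span_coef (w : List I) (S : (Fin w.length → ℕ) → Prop) {u : Uq D}
    (hu : u ∈ Submodule.span ↥LA {u | ∃ c, S c ∧ u = pbw T w c}) :
    ∃ p : (Fin w.length → ℕ) →₀ 𝕂, u = p.sum (fun a' c => c • pbw T w a') ∧ ∀ a' ∈ p.support, S a' ∧ IsLaurent (p a') := by
  suffices h : ∃ p : (Fin w.length → ℕ) →₀ 𝕂, u = p.sum (fun a' c => c • pbw T w a') ∧ ∀ a', (p a' ≠ 0 → S a') ∧ p a' ∈ LA by
    obtain ⟨p, h1, h2⟩ := h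
    exact ⟨p, h1, fun a' ha => ⟨(h2 a').1 (Finsupp.mem_support_iff.1 ha), (h2 a').2⟩⟩
  induction hu using Submodule.span_induction with
  | mem x hx =>
    obtain ⟨c, hc, rfl⟩ := hx
    refine ⟨Finsupp.single c 1, by rw [Finsupp.sum_single_index (by rw [zero_smul]), one_smul], fun a' => ?_⟩
    rw [Finsupp.single_apply]
    split_ifs with h
    · subst h; exact ⟨fun _ => hc, LA.one_mem⟩
    · exact ⟨fun h => absurd rfl h, LA.zero_mem⟩
  | zero => exact ⟨0, by rw [Finsupp.sum_zero_index], fun a' => ⟨fun h => absurd rfl h, LA.zero_mem⟩⟩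
  | add x y _ _ hx hy =>
    obtain ⟨p, rfl, hp⟩ := hx
    obtain ⟨r, rfl, hr⟩ := hy
    refine ⟨p + r, ?_, fun a' => ⟨?_, LA.add_mem (hp a').2 (hr a').2⟩⟩
    · exact (Finsupp.sum_add_index' (h := fun a' (c : 𝕂) => c • pbw T w a') (fun _ => zero_smul _ _) (fun _ _ _ => add_smul _ _ _)).symm
    · intro h
      by_cases h1 : p a' = 0
      · apply (hr a').1
        intro h2; apply h; rw [Finsupp.add_apply, h1, h2, add_zero]
      · exact (hp a').1 h1
  | smul c x _ hx =>
    obtain ⟨p, rfl, hp⟩ := hx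
    refine ⟨(c : 𝕂) • p, ?_, fun a' => ⟨?_, LA.mul_mem c.2 (hp a').2⟩⟩
    · change (c : 𝕂) • (p.sum fun a' (c : 𝕂) => c • pbw T w a') = _
      rw [Finsupp.sum_smul_index' (h := fun a' (c : 𝕂) => c • pbw T w a') (fun _ => zero_smul _ _), Finsupp.smul_sum]
      simp only [smul_eq_mul, mul_smul]
    · intro h
      apply (hp a').1
      intro h2; apply h; rw [Finsupp.smul_apply, h2, smul_zero]

theorem wt_eq {μ ν : I → ℤ} (h : ∀ k, pairing D μ k = pairing D ν k) : μ = ν := by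
  by_contra hc
  have h1 := BF_pos D (μ - ν) (sub_ne_zero.2 hc)
  have h2 : BF D (μ - ν) (μ - ν) = 0 := by
    unfold BF
    refine Finset.sum_eq_zero fun k _ => ?_
    rw [pairing_sub, h k, sub_self, mul_zero]
  omega

theorem main (hT : IsLusztigAuts D T) (hbar : IsBar D bar) (w : List I) (hw : IsRedW0 D w) (a : Fin w.length → ℕ) :
    ∃ p : (Fin w.length → ℕ) →₀ 𝕂,
      bar (pbw T w a) = pbw T w a + p.sum (fun a' c => c • pbw T w a') ∧
      ∀ a' ∈ p.support, Prec D w a' a ∧ IsLaurent (p a') := by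
  obtain ⟨p, h1, h2⟩ := span_coef w _ (left_final hT hbar hw a)
  obtain ⟨r, h3, h4⟩ := span_coef w _ (right_final hT hbar hw a)
  have hli := pbw_li hT w hw.1
  have hpr : p = r := by
    apply hli
    exact h1.symm.trans h3
  subst hpr
  refine ⟨p, by rw [← h1]; abel, fun b hb => ⟨⟨?_, (h2 b hb).1, (h4 b hb).1⟩, (h2 b hb).2⟩⟩
  apply wt_eq (D := D)
  intro k
  have ga := GW_K (pbw_GW hT hw.1 a) k
  have gd : KK D k * (bar (pbw T w a) - pbw T w a) =
      qq ^ (-pairing D (wtData D w a) k) • ((bar (pbw T w a) - pbw T w a) * KK D k) := by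
    rw [mul_sub, sub_mul, bar_K hbar k ga, ga]; module
  have hz : ∑ c ∈ p.support, (p c * (qq ^ (-pairing D (wtData D w c) k) - qq ^ (-pairing D (wtData D w a) k))) • pbw T w c = 0 := by
    have e1 : (∑ c ∈ p.support, (p c * (qq ^ (-pairing D (wtData D w c) k) - qq ^ (-pairing D (wtData D w a) k))) • pbw T w c) * KK D k = 0 := by
      rw [h1, Finsupp.sum, Finset.mul_sum, Finset.sum_mul, Finset.smul_sum, ← sub_eq_zero, ← Finset.sum_sub_distrib] at gd
      rw [← gd, Finset.sum_mul]
      refine Finset.sum_congr rfl fun c _ => ?_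
      rw [mul_smul_comm, GW_K (pbw_GW hT hw.1 c) k, smul_mul_assoc, smul_mul_assoc]
      module
    have e2 := congrArg (· * KKinv D k) e1
    simp only [zero_mul] at e2
    rwa [mul_assoc, KKi, mul_one] at e2
  have h6 := linearIndependent_iff'.1 hli _ _ hz b hb
  have h7 := (mul_eq_zero.1 h6).resolve_left (Finsupp.mem_support_iff.1 hb)
  exact neg_injective (qq_zpow_inj (sub_eq_zero.1 h7))

end FinalA
end QProof

/-- (Unitriangularity of the bar involution.) For every
reduced expression `i` of `w₀` and Lusztig datum `a`,
`bar(F^a) = F^a + Σ_{a' ≺ a} p^a_{a'}(q) F^{a'}` with the `p^a_{a'}` Laurent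
polynomials in `q`. -/
theorem bar_unitriangular_on_pbw
    {I : Type} [Fintype I] [DecidableEq I] (D : ADEData I)
    (T : I → (Uq D ≃ₐ[𝕂] Uq D)) (hT : IsLusztigAuts D T)
    (bar : Uq D →+* Uq D) (hbar : IsBar D bar)
    (w : List I) (hw : IsRedW0 D w) (a : Fin w.length → ℕ) :
    ∃ p : (Fin w.length → ℕ) →₀ 𝕂,
      bar (pbw T w a) = pbw T w a + p.sum (fun a' c => c • pbw T w a') ∧
      ∀ a' ∈ p.support, Prec D w a' a ∧ IsLaurent (p a') := by
  exact QProof.main hT hbar w hw a
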